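/- Assume n = 3. Let ν be a real k-valuation of K with residue field κ_ν = k, let L ⊂ Der_k K be a foliation by lines, and suppose that, for a projective model M₀ with center P regular, some f̂ ∈ Ô_{M₀,P} has transversal maximal contact with ν. Then there is a finite composition of blow-ups with non-singular centers M → M₀ such that L is log-elementary at the center P of ν in M. -/

import Mathlib

/-!
Framework for formalizing "Local Uniformization of foliations for rational
archimedean valuations / reduction of singularities of codimension one
foliations in dimension three" (Cano–Roche–Spivakovsky style statements).

We encode local rings of points of models of a function field `K/k` as subrings
of `K`, valuations as additive `Γ`-valued functions trivial on `k`, foliations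
by lines as one–dimensional spaces of `k`-derivations of `K` (given by a
nonzero generator), and the transformations of the paper (coordinate changes,
coordinate blow-ups with codimension two centers, Puiseux packages, local
blow-ups with non-singular centers, étale Puiseux packages) relationally.
-/

noncomputable section

namespace FoliationLU

open scoped Classical

variable {k K : Type} [Field k] [Field K] [Algebra k K]

/-! ### Local algebra of subrings of a field -/

/-- `a` is a non-unit of the subring `O` of the field `K` (i.e. it belongs to `O`
and is not invertible in `O`); for a local subring these are exactly the elements
of the maximal ideal. -/
def Nonunit (O : Subring K) (a : K) : Prop :=
  a ∈ O ∧ (a = 0 ∨ a⁻¹ ∉ O)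

/-- The maximal ideal (set of non-units) of a local subring of `K`. -/
def maxIdealSet (O : Subring K) : Set K := {a : K | Nonunit O a}

/-- The set underlying the ideal of `O` generated by a subset `s ⊆ K`. -/
def idealSpanSet (O : Subring K) (s : Set K) : Set K :=
  {a : K | ∃ (m : ℕ) (c g : Fin m → K), (∀ i, c i ∈ O) ∧ (∀ i, g i ∈ s) ∧ a = ∑ i, c i * g i}

/-- The square of the maximal ideal of a local subring of `K`. -/
def sqMaxIdealSet (O : Subring K) : Set K :=
  idealSpanSet O {u : K | ∃ a b : K, Nonunit O a ∧ Nonunit O b ∧ u = a * b}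

/-- Powers of the maximal ideal of a local subring of `K`. -/
def maxIdealPow (O : Subring K) : ℕ → Set K
  | 0 => (O : Set K)
  | m + 1 => idealSpanSet O {u : K | ∃ a b : K, Nonunit O a ∧ b ∈ maxIdealPow O m ∧ u = a * b}

/-- `z` is a regular system of parameters of the (regular) local subring `O` of `K`:
it generates the maximal ideal and its classes modulo the square of the maximal
ideal are linearly independent. -/
structure IsRSP (O : Subring K) {m : ℕ} (z : Fin m → K) : Prop where
  mem : ∀ i, Nonunit O (z i)
  gen : maxIdealSet O ⊆ idealSpanSet O (Set.range z)
  indepMod : ∀ c : Fin m → K, (∀ i, c i ∈ O) →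
    (∑ i, c i * z i) ∈ sqMaxIdealSet O → ∀ i, Nonunit O (c i)

/-- `w` is part of a regular system of parameters of `O`. -/
def PartOfRSP (O : Subring K) {m : ℕ} (w : Fin m → K) : Prop :=
  ∃ (m' : ℕ) (h : m ≤ m') (z : Fin m' → K), IsRSP O z ∧ ∀ i : Fin m, z (Fin.castLE h i) = w i

/-- The subring of `K` generated by `O` and a subset `s`. -/
def ringAdjoin (O : Subring K) (s : Set K) : Subring K :=
  Subring.closure ((O : Set K) ∪ s)

/-- `K` is the field of rational functions of a projective algebraic variety of
dimension `n` over `k`: it is a finitely generated field extension of `k` of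
transcendence degree `n`. -/
def IsFunctionField (k K : Type) [Field k] [Field K] [Algebra k K] (n : ℕ) : Prop :=
  (∃ s : Finset K, IntermediateField.adjoin k (s : Set K) = ⊤) ∧
    ∃ x : Fin n → K, IsTranscendenceBasis k x

/-- `O` is the local ring `𝒪_{M,P}` of a point `P` of a model `M` of `K` over `k`:
a local subring of `K` containing `k`, with fraction field `K`, essentially of
finite type over `k`. -/
structure IsLocalModel (k : Type) {K : Type} [Field k] [Field K] [Algebra k K]
    (O : Subring K) : Prop where
  isLocal : ∀ a b : K, Nonunit O a → Nonunit O b → Nonunit O (a + b)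
  algk : ∀ c : k, algebraMap k K c ∈ O
  frac : ∀ u : K, ∃ a b : K, a ∈ O ∧ b ∈ O ∧ b ≠ 0 ∧ u = a / b
  essFinType : ∃ s : Finset K, (s : Set K) ⊆ (O : Set K) ∧
    ∀ a ∈ O, ∃ p q : K, p ∈ Algebra.adjoin k (s : Set K) ∧ q ∈ Algebra.adjoin k (s : Set K) ∧
      q ∈ O ∧ ¬ Nonunit O q ∧ a * q = p

/-! ### Derivations and foliations by lines -/

/-- `ξ : K → K` is a `k`-derivation of `K`. -/
structure IsKDerivation (k : Type) {K : Type} [Field k] [Field K] [Algebra k K]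
    (ξ : K → K) : Prop where
  map_add : ∀ a b : K, ξ (a + b) = ξ a + ξ b
  leibniz : ∀ a b : K, ξ (a * b) = a * ξ b + b * ξ a
  map_algebra : ∀ c : k, ξ (algebraMap k K c) = 0

/-- A foliation by lines `ℒ ⊆ Der_k K`: a one-dimensional `K`-vector subspace of the
space of `k`-derivations of `K`, recorded through a nonzero generator. -/
structure FoliationByLines (k K : Type) [Field k] [Field K] [Algebra k K] where
  gen : K → K
  isDer : IsKDerivation k gen
  ne : gen ≠ 0

/-- Membership in the foliation by lines (the `K`-multiples of the generator). -/
def FoliationByLines.Mem (L : FoliationByLines k K) (ξ : K → K) : Prop :=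
  ∃ c : K, ξ = fun a => c * L.gen a

/-- `ξ` preserves `O`; `ξ ∈ Der_k 𝒪` and membership in `ℒ` together express
`ξ ∈ ℒ_{M,P} = ℒ ∩ Der_k 𝒪_{M,P}`. -/
def MapsInto (O : Subring K) (ξ : K → K) : Prop := ∀ a ∈ O, ξ a ∈ O

/-- The foliation (given by the membership predicate `Mem`) is log-elementary at the
local ring `O`: there exist a regular system of parameters `z₁,…,z_m` of `O`, an
integer `0 ≤ e ≤ m`, and `ξ` in the local foliation of the form
`ξ = ∑_{i≤e} a_i z_i ∂/∂z_i + ∑_{i>e} a_i ∂/∂z_i` with some `a_j ∉ M²`. -/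
def LogElementaryAt {K : Type} [Field K] (Mem : (K → K) → Prop) (O : Subring K) : Prop :=
  ∃ (m e : ℕ), e ≤ m ∧ ∃ z : Fin m → K, IsRSP O z ∧
    ∃ ξ : K → K, Mem ξ ∧ MapsInto O ξ ∧
      ∃ a : Fin m → K, (∀ i, a i ∈ O) ∧
        (∀ i : Fin m, (i.val < e → ξ (z i) = a i * z i) ∧ (e ≤ i.val → ξ (z i) = a i)) ∧
        ∃ j : Fin m, a j ∉ sqMaxIdealSet O

/-- The foliation is non-singular at `O` : `ℒ_O ⊄ M·Der_k O`. -/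
def NonSingularAt {K : Type} [Field K] (Mem : (K → K) → Prop) (O : Subring K) : Prop :=
  ∃ (m : ℕ) (z : Fin m → K), IsRSP O z ∧
    ∃ ξ : K → K, Mem ξ ∧ MapsInto O ξ ∧ ∃ i : Fin m, ¬ Nonunit O (ξ (z i))

/-- The foliation is elementary at `O`: some `ξ` in the local foliation has a
non-nilpotent linear part `M/M² → M/M²`, recorded through its residue matrix `C`. -/
def ElementaryAt (k : Type) {K : Type} [Field k] [Field K] [Algebra k K]
    (Mem : (K → K) → Prop) (O : Subring K) : Prop :=
  ∃ (m : ℕ) (z : Fin m → K), IsRSP O z ∧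
    ∃ ξ : K → K, Mem ξ ∧ MapsInto O ξ ∧
      ∃ C : Matrix (Fin m) (Fin m) k, ¬ IsNilpotent C ∧
        ∀ i, ξ (z i) - ∑ j, algebraMap k K (C i j) * z j ∈ sqMaxIdealSet O

/-! ### k-valuations -/

/-- An (additively written) `k`-valuation of `K` with value group inside `Γ`
(for `Γ = ℝ` this is a *real* valuation of rank one). The value `v 0` is junk. -/
structure KValuation (k K : Type) [Field k] [Field K] [Algebra k K]
    (Γ : Type) [AddCommGroup Γ] [LinearOrder Γ] [IsOrderedAddMonoid Γ] where
  v : K → Γ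
  map_mul' : ∀ x y : K, x ≠ 0 → y ≠ 0 → v (x * y) = v x + v y
  map_add' : ∀ x y : K, x ≠ 0 → y ≠ 0 → x + y ≠ 0 → min (v x) (v y) ≤ v (x + y)
  trivial' : ∀ c : k, c ≠ 0 → v (algebraMap k K c) = 0
  nontrivial' : ∃ x : K, x ≠ 0 ∧ v x ≠ 0

variable {Γ : Type} [AddCommGroup Γ] [LinearOrder Γ] [IsOrderedAddMonoid Γ]

/-- The residue field `κ_ν` of `ν` is (the image of) `k`. -/
def KValuation.ResidueFieldIsK (ν : KValuation k K Γ) : Prop :=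
  ∀ x : K, x ≠ 0 → ν.v x = 0 →
    ∃ c : k, c ≠ 0 ∧ (x = algebraMap k K c ∨ 0 < ν.v (x - algebraMap k K c))

/-- `ν` has rational rank `r`: `r` is the maximal number of `ℤ`-linearly independent
elements of the value group of `ν`. -/
def KValuation.HasRationalRank (ν : KValuation k K Γ) (r : ℕ) : Prop :=
  (∃ x : Fin r → K, (∀ i, x i ≠ 0) ∧ LinearIndependent ℤ fun i => ν.v (x i)) ∧
    ¬ ∃ x : Fin (r + 1) → K, (∀ i, x i ≠ 0) ∧ LinearIndependent ℤ fun i => ν.v (x i)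

/-- The point with local ring `O` is the center of `ν` (the valuation ring of `ν`
dominates `O`). -/
structure CenteredAt (ν : KValuation k K Γ) (O : Subring K) : Prop where
  nonneg : ∀ a ∈ O, a ≠ 0 → 0 ≤ ν.v a
  pos_iff : ∀ a : K, a ∈ O → a ≠ 0 → (Nonunit O a ↔ 0 < ν.v a)

/-- `O'` is the localization of the subring `A ⊆ K` at the center of `ν`. -/
def IsLocOf (ν : KValuation k K Γ) (O' A : Subring K) : Prop :=
  (A : Set K) ⊆ (O' : Set K) ∧
    ∀ u ∈ O', ∃ a b : K, a ∈ A ∧ b ∈ A ∧ b ≠ 0 ∧ ν.v b = 0 ∧ u = a / b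

/-- One step of a blow-up with non-singular center, followed along the valuation `ν`:
either the center does not pass through the point (`O' = O`), or we blow up the
closed point, or a non-singular center cut out by part of a regular system of
parameters, and localize at the center of `ν`. -/
def LocalBlowUpStep (ν : KValuation k K Γ) (O O' : Subring K) : Prop :=
  O' = O ∨
    (∃ b : K, Nonunit O b ∧ b ≠ 0 ∧
      IsLocOf ν O' (ringAdjoin O {u : K | ∃ a : K, Nonunit O a ∧ u = a / b})) ∨
    ∃ (m' m : ℕ) (z : Fin m' → K), IsRSP O z ∧ 0 < m ∧ m ≤ m' ∧
      ∃ i₀ : Fin m', i₀.val < m ∧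
        IsLocOf ν O' (ringAdjoin O {u : K | ∃ i : Fin m', i.val < m ∧ u = z i / z i₀})

/-- A formal series `f̂ ∈ Ô` (given by the Krull-convergent sequence of its truncations
`f i ∈ O`, of strictly increasing values) has *transversal maximal contact* with `ν` :
there is a part `x₁,…,x_r` of a regular system of parameters of `O` with
`ν(x₁),…,ν(x_r)` `ℤ`-linearly independent such that `x₁,…,x_r, f̂` is part of a regular
system of parameters of the completion `Ô`. -/
def TransversalMaxContact (ν : KValuation k K Γ) (O : Subring K) (r : ℕ) : Prop :=
  ∃ f : ℕ → K, (∀ i, f i ∈ O) ∧ (∀ i, ν.v (f i) < ν.v (f (i + 1))) ∧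
    (∀ m : ℕ, ∃ N : ℕ, ∀ i, N ≤ i → f (i + 1) - f i ∈ maxIdealPow O m) ∧
    ∃ x : Fin r → K, PartOfRSP O x ∧ (LinearIndependent ℤ fun i => ν.v (x i)) ∧
      ∃ N : ℕ, ∀ i, N ≤ i → PartOfRSP O (Fin.snoc x (f i))

/-! ### Projective models (Zariski–Riemann style) -/

/-- The local ring `O` is dominated by the valuation subring `V`. -/
def DominatedByVS (O : Subring K) (V : ValuationSubring K) : Prop :=
  (O : Set K) ⊆ (V : Set K) ∧ ∀ a : K, Nonunit O a → a = 0 ∨ a⁻¹ ∉ (V : Set K)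

/-- A projective (complete) model of `K` over `k`, encoded by the set of local rings
of its points: each is a local model, and every `k`-valuation of `K` has exactly one
center on it (valuative criterion of properness). -/
structure IsProjModel (k : Type) {K : Type} [Field k] [Field K] [Algebra k K]
    (M : Set (Subring K)) : Prop where
  nonempty : M.Nonempty
  localModels : ∀ O ∈ M, IsLocalModel k O
  complete : ∀ V : ValuationSubring K, (∀ c : k, algebraMap k K c ∈ V) →
    ∃ O ∈ M, DominatedByVS O V
  separated : ∀ V : ValuationSubring K, (∀ c : k, algebraMap k K c ∈ V) →
    ∀ O₁ ∈ M, DominatedByVS O₁ V → ∀ O₂ ∈ M, DominatedByVS O₂ V → O₁ = O₂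

/-! ### Parameterized regular local models -/

/-- A parameterized regular local model `𝒜 = (𝒪, z = (x, y))` for `K, ν` : the local
ring at the center of `ν` on a model, together with a regular system of parameters
`z = (x₁,…,x_r, y_{r+1},…,y_n)` such that `ν(x₁),…,ν(x_r)` are `ℤ`-linearly
independent. -/
structure PRLM (k K : Type) [Field k] [Field K] [Algebra k K]
    (Γ : Type) [AddCommGroup Γ] [LinearOrder Γ] [IsOrderedAddMonoid Γ] (ν : KValuation k K Γ) (n r : ℕ) where
  O : Subring K
  z : Fin n → K
  hr : r ≤ n
  isLocal : ∀ a b : K, Nonunit O a → Nonunit O b → Nonunit O (a + b)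
  algk : ∀ c : k, algebraMap k K c ∈ O
  rsp : IsRSP O z
  centered : CenteredAt ν O
  indepVals : LinearIndependent ℤ fun i : Fin r => ν.v (z (Fin.castLE hr i))

variable {n r : ℕ}

/-- A `j`-coordinate change in the dependent variables: `y'_j = y_j - c·xᵃ` (value
non-decreasing) or `y'_j = y_j + y_s`. -/
def IsCoordChange (ν : KValuation k K Γ) (A A' : PRLM k K Γ ν n r) : Prop :=
  A'.O = A.O ∧ ∃ j : Fin n, r ≤ j.val ∧ (∀ i : Fin n, i ≠ j → A'.z i = A.z i) ∧
    ((∃ (c : k) (a : Fin r → ℕ),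
        A'.z j = A.z j - algebraMap k K c * ∏ i : Fin r, A.z (Fin.castLE A.hr i) ^ a i ∧
          ν.v (A.z j) ≤ ν.v (A'.z j)) ∨
      ∃ s : Fin n, s ≠ j ∧ r ≤ s.val ∧ A'.z j = A.z j + A.z s)

/-- Common frame of a coordinate `(i,j)`-blow-up with codimension two center
`x_i = z_j = 0`: all other coordinates are unchanged and `𝒪'` is the localization of
`𝒪[z']` at the center of `ν`. -/
def BlowupFrame (ν : KValuation k K Γ) (A A' : PRLM k K Γ ν n r) (i j : Fin n) : Prop :=
  i.val < r ∧ i ≠ j ∧ (∀ s : Fin n, s ≠ i → s ≠ j → A'.z s = A.z s) ∧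
    IsLocOf ν A'.O (ringAdjoin A.O (Set.range A'.z))

/-- A combinatorial coordinate `(i,j)`-blow-up. -/
def IsCombBlowup (ν : KValuation k K Γ) (A A' : PRLM k K Γ ν n r) (i j : Fin n) : Prop :=
  BlowupFrame ν A A' i j ∧
    ((ν.v (A.z i) < ν.v (A.z j) ∧ A'.z i = A.z i ∧ A'.z j = A.z j / A.z i) ∨
      (ν.v (A.z j) < ν.v (A.z i) ∧ A'.z i = A.z i / A.z j ∧ A'.z j = A.z j))

/-- A coordinate `(i,j)`-blow-up with translation (`ν(x_i) = ν(z_j)`). -/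
def IsTransBlowup (ν : KValuation k K Γ) (A A' : PRLM k K Γ ν n r) (i j : Fin n) : Prop :=
  BlowupFrame ν A A' i j ∧ ν.v (A.z i) = ν.v (A.z j) ∧ r ≤ j.val ∧ A'.z i = A.z i ∧
    ∃ c : k, 0 < ν.v (A.z j / A.z i - algebraMap k K c) ∧
      A'.z j = A.z j / A.z i - algebraMap k K c

/-- A coordinate `(i,j)`-blow-up with codimension two center. -/
def IsCoordBlowup (ν : KValuation k K Γ) (A A' : PRLM k K Γ ν n r) (i j : Fin n) : Prop :=
  IsCombBlowup ν A A' i j ∨ IsTransBlowup ν A A' i j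

/-- An atomic transformation: a coordinate change in the dependent variables or a
coordinate blow-up with codimension two center. -/
def StdStep (ν : KValuation k K Γ) (A A' : PRLM k K Γ ν n r) : Prop :=
  IsCoordChange ν A A' ∨ ∃ i j : Fin n, IsCoordBlowup ν A A' i j

/-- A coordinate blow-up in the independent variables (always combinatorial). -/
def IndepBlowupStep (ν : KValuation k K Γ) (A A' : PRLM k K Γ ν n r) : Prop :=
  ∃ i s : Fin n, i.val < r ∧ s.val < r ∧ IsCombBlowup ν A A' i s

/-- The data `d, p` of the `j`-contact rational function `Φ = z_j^d / xᵖ` :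
`d·ν(z_j) = ∑ p_i ν(x_i)`, `d > 0`, `gcd(d; p₁,…,p_r) = 1`. In particular `d` is
the `j`-ramification index of `𝒜`. -/
def ContactExponents (ν : KValuation k K Γ) (A : PRLM k K Γ ν n r) (j : Fin n)
    (d : ℕ) (p : Fin r → ℤ) : Prop :=
  r ≤ j.val ∧ 0 < d ∧
    ((d : ℤ) • ν.v (A.z j) = ∑ i : Fin r, p i • ν.v (A.z (Fin.castLE A.hr i))) ∧
    ∀ m : ℕ, 1 < m → ¬((m ∣ d) ∧ ∀ i, (m : ℤ) ∣ p i)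

/-- The coordinate `(i,s)`-blow-up is `j`-admissible for the contact exponents `p` :
either `s` is an independent variable with `p_i ≠ 0 ≠ p_s`, or `p_i ≠ 0` and `s = j`. -/
def JAdmissible {n r : ℕ} (j : Fin n) (p : Fin r → ℤ) (i s : Fin n) : Prop :=
  (∃ hi : i.val < r, p ⟨i.val, hi⟩ ≠ 0) ∧
    ((∃ hs : s.val < r, p ⟨s.val, hs⟩ ≠ 0) ∨ s = j)

/-- A `j`-Puiseux package: a finite sequence of `j`-admissible coordinate blow-ups,
all combinatorial except the last one, which has a translation. -/
def IsPuiseuxPackage (ν : KValuation k K Γ) (A A' : PRLM k K Γ ν n r) (j : Fin n) : Prop :=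
  r ≤ j.val ∧
    ∃ (N : ℕ) (B : Fin (N + 1) → PRLM k K Γ ν n r), 0 < N ∧ B 0 = A ∧ B (Fin.last N) = A' ∧
      ∀ t : Fin N, ∃ (i s : Fin n) (d : ℕ) (p : Fin r → ℤ),
        ContactExponents ν (B t.castSucc) j d p ∧ JAdmissible j p i s ∧
          (t.val + 1 < N → IsCombBlowup ν (B t.castSucc) (B t.succ) i s) ∧
          (t.val + 1 = N → IsTransBlowup ν (B t.castSucc) (B t.succ) i s)

/-- `d` is the `j`-ramification index `d(𝒜)`. -/
def RamIndex (ν : KValuation k K Γ) (A : PRLM k K Γ ν n r) (j : Fin n) (d : ℕ) : Prop :=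
  ∃ p : Fin r → ℤ, ContactExponents ν A j d p

/-- A step among: coordinate blow-ups in the independent variables, coordinate changes
in the dependent variable, Puiseux packages. -/
def NPStep (ν : KValuation k K Γ) (A A' : PRLM k K Γ ν n r) : Prop :=
  IndepBlowupStep ν A A' ∨ IsCoordChange ν A A' ∨ ∃ j : Fin n, IsPuiseuxPackage ν A A' j

/-! ### Newton–Puiseux invariants (rational co-rank one) -/

/-- `g ∈ 𝒪 ∩ k[[x]]`: `g` is `M`-adically approximable by polynomials in the
independent variables `x`. -/
def DependsOnlyOnX (k : Type) {K : Type} [Field k] [Field K] [Algebra k K]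
    (O : Subring K) {r : ℕ} (x : Fin r → K) (g : K) : Prop :=
  g ∈ O ∧ ∀ m : ℕ, ∃ P : MvPolynomial (Fin r) k,
    g - MvPolynomial.aeval x P ∈ maxIdealPow O m

/-- `H` is the expansion `g = ∑_{s ≥ 0} H_s(x) yˢ` of `g ∈ 𝒪` in powers of `y` with
coefficients depending only on `x`. -/
def IsYExpansion (k : Type) {K : Type} [Field k] [Field K] [Algebra k K]
    (O : Subring K) {r : ℕ} (x : Fin r → K) (y : K) (g : K) (H : ℕ → K) : Prop :=
  (∀ s, DependsOnlyOnX k O x (H s)) ∧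
    ∀ m : ℕ, ∃ u ∈ (O : Set K), g - (∑ s ∈ Finset.range m, H s * y ^ s) = y ^ m * u

/-- Minimal abscissa `α` of a Newton–Puiseux support. -/
def npAlpha (S : Set (ℝ × ℤ)) : ℝ := sInf (Prod.fst '' S)

/-- Main height `ħ`: the least height on the support realizing the minimal abscissa. -/
def npMainHeight (S : Set (ℝ × ℤ)) : ℤ := sInf {s : ℤ | (npAlpha S, s) ∈ S}

/-- `δ`: the minimal value `u + s·ν(y)` on the support. -/
def npDelta (yval : ℝ) (S : Set (ℝ × ℤ)) : ℝ :=
  sInf {t : ℝ | ∃ u : ℝ, ∃ s : ℤ, (u, s) ∈ S ∧ t = u + (s : ℝ) * yval}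

/-- Critical height `χ`: the greatest height on the critical segment. -/
def npChi (yval : ℝ) (S : Set (ℝ × ℤ)) : ℤ :=
  sSup {s : ℤ | ∃ u : ℝ, (u, s) ∈ S ∧ u + (s : ℝ) * yval = npDelta yval S}

/-- `ξ ∈ Der_k 𝒪[log x]`: an `x`-logarithmic vector field for `𝒜`, i.e.
`ξ = ∑ f_i x_i ∂/∂x_i + ∑ g_j ∂/∂y_j` with coefficients in `𝒪`. -/
def IsLogVF {Γ : Type} [AddCommGroup Γ] [LinearOrder Γ] [IsOrderedAddMonoid Γ] {ν : KValuation k K Γ} {n r : ℕ}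
    (A : PRLM k K Γ ν n r) (ξ : K → K) : Prop :=
  (∀ i : Fin n, i.val < r → ξ (A.z i) / A.z i ∈ A.O) ∧
    ∀ j : Fin n, r ≤ j.val → ξ (A.z j) ∈ A.O

/-- The Newton–Puiseux support of the `x`-logarithmic vector field `ξ` with respect to
the parameterized regular local model `𝒜` (case `r = n - 1`, one dependent variable
`y = z_n`); the components are `(f₁, …, f_{n-1}, g/y)`, expanded in powers of `y` with
`x`-only coefficients, and recorded with heights in `ℤ_{≥ -1}`. -/
def HasNPSupport {ν : KValuation k K ℝ} {r : ℕ} (A : PRLM k K ℝ ν (r + 1) r)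
    (ξ : K → K) (S : Set (ℝ × ℤ)) : Prop :=
  ∃ H : Fin (r + 1) → ℕ → K,
    (∀ l, IsYExpansion k A.O (fun i : Fin r => A.z (Fin.castLE A.hr i)) (A.z (Fin.last r))
        (A.z (Fin.last r) * (ξ (A.z l) / A.z l)) (H l)) ∧
    S = {q : ℝ × ℤ | ∃ (l : Fin (r + 1)) (s : ℕ), H l s ≠ 0 ∧ q = (ν.v (H l s), (s : ℤ) - 1)}

/-- `h = ħ(ℒ; 𝒜)` is the main height of the foliation: the minimum of the main heights
of the `x`-logarithmic vector fields of `ℒ_𝒜[log x]`. -/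
def FolMainHeight {ν : KValuation k K ℝ} {r : ℕ} (A : PRLM k K ℝ ν (r + 1) r)
    (Mem : (K → K) → Prop) (h : ℤ) : Prop :=
  (∃ ξ S, Mem ξ ∧ IsLogVF A ξ ∧ HasNPSupport A ξ S ∧ npMainHeight S = h) ∧
    ∀ ξ S, Mem ξ → IsLogVF A ξ → HasNPSupport A ξ S → h ≤ npMainHeight S

/-- `c = χ(ℒ; 𝒜)` is the critical height of the foliation. -/
def FolCriticalHeight {ν : KValuation k K ℝ} {r : ℕ} (A : PRLM k K ℝ ν (r + 1) r)
    (Mem : (K → K) → Prop) (c : ℤ) : Prop :=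
  (∃ ξ S, Mem ξ ∧ IsLogVF A ξ ∧ HasNPSupport A ξ S ∧
      npChi (ν.v (A.z (Fin.last r))) S = c) ∧
    ∀ ξ S, Mem ξ → IsLogVF A ξ → HasNPSupport A ξ S →
      c ≤ npChi (ν.v (A.z (Fin.last r))) S

/-! ### Field extensions, étale Puiseux packages -/

/-- A field extension `E` of `K` over `k` (receptacle for étale extensions). -/
structure FieldExtension (k K : Type) [Field k] [Field K] [Algebra k K] where
  E : Type
  [fieldE : Field E]
  [algE : Algebra k E]
  ι : K →ₐ[k] E

attribute [instance] FieldExtension.fieldE FieldExtension.algE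

/-- `ν'` restricts to `ν` on `K`. -/
def ValExtends {Γ : Type} [AddCommGroup Γ] [LinearOrder Γ] [IsOrderedAddMonoid Γ] (X : FieldExtension k K)
    (ν : KValuation k K Γ) (ν' : KValuation k X.E Γ) : Prop :=
  ∀ u : K, u ≠ 0 → ν'.v (X.ι u) = ν.v u

/-- Membership in the foliation `ℒ' = E·ℒ ⊆ Der_k E` induced on the extension `E`. -/
def ExtFolMem (X : FieldExtension k K) (L : FoliationByLines k K) (ξ : X.E → X.E) : Prop :=
  ∃ (c : X.E) (D : X.E → X.E), IsKDerivation k D ∧ (∀ u : K, D (X.ι u) = X.ι (L.gen u)) ∧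
    ξ = fun a => c * D a

/-- The Newton–Puiseux support of `f ∈ w⁻¹k[[x,w]]` with respect to `(x,w)` :
`f = ∑_{ℓ ≥ -1} wˡ f_ℓ(x)`, recorded as the set of `(ν(f_ℓ), ℓ)`. -/
def TwoVarSupport (ν : KValuation k K ℝ) (O : Subring K) (x w f : K)
    (S : Set (ℝ × ℤ)) : Prop :=
  ∃ H : ℕ → K, IsYExpansion k O (fun _ : Fin 1 => x) w (w * f) H ∧
    S = {q : ℝ × ℤ | ∃ ℓ : ℕ, H ℓ ≠ 0 ∧ q = (ν.v (H ℓ), (ℓ : ℤ) - 1)}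

/-- The Newton–Puiseux support of the vector field
`η = a·x∂/∂x + b·∂/∂w + c·y∂/∂y`, the union of the supports of `(a, b/w, c)`. -/
def VF3Support (ν : KValuation k K ℝ) (O : Subring K) (x w y : K) (η : K → K)
    (S : Set (ℝ × ℤ)) : Prop :=
  ∃ Sa Sb Sc : Set (ℝ × ℤ), TwoVarSupport ν O x w (η x / x) Sa ∧
    TwoVarSupport ν O x w (η w / w) Sb ∧ TwoVarSupport ν O x w (η y / y) Sc ∧
    S = Sa ∪ Sb ∪ Sc

/-- `η = a·x∂/∂x + b·∂/∂w + c·y∂/∂y` is `(x,w)`-prepared and dominant: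
`(a, b, c) = x^q·(ã, b̃, c̃)` with `b̃(0,0) ≠ 0` (i.e. `b̃` a unit of `𝒪`). -/
def PreparedDominant (O : Subring K) (x w y : K) (η : K → K) : Prop :=
  ∃ (q : ℕ) (a b c : K), a ∈ O ∧ b ∈ O ∧ c ∈ O ∧
    η x = x * (x ^ q * a) ∧ η w = x ^ q * b ∧ η y = y * (x ^ q * c) ∧ ¬ Nonunit O b

/-- `(Ot, ν')` is a local-etale extension of `(O', ν)` : `Ot` is the localization at the
center of `ν'` of a standard étale `O'`-algebra `O'[θ]` (with `θ` a simple root of a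
polynomial over `O'`), with the same residue field. -/
def IsLocalEtaleExt {Γ : Type} [AddCommGroup Γ] [LinearOrder Γ] [IsOrderedAddMonoid Γ] (X : FieldExtension k K)
    (ν' : KValuation k X.E Γ) (O' : Subring K) (Ot : Subring X.E) : Prop :=
  (∀ a ∈ O', X.ι a ∈ Ot) ∧
    (∃ (θ : X.E) (P : Polynomial K), (∀ i : ℕ, P.coeff i ∈ O') ∧
      (P.map X.ι.toRingHom).eval θ = 0 ∧
      ((Polynomial.derivative P).map X.ι.toRingHom).eval θ ∈ Ot ∧
      ¬ Nonunit Ot (((Polynomial.derivative P).map X.ι.toRingHom).eval θ) ∧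
      IsLocOf ν' Ot (ringAdjoin (O'.map X.ι.toRingHom) {θ})) ∧
    ∀ u ∈ Ot, ∃ a b : K, a ∈ O' ∧ b ∈ O' ∧ ¬ Nonunit Ot (X.ι b) ∧
      (u = X.ι a / X.ι b ∨ Nonunit Ot (u - X.ι a / X.ι b))

/-- An étale standard transformation (rational rank one, `n = 3`): a coordinate change
in the dependent variables, or an étale `j`-Puiseux package: first pass to
`𝒪^♮ = 𝒪[t]`, `t^d = x` (`d` the `j`-ramification index), then perform an ordinary
`j`-Puiseux package. -/
def EtaleStdStep {k E : Type} [Field k] [Field E] [Algebra k E] (ν' : KValuation k E ℝ)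
    (B B' : PRLM k E ℝ ν' 3 1) : Prop :=
  IsCoordChange ν' B B' ∨
    ∃ (j : Fin 3) (d : ℕ) (p : Fin 1 → ℤ) (t : E) (Bnat : PRLM k E ℝ ν' 3 1),
      1 ≤ j.val ∧ ContactExponents ν' B j d p ∧ t ^ d = B.z 0 ∧
      Bnat.O = ringAdjoin B.O {t} ∧ Bnat.z = Function.update B.z 0 t ∧
      IsPuiseuxPackage ν' Bnat B' j

/-- The coefficients `F` have no common factor in `𝒪`. -/
def NoCommonFactor (O : Subring K) {m : ℕ} (F : Fin m → K) : Prop :=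
  ¬ ∃ h : K, Nonunit O h ∧ ∀ l, ∃ u ∈ (O : Set K), F l = h * u

open KaehlerDifferential in
lemma finrank_derivation [CharZero k] (x : Fin 3 → K) (hx : IsTranscendenceBasis k x) :
    Module.finrank K (Derivation k K K) = 3 ∧ Module.Finite K (Derivation k K K) := by
  have hinj : Function.Injective (MvPolynomial.aeval (R := k) x) := hx.1
  let _ : Algebra (MvPolynomial (Fin 3) k) K := (MvPolynomial.aeval (R := k) x).toAlgebra
  have : FaithfulSMul (MvPolynomial (Fin 3) k) K := (faithfulSMul_iff_algebraMap_injective _ _).2 hinj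
  have : IsScalarTower k (MvPolynomial (Fin 3) k) K := IsScalarTower.of_algHom (MvPolynomial.aeval (R := k) x)
  let _ : Algebra (FractionRing (MvPolynomial (Fin 3) k)) K := FractionRing.liftAlgebra _ _
  have : IsScalarTower (MvPolynomial (Fin 3) k) (FractionRing (MvPolynomial (Fin 3) k)) K :=
    FractionRing.isScalarTower_liftAlgebra _ _
  have halg0 : Algebra.IsAlgebraic (Algebra.adjoin k (Set.range x)) K := hx.isAlgebraic
  have halg1 : Algebra.IsAlgebraic (MvPolynomial (Fin 3) k) K := by
    refine Algebra.IsAlgebraic.of_ringHom_of_comp_eq (S := Algebra.adjoin k (Set.range x)) (B := K)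
      hx.1.aevalEquiv (RingHom.id K) (hx.1.aevalEquiv.surjective) (fun _ _ h => h) ?_
    ext <;> rfl
  have halg : Algebra.IsAlgebraic (FractionRing (MvPolynomial (Fin 3) k)) K :=
    ⟨fun a => (halg1.isAlgebraic a).extendScalars (IsFractionRing.injective (MvPolynomial (Fin 3) k) (FractionRing (MvPolynomial (Fin 3) k)))⟩
  have : CharZero (FractionRing (MvPolynomial (Fin 3) k)) := by
    infer_instance
  have : Algebra.IsSeparable (FractionRing (MvPolynomial (Fin 3) k)) K := inferInstance
  have := Algebra.FormallyEtale.of_isSeparable (FractionRing (MvPolynomial (Fin 3) k)) K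
  have : Algebra.FormallyEtale (MvPolynomial (Fin 3) k) (FractionRing (MvPolynomial (Fin 3) k)) :=
    Algebra.FormallyEtale.of_isLocalization (nonZeroDivisors (MvPolynomial (Fin 3) k))
  have : Algebra.FormallyEtale (MvPolynomial (Fin 3) k) K :=
    Algebra.FormallyEtale.comp _ (FractionRing (MvPolynomial (Fin 3) k)) _
  let e := KaehlerDifferential.tensorKaehlerEquivOfFormallyEtale k (MvPolynomial (Fin 3) k) K
  let b := (Module.Basis.baseChange K (KaehlerDifferential.mvPolynomialBasis k (Fin 3))).map e
  have hf := Module.Finite.of_basis b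
  have hr : Module.finrank K (Ω[K⁄k]) = 3 := by
    rw [Module.finrank_eq_card_basis b]; simp
  let l := KaehlerDifferential.linearMapEquivDerivation k K (M := K)
  refine ⟨?_, Module.Finite.equiv l⟩
  rw [← l.finrank_eq]
  rw [Module.finrank_linearMap, hr]; simp

/-- dual derivations for a family whose common kernel is trivial -/
lemma exists_dual [CharZero k] (x : Fin 3 → K) (hx : IsTranscendenceBasis k x) (z : Fin 3 → K)
    (hz : ∀ δ : Derivation k K K, (∀ i, δ (z i) = 0) → δ = 0) :
    ∃ D : Fin 3 → Derivation k K K, ∀ i j, D i (z j) = if i = j then 1 else 0 := by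
  obtain ⟨h1, h2⟩ := finrank_derivation x hx
  let ev : Derivation k K K →ₗ[K] (Fin 3 → K) :=
    { toFun := fun δ i => δ (z i)
      map_add' := fun a b => by ext; simp
      map_smul' := fun a b => by ext; simp }
  have hinj : Function.Injective ev := by
    rw [← LinearMap.ker_eq_bot, LinearMap.ker_eq_bot']
    intro δ h
    exact hz δ fun i => congrFun h i
  have hsurj : Function.Surjective ev := by
    refine (LinearMap.injective_iff_surjective_of_finrank_eq_finrank ?_).1 hinj
    rw [h1]; simp
  choose D hD using fun i : Fin 3 => hsurj (Pi.single i 1)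
  refine ⟨D, fun i j => ?_⟩
  have := congrFun (hD i) j
  rw [show D i (z j) = ev (D i) j from rfl, this]
  simp [Pi.single_apply, eq_comm]

section val
variable (ν : KValuation k K ℝ)

lemma v_one : ν.v 1 = 0 := by
  have := ν.map_mul' 1 1 one_ne_zero one_ne_zero
  rw [one_mul] at this; linarith

lemma v_inv (a : K) (ha : a ≠ 0) : ν.v a⁻¹ = - ν.v a := by
  have := ν.map_mul' a a⁻¹ ha (inv_ne_zero ha)
  rw [mul_inv_cancel₀ ha, v_one] at this; linarith

lemma v_div (a b : K) (ha : a ≠ 0) (hb : b ≠ 0) : ν.v (a / b) = ν.v a - ν.v b := by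
  rw [div_eq_mul_inv, ν.map_mul' _ _ ha (inv_ne_zero hb), v_inv ν b hb]; ring

lemma v_pow (a : K) (ha : a ≠ 0) (n : ℕ) : ν.v (a ^ n) = n * ν.v a := by
  induction n with
  | zero => simp [v_one]
  | succ n ih => rw [pow_succ, ν.map_mul' _ _ (pow_ne_zero _ ha) ha, ih]; push_cast; ring

lemma v_neg (a : K) : ν.v (-a) = ν.v a := by
  by_cases ha : a = 0
  · simp [ha]
  have h1 : ν.v (-1 : K) = 0 := by
    have := ν.trivial' (-1) (by simp)
    simpa using this
  rw [← neg_one_mul, ν.map_mul' _ _ (by simp) ha, h1, zero_add]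

lemma v_const (c : k) (hc : c ≠ 0) : ν.v (algebraMap k K c) = 0 := ν.trivial' c hc

/-- `a = 0` or `t ≤ v a`. -/
def VGe (t : ℝ) (a : K) : Prop := a = 0 ∨ t ≤ ν.v a

/-- `a = 0` or `0 < v a`. -/
def VPos (a : K) : Prop := a = 0 ∨ 0 < ν.v a

variable {ν}

lemma VGe.zero {t : ℝ} : VGe ν t 0 := Or.inl rfl

lemma VGe.add {t : ℝ} {a b : K} (ha : VGe ν t a) (hb : VGe ν t b) : VGe ν t (a + b) := by
  by_cases h : a + b = 0
  · exact Or.inl h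
  by_cases ha0 : a = 0
  · simpa [ha0] using hb
  by_cases hb0 : b = 0
  · simpa [hb0] using ha
  have h1 := ha.resolve_left ha0
  have h2 := hb.resolve_left hb0
  exact Or.inr (le_trans (le_min h1 h2) (ν.map_add' a b ha0 hb0 h))

lemma VGe.mul {s t : ℝ} {a b : K} (ha : VGe ν s a) (hb : VGe ν t b) : VGe ν (s + t) (a * b) := by
  by_cases ha0 : a = 0
  · simp [ha0, VGe]
  by_cases hb0 : b = 0
  · simp [hb0, VGe]
  right
  rw [ν.map_mul' a b ha0 hb0]
  exact add_le_add (ha.resolve_left ha0) (hb.resolve_left hb0)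

lemma VGe.neg {t : ℝ} {a : K} (ha : VGe ν t a) : VGe ν t (-a) := by
  rcases ha with h | h
  · left; simp [h]
  · right; rwa [v_neg]

lemma VGe.mono {s t : ℝ} {a : K} (ha : VGe ν t a) (h : s ≤ t) : VGe ν s a :=
  ha.imp id fun h1 => h.trans h1

lemma VPos.add {a b : K} (ha : VPos ν a) (hb : VPos ν b) : VPos ν (a + b) := by
  by_cases h : a + b = 0
  · exact Or.inl h
  by_cases ha0 : a = 0
  · simpa [ha0] using hb
  by_cases hb0 : b = 0
  · simpa [hb0] using ha
  have h1 := ha.resolve_left ha0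
  have h2 := hb.resolve_left hb0
  exact Or.inr (lt_of_lt_of_le (lt_min h1 h2) (ν.map_add' a b ha0 hb0 h))

lemma VPos.mul {a b : K} (ha : VPos ν a) (hb : VGe ν 0 b) : VPos ν (a * b) := by
  by_cases ha0 : a = 0
  · simp [ha0, VPos]
  by_cases hb0 : b = 0
  · simp [hb0, VPos]
  right
  rw [ν.map_mul' a b ha0 hb0]
  have := ha.resolve_left ha0
  have := hb.resolve_left hb0
  linarith

lemma VPos.mul' {a b : K} (ha : VGe ν 0 a) (hb : VPos ν b) : VPos ν (a * b) := by
  rw [mul_comm]; exact hb.mul ha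

lemma VPos.neg {a : K} (ha : VPos ν a) : VPos ν (-a) := by
  rcases ha with h | h
  · left; simp [h]
  · right; rwa [v_neg]

lemma VPos.sub {a b : K} (ha : VPos ν a) (hb : VPos ν b) : VPos ν (a - b) := by
  rw [sub_eq_add_neg]; exact ha.add hb.neg

lemma VPos.vge {a : K} (ha : VPos ν a) : VGe ν 0 a := ha.imp id le_of_lt

lemma vge_const (c : k) : VGe ν 0 (algebraMap k K c) := by
  by_cases hc : c = 0
  · simp [hc, VGe]
  · right; rw [v_const ν c hc]

lemma VGe.sum {ι : Type*} {s : Finset ι} {t : ℝ} {f : ι → K} (h : ∀ i ∈ s, VGe ν t (f i)) :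
    VGe ν t (∑ i ∈ s, f i) := by
  induction s using Finset.induction_on with
  | empty => simp [VGe]
  | insert a s ha ih =>
    rw [Finset.sum_insert ha]
    exact (h a (by simp)).add (ih fun i hi => h i (by simp [hi]))

/-- adding a term of larger value -/
lemma v_add_lt {a b : K} (ha : a ≠ 0) (hb : b = 0 ∨ ν.v a < ν.v b) :
    a + b ≠ 0 ∧ ν.v (a + b) = ν.v a := by
  rcases hb with rfl | hb
  · simp [ha]
  by_cases hb0 : b = 0
  · simp [hb0, ha]
  have h0 : a + b ≠ 0 := by
    intro h
    have : b = -a := by linear_combination h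
    rw [this, v_neg] at hb; exact lt_irrefl _ hb
  refine ⟨h0, ?_⟩
  have h1 := ν.map_add' a b ha hb0 h0
  rw [min_eq_left hb.le] at h1
  have h2 := ν.map_add' (a + b) (-b) h0 (by simpa) (by simpa)
  rw [add_neg_cancel_right, v_neg] at h2
  rcases min_le_iff.1 h2 with h | h
  · linarith
  · linarith

lemma v_unit_add {c : k} (hc : c ≠ 0) {b : K} (hb : VPos ν b) :
    algebraMap k K c + b ≠ 0 ∧ ν.v (algebraMap k K c + b) = 0 := by
  have := v_add_lt (ν := ν) (a := algebraMap k K c) (b := b) (by simpa using hc)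
    (by rw [v_const ν c hc]; exact hb)
  rwa [v_const ν c hc] at this

lemma not_vpos_one : ¬ VPos ν (1 : K) := by
  rintro (h | h)
  · exact one_ne_zero h
  · rw [v_one] at h; exact lt_irrefl _ h

end val

section cent
variable {ν : KValuation k K ℝ} {O : Subring K}

lemma CenteredAt.vge (h : CenteredAt ν O) {a : K} (ha : a ∈ O) : VGe ν 0 a := by
  by_cases h0 : a = 0
  · exact Or.inl h0
  · exact Or.inr (h.nonneg a ha h0)

lemma CenteredAt.nonunit_iff (h : CenteredAt ν O) {a : K} : Nonunit O a ↔ a ∈ O ∧ VPos ν a := by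
  constructor
  · intro hn
    refine ⟨hn.1, ?_⟩
    by_cases h0 : a = 0
    · exact Or.inl h0
    · exact Or.inr ((h.pos_iff a hn.1 h0).1 hn)
  · rintro ⟨h1, h2⟩
    by_cases h0 : a = 0
    · exact ⟨h1, Or.inl h0⟩
    · exact (h.pos_iff a h1 h0).2 (h2.resolve_left h0)

lemma CenteredAt.inv_mem (h : CenteredAt ν O) {a : K} (ha : a ∈ O) (hn : ¬ VPos ν a) : a⁻¹ ∈ O := by
  by_contra h1
  exact hn (h.nonunit_iff.1 ⟨ha, Or.inr h1⟩).2

lemma CenteredAt.inv_mem' (h : CenteredAt ν O) {a : K} (ha : a ∈ O) (h0 : a ≠ 0) (hv : ν.v a = 0) :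
    a⁻¹ ∈ O := by
  apply h.inv_mem ha
  rintro (h1 | h1)
  · exact h0 h1
  · linarith

lemma sq_vpos (h : CenteredAt ν O) {a : K} (ha : a ∈ sqMaxIdealSet O) : VPos ν a := by
  obtain ⟨m, c, g, hc, hg, rfl⟩ := ha
  have : ∀ i, VPos ν (c i * g i) := by
    intro i
    obtain ⟨a, b, ha, hb, hab⟩ := hg i
    rw [hab]
    exact VPos.mul' (h.vge (hc i)) ((h.nonunit_iff.1 ha).2.mul (h.vge hb.1))
  induction (Finset.univ : Finset (Fin m)) using Finset.induction_on with
  | empty => simp [VPos]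
  | insert a s ha ih =>
    rw [Finset.sum_insert ha]
    exact (this a).add ih

/-- a derivation preserving `O` maps the square of the maximal ideal into the maximal ideal -/
lemma sq_der (h : CenteredAt ν O) {D : Derivation k K K} (hD : ∀ a ∈ O, D a ∈ O)
    {a : K} (ha : a ∈ sqMaxIdealSet O) : VPos ν (D a) := by
  obtain ⟨m, c, g, hc, hg, rfl⟩ := ha
  rw [map_sum]
  have : ∀ i, VPos ν (D (c i * g i)) := by
    intro i
    obtain ⟨a, b, ha, hb, hab⟩ := hg i
    rw [hab]
    have ha' := (h.nonunit_iff.1 ha)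
    have hb' := (h.nonunit_iff.1 hb)
    simp only [Derivation.leibniz, smul_eq_mul]
    exact ((VPos.mul' (h.vge (hc i)) ((ha'.2.mul (h.vge (hD _ hb.1))).add
      (hb'.2.mul (h.vge (hD _ ha.1))))).add ((ha'.2.mul (h.vge hb.1)).mul (h.vge (hD _ (hc i)))))
  induction (Finset.univ : Finset (Fin m)) using Finset.induction_on with
  | empty => simp [VPos]
  | insert a s ha ih =>
    rw [Finset.sum_insert ha]
    exact (this a).add ih

end cent

/-- local coordinates at the center of `ν` -/
structure Chart (ν : KValuation k K ℝ) (O : Subring K) (x y z : K) : Prop where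
  cen : CenteredAt ν O
  algk : ∀ c : k, algebraMap k K c ∈ O
  hx : x ∈ O
  hy : y ∈ O
  hz : z ∈ O
  x0 : x ≠ 0
  y0 : y ≠ 0
  z0 : z ≠ 0
  vx : 0 < ν.v x
  vy : 0 < ν.v y
  vz : 0 < ν.v z
  gen : ∀ a ∈ O, ∃ c : k, ∃ b₁ ∈ O, ∃ b₂ ∈ O, ∃ b₃ ∈ O,
    a = algebraMap k K c + (b₁ * x + b₂ * y + b₃ * z)
  der : ∃ X Y Z : Derivation k K K,
    (∀ a ∈ O, X a ∈ O) ∧ (∀ a ∈ O, Y a ∈ O) ∧ (∀ a ∈ O, Z a ∈ O) ∧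
    (X x = 1 ∧ X y = 0 ∧ X z = 0) ∧ (Y x = 0 ∧ Y y = 1 ∧ Y z = 0) ∧ (Z x = 0 ∧ Z y = 0 ∧ Z z = 1) ∧
    ∀ ξ : Derivation k K K, ∀ a, ξ a = ξ x * X a + ξ y * Y a + ξ z * Z a

namespace Chart
variable {ν : KValuation k K ℝ} {O : Subring K} {x y z : K}

lemma swap12 (h : Chart ν O x y z) : Chart ν O y x z where
  cen := h.cen
  algk := h.algk
  hx := h.hy
  hy := h.hx
  hz := h.hz
  x0 := h.y0
  y0 := h.x0
  z0 := h.z0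
  vx := h.vy
  vy := h.vx
  vz := h.vz
  gen := fun a ha => by
    obtain ⟨c, b₁, h₁, b₂, h₂, b₃, h₃, e⟩ := h.gen a ha
    exact ⟨c, b₂, h₂, b₁, h₁, b₃, h₃, by rw [e]; ring⟩
  der := by
    obtain ⟨X, Y, Z, pX, pY, pZ, hX, hY, hZ, hd⟩ := h.der
    exact ⟨Y, X, Z, pY, pX, pZ, ⟨hY.2.1, hY.1, hY.2.2⟩, ⟨hX.2.1, hX.1, hX.2.2⟩,
      ⟨hZ.2.1, hZ.1, hZ.2.2⟩, fun ξ a => by rw [hd ξ a]; ring⟩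

lemma swap23 (h : Chart ν O x y z) : Chart ν O x z y where
  cen := h.cen
  algk := h.algk
  hx := h.hx
  hy := h.hz
  hz := h.hy
  x0 := h.x0
  y0 := h.z0
  z0 := h.y0
  vx := h.vx
  vy := h.vz
  vz := h.vy
  gen := fun a ha => by
    obtain ⟨c, b₁, h₁, b₂, h₂, b₃, h₃, e⟩ := h.gen a ha
    exact ⟨c, b₁, h₁, b₃, h₃, b₂, h₂, by rw [e]; ring⟩
  der := by
    obtain ⟨X, Y, Z, pX, pY, pZ, hX, hY, hZ, hd⟩ := h.der
    exact ⟨X, Z, Y, pX, pZ, pY, ⟨hX.1, hX.2.2, hX.2.1⟩, ⟨hZ.1, hZ.2.2, hZ.2.1⟩,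
      ⟨hY.1, hY.2.2, hY.2.1⟩, fun ξ a => by rw [hd ξ a]; ring⟩

lemma mx (h : Chart ν O x y z) : VPos ν x := Or.inr h.vx
lemma my (h : Chart ν O x y z) : VPos ν y := Or.inr h.vy
lemma mz (h : Chart ν O x y z) : VPos ν z := Or.inr h.vz

lemma gen_pos (h : Chart ν O x y z) {a : K} (ha : a ∈ O) (hp : VPos ν a) :
    ∃ b₁ ∈ O, ∃ b₂ ∈ O, ∃ b₃ ∈ O, a = b₁ * x + b₂ * y + b₃ * z := by
  obtain ⟨c, b₁, h₁, b₂, h₂, b₃, h₃, e⟩ := h.gen a ha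
  have hm : VPos ν (b₁ * x + b₂ * y + b₃ * z) :=
    ((VPos.mul' (h.cen.vge h₁) h.mx).add (VPos.mul' (h.cen.vge h₂) h.my)).add
      (VPos.mul' (h.cen.vge h₃) h.mz)
  by_cases hc : c = 0
  · exact ⟨b₁, h₁, b₂, h₂, b₃, h₃, by simpa [hc] using e⟩
  · have h3 := v_unit_add (ν := ν) hc hm
    rw [← e] at h3
    rcases hp with h4 | h4
    · exact absurd h4 h3.1
    · linarith [h3.2]

lemma mapsInto (h : Chart ν O x y z) (ξ : Derivation k K K) (h1 : ξ x ∈ O) (h2 : ξ y ∈ O)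
    (h3 : ξ z ∈ O) : ∀ a ∈ O, ξ a ∈ O := by
  obtain ⟨X, Y, Z, pX, pY, pZ, hX, hY, hZ, hd⟩ := h.der
  intro a ha
  rw [hd ξ a]
  exact O.add_mem (O.add_mem (O.mul_mem h1 (pX a ha)) (O.mul_mem h2 (pY a ha)))
    (O.mul_mem h3 (pZ a ha))

lemma not_sq_unit (h : Chart ν O x y z) {a : K} (ha : ¬ VPos ν a) : a ∉ sqMaxIdealSet O :=
  fun h1 => ha (sq_vpos h.cen h1)

lemma not_sq_lin (h : Chart ν O x y z) {α β γ : K} (hα : α ∈ O) (hβ : β ∈ O) (hγ : γ ∈ O)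
    (hu : ¬ VPos ν α ∨ ¬ VPos ν β ∨ ¬ VPos ν γ) : α * x + β * y + γ * z ∉ sqMaxIdealSet O := by
  obtain ⟨X, Y, Z, pX, pY, pZ, hX, hY, hZ, hd⟩ := h.der
  intro hs
  have key : ∀ D : Derivation k K K, (∀ a ∈ O, D a ∈ O) →
      VPos ν (α * D x + β * D y + γ * D z) := by
    intro D hD
    have h1 := sq_der h.cen hD hs
    have h2 : VPos ν (x * D α + y * D β + z * D γ) :=
      ((h.mx.mul (h.cen.vge (hD _ hα))).add (h.my.mul (h.cen.vge (hD _ hβ)))).add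
        (h.mz.mul (h.cen.vge (hD _ hγ)))
    have h3 := h1.sub h2
    convert h3 using 1
    simp only [map_add, Derivation.leibniz, smul_eq_mul]; ring
  rcases hu with hu | hu | hu
  · apply hu; simpa [hX] using key X pX
  · apply hu; simpa [hY] using key Y pY
  · apply hu; simpa [hZ] using key Z pZ

lemma isRSP (h : Chart ν O x y z) : IsRSP O ![x, y, z] where
  mem := by
    intro i
    rw [h.cen.nonunit_iff]
    fin_cases i
    · exact ⟨h.hx, h.mx⟩
    · exact ⟨h.hy, h.my⟩
    · exact ⟨h.hz, h.mz⟩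
  gen := by
    intro a ha
    have ha' := h.cen.nonunit_iff.1 ha
    obtain ⟨b₁, h₁, b₂, h₂, b₃, h₃, e⟩ := h.gen_pos ha'.1 ha'.2
    refine ⟨3, ![b₁, b₂, b₃], ![x, y, z], ?_, fun i => ⟨i, rfl⟩, ?_⟩
    · intro i; fin_cases i <;> assumption
    · simp [Fin.sum_univ_three, e]
  indepMod := by
    intro c hc hs i
    rw [Fin.sum_univ_three] at hs
    have := mt (h.not_sq_lin (hc 0) (hc 1) (hc 2)) (not_not.2 hs)
    push Not at this
    rw [h.cen.nonunit_iff]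
    refine ⟨hc i, ?_⟩
    fin_cases i
    · exact this.1
    · exact this.2.1
    · exact this.2.2

end Chart

/-- the goal relative to a derivation -/
def Goal (ν : KValuation k K ℝ) (O₀ : Subring K) (ξ : Derivation k K K) : Prop :=
  ∃ O : Subring K, Relation.ReflTransGen (LocalBlowUpStep ν) O₀ O ∧
      CenteredAt ν O ∧ LogElementaryAt (fun η : K → K => ∃ c : K, η = fun a => c * ξ a) O

lemma Goal.trans {ν : KValuation k K ℝ} {O₀ O₁ : Subring K} {ξ : Derivation k K K}
    (hr : Relation.ReflTransGen (LocalBlowUpStep ν) O₀ O₁) (h : Goal ν O₁ ξ) : Goal ν O₀ ξ := by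
  obtain ⟨O, h1, h2⟩ := h
  exact ⟨O, hr.trans h1, h2⟩

lemma Goal.smul {ν : KValuation k K ℝ} {O₀ : Subring K} {ξ : Derivation k K K} (q : K)
    (h : Goal ν O₀ (q • ξ)) : Goal ν O₀ ξ := by
  obtain ⟨O, h1, h2, m, e, h3, z, h4, ξ', ⟨c, hc⟩, h6⟩ := h
  refine ⟨O, h1, h2, m, e, h3, z, h4, ξ', ⟨c * q, ?_⟩, h6⟩
  rw [hc]; ext a; simp [mul_assoc]

namespace Chart
variable {ν : KValuation k K ℝ} {O : Subring K} {x y z : K}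

lemma goal_aux (h : Chart ν O x y z) (ξ : Derivation k K K) (e : ℕ) (he : e ≤ 3) (a : Fin 3 → K)
    (ha : ∀ i, a i ∈ O) 
    (hξ : ∀ i : Fin 3, (i.val < e → ξ (![x, y, z] i) = a i * ![x, y, z] i) ∧
      (e ≤ i.val → ξ (![x, y, z] i) = a i)) (hj : ∃ j, a j ∉ sqMaxIdealSet O) : Goal ν O ξ := by
  refine ⟨O, Relation.ReflTransGen.refl, h.cen, 3, e, he, ![x, y, z], h.isRSP, ξ, ⟨1, by simp⟩, ?_,
    a, ha, hξ, hj⟩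
  have : ∀ i, ξ (![x, y, z] i) ∈ O := by
    intro i
    rcases lt_or_ge i.val e with h1 | h1
    · rw [(hξ i).1 h1]; exact O.mul_mem (ha i) (h.isRSP.mem i).1
    · rw [(hξ i).2 h1]; exact ha i
  exact h.mapsInto ξ (this 0) (this 1) (this 2)

/-- log-elementary with one logarithmic coordinate -/
lemma goal_one (h : Chart ν O x y z) (ξ : Derivation k K K) {a b c : K} (ha : a ∈ O) (hb : b ∈ O)
    (hc : c ∈ O) (h1 : ξ x = a * x) (h2 : ξ y = b) (h3 : ξ z = c)
    (hn : a ∉ sqMaxIdealSet O ∨ b ∉ sqMaxIdealSet O ∨ c ∉ sqMaxIdealSet O) : Goal ν O ξ := by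
  refine h.goal_aux ξ 1 (by norm_num) ![a, b, c] ?_ ?_ ?_
  · intro i; fin_cases i <;> assumption
  · intro i; fin_cases i <;> simp [h1, h2, h3]
  · rcases hn with hn | hn | hn
    exacts [⟨0, hn⟩, ⟨1, hn⟩, ⟨2, hn⟩]

lemma goal_two (h : Chart ν O x y z) (ξ : Derivation k K K) {a b c : K} (ha : a ∈ O) (hb : b ∈ O)
    (hc : c ∈ O) (h1 : ξ x = a * x) (h2 : ξ y = b * y) (h3 : ξ z = c)
    (hn : a ∉ sqMaxIdealSet O ∨ b ∉ sqMaxIdealSet O ∨ c ∉ sqMaxIdealSet O) : Goal ν O ξ := by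
  refine h.goal_aux ξ 2 (by norm_num) ![a, b, c] ?_ ?_ ?_
  · intro i; fin_cases i <;> assumption
  · intro i; fin_cases i <;> simp [h1, h2, h3]
  · rcases hn with hn | hn | hn
    exacts [⟨0, hn⟩, ⟨1, hn⟩, ⟨2, hn⟩]

lemma goal_zero (h : Chart ν O x y z) (ξ : Derivation k K K) {a b c : K} (ha : a ∈ O) (hb : b ∈ O)
    (hc : c ∈ O) (h1 : ξ x = a) (h2 : ξ y = b) (h3 : ξ z = c)
    (hn : a ∉ sqMaxIdealSet O ∨ b ∉ sqMaxIdealSet O ∨ c ∉ sqMaxIdealSet O) : Goal ν O ξ := by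
  refine h.goal_aux ξ 0 (by norm_num) ![a, b, c] ?_ ?_ ?_
  · intro i; fin_cases i <;> assumption
  · intro i; fin_cases i <;> simp [h1, h2, h3]
  · rcases hn with hn | hn | hn
    exacts [⟨0, hn⟩, ⟨1, hn⟩, ⟨2, hn⟩]

/-- the case where the first two coordinates are first integrals -/
lemma goal_trivial (h : Chart ν O x y z) (ξ : Derivation k K K) (h0 : ξ ≠ 0) (h1 : ξ x = 0)
    (h2 : ξ y = 0) : Goal ν O ξ := by
  have h3 : ξ z ≠ 0 := by
    intro h3
    obtain ⟨X, Y, Z, pX, pY, pZ, hX, hY, hZ, hd⟩ := h.der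
    apply h0; ext a; rw [hd ξ a]; simp [h1, h2, h3]
  refine Goal.smul (ξ z)⁻¹ (h.goal_zero _ O.zero_mem O.zero_mem O.one_mem ?_ ?_ ?_ ?_)
  · simp [h1]
  · simp [h2]
  · simp [h3]
  · exact Or.inr (Or.inr (h.not_sq_unit not_vpos_one))

end Chart

namespace Chart
variable {ν : KValuation k K ℝ} {O : Subring K} {x y z : K}

/-- change of the second coordinate -/
lemma change (h : Chart ν O x y z) {α β γ : K} (hα : α ∈ O) (hβ : β ∈ O) (hγ : γ ∈ O)
    (hu : ¬ VPos ν β) {y' : K} (hy' : y' = α * x + β * y + γ * z) : Chart ν O x y' z := by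
  obtain ⟨X, Y, Z, pX, pY, pZ, hX, hY, hZ, hd⟩ := h.der
  have hy'O : y' ∈ O := by
    rw [hy']; exact O.add_mem (O.add_mem (O.mul_mem hα h.hx) (O.mul_mem hβ h.hy)) (O.mul_mem hγ h.hz)
  have hpos : VPos ν y' := by
    rw [hy']
    exact ((VPos.mul' (h.cen.vge hα) h.mx).add (VPos.mul' (h.cen.vge hβ) h.my)).add
      (VPos.mul' (h.cen.vge hγ) h.mz)
  have hunit : ¬ VPos ν (Y y') := by
    intro hp
    apply hu
    have h2 : VPos ν (x * Y α + y * Y β + z * Y γ) :=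
      ((h.mx.mul (h.cen.vge (pY _ hα))).add (h.my.mul (h.cen.vge (pY _ hβ)))).add
        (h.mz.mul (h.cen.vge (pY _ hγ)))
    convert hp.sub h2 using 1
    rw [hy']
    simp only [map_add, Derivation.leibniz, smul_eq_mul, hY]; ring
  have hYy0 : Y y' ≠ 0 := fun h0 => hunit (Or.inl h0)
  have hinv : (Y y')⁻¹ ∈ O := h.cen.inv_mem (pY _ hy'O) hunit
  have hy0 : y' ≠ 0 := by
    intro h0; apply hYy0; rw [h0]; simp
  have hβ0 : β ≠ 0 := fun h0 => hu (Or.inl h0)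
  have hβi : β⁻¹ ∈ O := h.cen.inv_mem hβ hu
  refine ⟨h.cen, h.algk, h.hx, hy'O, h.hz, h.x0, hy0, h.z0, h.vx, hpos.resolve_left hy0, h.vz, ?_, ?_⟩
  · intro a ha
    obtain ⟨c, b₁, h₁, b₂, h₂, b₃, h₃, e⟩ := h.gen a ha
    refine ⟨c, b₁ - b₂ * β⁻¹ * α, O.sub_mem h₁ (O.mul_mem (O.mul_mem h₂ hβi) hα), b₂ * β⁻¹,
      O.mul_mem h₂ hβi, b₃ - b₂ * β⁻¹ * γ, O.sub_mem h₃ (O.mul_mem (O.mul_mem h₂ hβi) hγ), ?_⟩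
    rw [e, hy']; field_simp; ring
  · refine ⟨X - (X y' * (Y y')⁻¹) • Y, (Y y')⁻¹ • Y, Z - (Z y' * (Y y')⁻¹) • Y, ?_, ?_, ?_, ?_, ?_, ?_, ?_⟩
    · intro a ha
      exact O.sub_mem (pX a ha) (O.mul_mem (O.mul_mem (pX _ hy'O) hinv) (pY a ha))
    · intro a ha
      exact O.mul_mem hinv (pY a ha)
    · intro a ha
      exact O.sub_mem (pZ a ha) (O.mul_mem (O.mul_mem (pZ _ hy'O) hinv) (pY a ha))
    · simp [hX, hY, hYy0]
    · simp [hY, hYy0]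
    · simp [hZ, hY, hYy0]
    · intro ξ a
      simp only [Derivation.sub_apply, Derivation.smul_apply, smul_eq_mul]
      rw [hd ξ a, hd ξ y']
      field_simp
      ring

lemma change3 (h : Chart ν O x y z) {α β γ : K} (hα : α ∈ O) (hβ : β ∈ O) (hγ : γ ∈ O)
    (hu : ¬ VPos ν γ) {z' : K} (hz' : z' = α * x + β * y + γ * z) : Chart ν O x y z' :=
  (h.swap23.change hα hγ hβ hu (y' := z') (by rw [hz']; ring)).swap23

end Chart

/-- localization of `A` along `ν` as a subring -/
def locSub (ν : KValuation k K ℝ) (A : Subring K) : Subring K where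
  carrier := {u | ∃ a b : K, a ∈ A ∧ b ∈ A ∧ b ≠ 0 ∧ ν.v b = 0 ∧ u = a / b}
  mul_mem' := by
    rintro _ _ ⟨a, b, ha, hb, hb0, hv, rfl⟩ ⟨a', b', ha', hb', hb0', hv', rfl⟩
    exact ⟨a * a', b * b', A.mul_mem ha ha', A.mul_mem hb hb', mul_ne_zero hb0 hb0',
      by rw [ν.map_mul' _ _ hb0 hb0', hv, hv', add_zero], by field_simp⟩
  one_mem' := ⟨1, 1, A.one_mem, A.one_mem, one_ne_zero, v_one ν, by simp⟩
  add_mem' := by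
    rintro _ _ ⟨a, b, ha, hb, hb0, hv, rfl⟩ ⟨a', b', ha', hb', hb0', hv', rfl⟩
    exact ⟨a * b' + a' * b, b * b', A.add_mem (A.mul_mem ha hb') (A.mul_mem ha' hb),
      A.mul_mem hb hb', mul_ne_zero hb0 hb0',
      by rw [ν.map_mul' _ _ hb0 hb0', hv, hv', add_zero], by field_simp⟩
  zero_mem' := ⟨0, 1, A.zero_mem, A.one_mem, one_ne_zero, v_one ν, by simp⟩
  neg_mem' := by
    rintro _ ⟨a, b, ha, hb, hb0, hv, rfl⟩
    exact ⟨-a, b, A.neg_mem ha, hb, hb0, hv, by rw [neg_div]⟩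

lemma le_locSub (ν : KValuation k K ℝ) (A : Subring K) : A ≤ locSub ν A :=
  fun a ha => ⟨a, 1, ha, A.one_mem, one_ne_zero, v_one ν, by simp⟩

lemma locSub_cen {ν : KValuation k K ℝ} {A : Subring K} (hA : ∀ a ∈ A, VGe ν 0 a) :
    CenteredAt ν (locSub ν A) := by
  have hnn : ∀ a ∈ locSub ν A, a ≠ 0 → 0 ≤ ν.v a := by
    rintro _ ⟨a, b, ha, hb, hb0, hv, rfl⟩ h0
    have ha0 : a ≠ 0 := by rintro rfl; simp at h0
    rw [v_div ν a b ha0 hb0, hv, sub_zero]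
    exact (hA a ha).resolve_left ha0
  refine ⟨hnn, ?_⟩
  intro u hu hu0
  constructor
  · intro hn
    rcases (hnn u hu hu0).lt_or_eq with h | h
    · exact h
    · exfalso
      obtain ⟨a, b, ha, hb, hb0, hv, rfl⟩ := hu
      have ha0 : a ≠ 0 := by rintro rfl; simp at hu0
      rw [v_div ν a b ha0 hb0, hv, sub_zero] at h
      rcases hn.2 with h1 | h1
      · exact hu0 h1
      · exact h1 ⟨b, a, hb, ha, ha0, h.symm, by simp⟩
  · intro hp
    refine ⟨hu, Or.inr fun h => ?_⟩
    have := hnn _ h (inv_ne_zero hu0)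
    rw [v_inv ν u hu0] at this
    linarith

namespace Chart
variable {ν : KValuation k K ℝ} {O : Subring K} {x y z : K}

/-- elementary blow-up of `x = y = 0` -/
lemma blowup (h : Chart ν O x y z) (c : k) (hw0 : y / x - algebraMap k K c ≠ 0)
    (hv : 0 < ν.v (y / x - algebraMap k K c)) :
    ∃ O' : Subring K, LocalBlowUpStep ν O O' ∧ O ≤ O' ∧
      Chart ν O' x (y / x - algebraMap k K c) z := by
  obtain ⟨X, Y, Z, pX, pY, pZ, hX, hY, hZ, hd⟩ := h.der
  have x0 := h.x0
  set w := y / x - algebraMap k K c with hw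
  have hyx : y / x = algebraMap k K c + w := by rw [hw]; ring
  have hyw : y = (algebraMap k K c + w) * x := by rw [← hyx]; field_simp
  set S : Set K := {u : K | ∃ i : Fin 3, i.val < 2 ∧ u = ![x, y, z] i / ![x, y, z] 0} with hS
  set A := ringAdjoin O S with hAdef
  have hSmem : ∀ u ∈ S, u = 1 ∨ u = algebraMap k K c + w := by
    rintro u ⟨i, hi, rfl⟩
    fin_cases i
    · left; simp [x0]
    · right; simp [hyx]
    · simp at hi
  have hOA : ∀ a ∈ O, a ∈ A := fun a ha => Subring.subset_closure (Or.inl ha)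
  have hyxA : y / x ∈ A := Subring.subset_closure (Or.inr ⟨1, by norm_num, by simp⟩)
  have hwA : w ∈ A := A.sub_mem hyxA (hOA _ (h.algk c))
  have hAnn : ∀ a ∈ A, VGe ν 0 a := by
    intro a ha
    induction ha using Subring.closure_induction with
    | mem u hu =>
      rcases hu with hu | hu
      · exact h.cen.vge hu
      · rcases hSmem u hu with rfl | rfl
        · right; rw [v_one]
        · exact (vge_const c).add (Or.inr hv.le)
    | zero => exact VGe.zero
    | one => right; rw [v_one]
    | add a b _ _ ha hb => exact ha.add hb
    | neg a _ ha => exact ha.neg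
    | mul a b _ _ ha hb => simpa using ha.mul hb
  set O' := locSub ν A with hO'
  have hAO : ∀ a ∈ A, a ∈ O' := le_locSub ν A
  have hOO : ∀ a ∈ O, a ∈ O' := fun a ha => hAO a (hOA a ha)
  have hcen : CenteredAt ν O' := locSub_cen hAnn
  have hk : ∀ c : k, algebraMap k K c ∈ O' := fun c => hOO _ (h.algk c)
  have hwO : w ∈ O' := hAO w hwA
  have hxO := hOO x h.hx
  have hzO := hOO z h.hz
  have hpm : ∀ b₁ ∈ O', ∀ b₂ ∈ O', ∀ b₃ ∈ O', VPos ν (b₁ * x + b₂ * w + b₃ * z) := by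
    intro b₁ h₁ b₂ h₂ b₃ h₃
    exact ((VPos.mul' (hcen.vge h₁) h.mx).add (VPos.mul' (hcen.vge h₂) (Or.inr hv))).add
      (VPos.mul' (hcen.vge h₃) h.mz)
  have hgenA : ∀ a ∈ A, ∃ c : k, ∃ b₁ ∈ O', ∃ b₂ ∈ O', ∃ b₃ ∈ O',
      a = algebraMap k K c + (b₁ * x + b₂ * w + b₃ * z) := by
    intro a ha
    induction ha using Subring.closure_induction with
    | mem u hu =>
      rcases hu with hu | hu
      · obtain ⟨c', b₁, h₁, b₂, h₂, b₃, h₃, e⟩ := h.gen u hu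
        refine ⟨c', b₁ + b₂ * (algebraMap k K c + w),
          O'.add_mem (hOO _ h₁) (O'.mul_mem (hOO _ h₂) (O'.add_mem (hk c) hwO)), 0, O'.zero_mem,
          b₃, hOO _ h₃, ?_⟩
        rw [e]; rw [hyw]; ring
      · rcases hSmem u hu with rfl | rfl
        · exact ⟨1, 0, O'.zero_mem, 0, O'.zero_mem, 0, O'.zero_mem, by simp⟩
        · exact ⟨c, 0, O'.zero_mem, 1, O'.one_mem, 0, O'.zero_mem, by simp⟩
    | zero => exact ⟨0, 0, O'.zero_mem, 0, O'.zero_mem, 0, O'.zero_mem, by simp⟩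
    | one => exact ⟨1, 0, O'.zero_mem, 0, O'.zero_mem, 0, O'.zero_mem, by simp⟩
    | add a b _ _ ha hb =>
      obtain ⟨c', b₁, h₁, b₂, h₂, b₃, h₃, e⟩ := ha
      obtain ⟨c'', b₁', h₁', b₂', h₂', b₃', h₃', e'⟩ := hb
      exact ⟨c' + c'', _, O'.add_mem h₁ h₁', _, O'.add_mem h₂ h₂', _, O'.add_mem h₃ h₃',
        by rw [e, e']; simp; ring⟩
    | neg a _ ha =>
      obtain ⟨c', b₁, h₁, b₂, h₂, b₃, h₃, e⟩ := ha
      exact ⟨-c', _, O'.neg_mem h₁, _, O'.neg_mem h₂, _, O'.neg_mem h₃, by rw [e]; simp; ring⟩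
    | mul a b haA hbA ha hb =>
      obtain ⟨c', b₁, h₁, b₂, h₂, b₃, h₃, e⟩ := ha
      obtain ⟨c'', b₁', h₁', b₂', h₂', b₃', h₃', e'⟩ := hb
      refine ⟨c' * c'', b₁ * b + algebraMap k K c' * b₁', ?_, b₂ * b + algebraMap k K c' * b₂', ?_,
        b₃ * b + algebraMap k K c' * b₃', ?_, ?_⟩
      · exact O'.add_mem (O'.mul_mem h₁ (hAO _ hbA)) (O'.mul_mem (hk _) h₁')
      · exact O'.add_mem (O'.mul_mem h₂ (hAO _ hbA)) (O'.mul_mem (hk _) h₂')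
      · exact O'.add_mem (O'.mul_mem h₃ (hAO _ hbA)) (O'.mul_mem (hk _) h₃')
      · rw [map_mul]
        linear_combination b * e + algebraMap k K c' * e'
  have hder : ∀ D : Derivation k K K, (∀ a ∈ O, D a ∈ O') → D w ∈ O' → ∀ a ∈ O', D a ∈ O' := by
    intro D h1 h2
    have h3 : ∀ a ∈ A, D a ∈ O' := by
      intro a ha
      induction ha using Subring.closure_induction with
      | mem u hu =>
        rcases hu with hu | hu
        · exact h1 u hu
        · rcases hSmem u hu with rfl | rfl
          · simp
          · simpa using h2
      | zero => simp
      | one => simp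
      | add a b _ _ ha hb => rw [map_add]; exact O'.add_mem ha hb
      | neg a _ ha => rw [map_neg]; exact O'.neg_mem ha
      | mul a b haA hbA ha hb =>
        rw [Derivation.leibniz]
        exact O'.add_mem (O'.mul_mem (hAO _ haA) hb) (O'.mul_mem (hAO _ hbA) ha)
    rintro _ ⟨a, b, ha, hb, hb0, hv, rfl⟩
    rw [Derivation.leibniz_div]
    have hbi : b⁻¹ ∈ O' := hcen.inv_mem' (hAO b hb) hb0 hv
    simp only [smul_eq_mul]
    exact O'.mul_mem (O'.pow_mem hbi 2) (O'.sub_mem (O'.mul_mem (hAO _ hb) (h3 a ha))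
      (O'.mul_mem (hAO _ ha) (h3 b hb)))
  have hDw : ∀ D : Derivation k K K, D w = (x * D y - y * D x) / x ^ 2 := by
    intro D
    rw [hw]
    simp only [map_sub, Derivation.map_algebraMap, sub_zero, Derivation.leibniz_div, smul_eq_mul]
    field_simp
  refine ⟨O', ?_, hOO, ?_⟩
  · right; right
    refine ⟨3, 2, ![x, y, z], h.isRSP, by norm_num, by norm_num, 0, by norm_num, hAO, ?_⟩
    intro u hu
    exact hu
  · refine ⟨hcen, hk, hxO, hwO, hzO, x0, hw0, h.z0, h.vx, hv, h.vz, ?_, ?_⟩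
    · rintro _ ⟨a, b, ha, hb, hb0, hvb, rfl⟩
      obtain ⟨c', b₁, h₁, b₂, h₂, b₃, h₃, e⟩ := hgenA a ha
      obtain ⟨c'', b₁', h₁', b₂', h₂', b₃', h₃', e'⟩ := hgenA b hb
      have hc'' : c'' ≠ 0 := by
        rintro rfl
        have := hpm _ h₁' _ h₂' _ h₃'
        rw [map_zero, zero_add] at e'
        rw [← e'] at this
        rcases this with h | h
        · exact hb0 h
        · linarith
      have hbi : b⁻¹ ∈ O' := hcen.inv_mem' (hAO b hb) hb0 hvb
      refine ⟨c' / c'', b⁻¹ * (b₁ - algebraMap k K (c' / c'') * b₁'), ?_,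
        b⁻¹ * (b₂ - algebraMap k K (c' / c'') * b₂'), ?_,
        b⁻¹ * (b₃ - algebraMap k K (c' / c'') * b₃'), ?_, ?_⟩
      · exact O'.mul_mem hbi (O'.sub_mem h₁ (O'.mul_mem (hk _) h₁'))
      · exact O'.mul_mem hbi (O'.sub_mem h₂ (O'.mul_mem (hk _) h₂'))
      · exact O'.mul_mem hbi (O'.sub_mem h₃ (O'.mul_mem (hk _) h₃'))
      · have hc1 : algebraMap k K c'' ≠ 0 := by simpa using hc''
        rw [div_eq_iff hb0]
        have e3 : algebraMap k K (c' / c'') * algebraMap k K c'' = algebraMap k K c' := by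
          rw [map_div₀]; field_simp
        have e4 : b⁻¹ * b = 1 := by field_simp
        linear_combination e - algebraMap k K (c' / c'') * e' - e3 -
          ((b₁ - algebraMap k K (c' / c'') * b₁') * x + (b₂ - algebraMap k K (c' / c'') * b₂') * w +
            (b₃ - algebraMap k K (c' / c'') * b₃') * z) * e4
    · refine ⟨X + (y / x) • Y, x • Y, Z, ?_, ?_, ?_, ?_, ?_, ?_, ?_⟩
      · apply hder
        · intro a ha
          exact O'.add_mem (hOO _ (pX a ha)) (O'.mul_mem (hAO _ hyxA) (hOO _ (pY a ha)))
        · rw [hDw]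
          simp [hX, hY, mul_div_cancel₀ _ x0]
      · apply hder
        · intro a ha
          exact O'.mul_mem hxO (hOO _ (pY a ha))
        · rw [hDw]
          simp [hY, x0, pow_two]
      · apply hder
        · intro a ha
          exact hOO _ (pZ a ha)
        · rw [hDw]
          simp [hZ]
      · refine ⟨by simp [hX, hY], ?_, by simp [hX, hY]⟩
        rw [hDw]; simp [hX, hY, mul_div_cancel₀ _ x0]
      · refine ⟨by simp [hY], ?_, by simp [hY]⟩
        rw [hDw]; simp [hY, x0, pow_two]
      · refine ⟨by simp [hZ], ?_, by simp [hZ]⟩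
        rw [hDw]; simp [hZ]
      · intro ξ a
        rw [hd ξ a, hDw]
        simp only [Derivation.add_apply, Derivation.smul_apply, smul_eq_mul]
        field_simp
        ring

end Chart

lemma span_range {O : Subring K} {n : ℕ} {z : Fin n → K} {a : K}
    (ha : a ∈ idealSpanSet O (Set.range z)) : ∃ b : Fin n → K, (∀ i, b i ∈ O) ∧ a = ∑ i, b i * z i := by
  obtain ⟨m, c, g, hc, hg, rfl⟩ := ha
  induction (Finset.univ : Finset (Fin m)) using Finset.induction_on with
  | empty => exact ⟨0, fun _ => O.zero_mem, by simp⟩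
  | insert j s hj ih =>
    obtain ⟨b, hb, e⟩ := ih
    obtain ⟨l, hl⟩ := hg j
    refine ⟨fun i => b i + if i = l then c j else 0, fun i => O.add_mem (hb i) ?_, ?_⟩
    · split_ifs
      · exact hc j
      · exact O.zero_mem
    · rw [Finset.sum_insert hj, e]
      simp [add_mul, Finset.sum_add_distrib, hl, add_comm]

section
variable {ν : KValuation k K ℝ} {O : Subring K}

lemma residue (hres : ν.ResidueFieldIsK) (hc : CenteredAt ν O) {a : K} (ha : a ∈ O) :
    ∃ c : k, VPos ν (a - algebraMap k K c) := by
  by_cases h : VPos ν a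
  · exact ⟨0, by simpa using h⟩
  · have h0 : a ≠ 0 := fun h0 => h (Or.inl h0)
    have hv : ν.v a = 0 := by
      have := hc.nonneg a ha h0
      have h2 : ¬ 0 < ν.v a := fun h1 => h (Or.inr h1)
      linarith
    obtain ⟨c, -, h1⟩ := hres a h0 hv
    refine ⟨c, ?_⟩
    rcases h1 with h1 | h1
    · left; rw [h1]; ring
    · right; exact h1

lemma vpos_const {c : k} (h : VPos ν (algebraMap k K c)) : c = 0 := by
  by_contra h0
  rcases h with h | h
  · exact h0 (by simpa using h)
  · rw [v_const ν c h0] at h; exact lt_irrefl _ h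

lemma rsp_card_le (hres : ν.ResidueFieldIsK) (hc : CenteredAt ν O)
    (hk : ∀ c : k, algebraMap k K c ∈ O) {m m' : ℕ} {z : Fin m → K} {w : Fin m' → K}
    (hz : IsRSP O z) (hw : IsRSP O w) : m' ≤ m := by
  by_contra hlt
  push Not at hlt
  choose a ha e using fun j => span_range (hz.gen (show w j ∈ maxIdealSet O from hw.mem j))
  choose r hr using fun j l => residue hres hc (ha j l)
  let f : (Fin m' → k) →ₗ[k] (Fin m → k) :=
    { toFun := fun c l => ∑ j, c j * r j l
      map_add' := fun a b => by ext; simp [add_mul, Finset.sum_add_distrib]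
      map_smul' := fun a b => by ext; simp [mul_assoc, Finset.mul_sum] }
  have hf : LinearMap.ker f ≠ ⊥ := LinearMap.ker_ne_bot_of_finrank_lt (by simpa using hlt)
  obtain ⟨c, hc1, hc0⟩ := Submodule.exists_mem_ne_zero_of_ne_bot hf
  apply hc0
  have hfc : ∀ l, ∑ j, c j * r j l = 0 := fun l => congrFun hc1 l
  have hsq : ∑ j, algebraMap k K (c j) * w j ∈ sqMaxIdealSet O := by
    refine ⟨m, fun _ => 1, fun l => (∑ j, algebraMap k K (c j) * (a j l - algebraMap k K (r j l))) * z l,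
      fun _ => O.one_mem, ?_, ?_⟩
    · intro l
      refine ⟨_, z l, hc.nonunit_iff.2 ⟨?_, ?_⟩, hz.mem l, rfl⟩
      · exact O.sum_mem fun j _ => O.mul_mem (hk _) (O.sub_mem (ha j l) (hk _))
      · have : ∀ s : Finset (Fin m'), VPos ν (∑ j ∈ s, algebraMap k K (c j) * (a j l - algebraMap k K (r j l))) := by
          intro s
          induction s using Finset.induction_on with
          | empty => left; simp
          | insert i s hi ih =>
            rw [Finset.sum_insert hi]
            exact (VPos.mul' (vge_const _) (hr i l)).add ih
        exact this _
    · have h1 : ∀ l, ∑ j, algebraMap k K (c j) * (a j l - algebraMap k K (r j l)) =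
          ∑ j, algebraMap k K (c j) * a j l := by
        intro l
        have := congrArg (algebraMap k K) (hfc l)
        simp only [map_sum, map_mul, map_zero] at this
        simp only [mul_sub, Finset.sum_sub_distrib, this, sub_zero]
      simp only [one_mul, h1]
      simp only [Finset.sum_mul]
      rw [Finset.sum_comm]
      refine Finset.sum_congr rfl fun j _ => ?_
      rw [e j, Finset.mul_sum]
      simp [mul_assoc]
  have := hw.indepMod _ (fun i => hk (c i)) hsq
  ext i
  exact vpos_const ((hc.nonunit_iff.1 (this i)).2)

lemma IsRSP.ne_zero (hc : CenteredAt ν O) {m : ℕ} {z : Fin m → K} (hz : IsRSP O z) (i : Fin m) :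
    z i ≠ 0 := by
  intro h
  have := hz.indepMod (Pi.single i 1) (fun j => by
    by_cases hj : j = i
    · subst hj; simp
    · simp [hj]) (by
    refine ⟨0, 0, 0, fun i => i.elim0, fun i => i.elim0, ?_⟩
    simp [Pi.single_apply, h]) i
  have h2 := (hc.nonunit_iff.1 this).2
  simp only [Pi.single_eq_same] at h2
  exact not_vpos_one h2

/-- S2 : a derivation killing the parameters vanishes -/
lemma der_eq_zero (hres : ν.ResidueFieldIsK) (hO : IsLocalModel k O) (hc : CenteredAt ν O)
    {m : ℕ} {z : Fin m → K} (hz : IsRSP O z) (δ : Derivation k K K) (hδ : ∀ i, δ (z i) = 0) :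
    δ = 0 := by
  by_contra hne
  obtain ⟨s, hsO, hs⟩ := hO.essFinType
  have hadjO : ∀ p ∈ Algebra.adjoin k (s : Set K), p ∈ O := by
    intro p hp
    induction hp using Algebra.adjoin_induction with
    | mem x hx => exact hsO hx
    | algebraMap c => exact hO.algk c
    | add a b _ _ ha hb => exact O.add_mem ha hb
    | mul a b _ _ ha hb => exact O.mul_mem ha hb
  have hlift : ∀ μ : ℝ, (∀ t ∈ s, VGe ν μ (δ t)) → ∀ a ∈ O, VGe ν μ (δ a) := by
    intro μ hμ
    have h1 : ∀ p ∈ Algebra.adjoin k (s : Set K), VGe ν μ (δ p) := by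
      intro p hp
      induction hp using Algebra.adjoin_induction with
      | mem x hx => exact hμ x hx
      | algebraMap c => simp [VGe]
      | add a b _ _ ha hb => rw [map_add]; exact ha.add hb
      | mul a b hpa hpb ha hb =>
        rw [Derivation.leibniz]
        have h1 := (hc.vge (hadjO a hpa)).mul hb
        have h2 := (hc.vge (hadjO b hpb)).mul ha
        rw [zero_add] at h1 h2
        exact h1.add h2
    intro a ha
    obtain ⟨p, q, hp, hq, hqO, hqu, e⟩ := hs a ha
    have hq0 : q ≠ 0 := fun h0 => hqu ⟨hqO, Or.inl h0⟩
    have hqi : q⁻¹ ∈ O := by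
      by_contra h; exact hqu ⟨hqO, Or.inr h⟩
    have e2 : δ a = q⁻¹ * (δ p - a * δ q) := by
      have := congrArg δ e
      rw [Derivation.leibniz, smul_eq_mul, smul_eq_mul] at this
      rw [← this]; field_simp; ring
    rw [e2]
    have h3 : VGe ν μ (δ p - a * δ q) := by
      have h4 := (hc.vge ha).mul (h1 q hq)
      rw [zero_add] at h4
      rw [sub_eq_add_neg]
      exact (h1 p hp).add h4.neg
    have := (hc.vge hqi).mul h3
    rwa [zero_add] at this
  -- some generator is not killed
  let T := s.filter fun t => δ t ≠ 0
  have hT : T.Nonempty := by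
    by_contra hT
    rw [Finset.not_nonempty_iff_eq_empty] at hT
    have h0 : ∀ t ∈ s, δ t = 0 := by
      intro t ht
      by_contra h
      have : t ∈ T := Finset.mem_filter.2 ⟨ht, h⟩
      rw [hT] at this; simp at this
    have h1 : ∀ a ∈ O, δ a = 0 := by
      intro a ha
      by_contra hna
      have := (hlift (ν.v (δ a) + 1) (fun t ht => Or.inl (h0 t ht)) a ha).resolve_left hna
      linarith
    apply hne
    ext u
    obtain ⟨a, b, ha, hb, hb0, rfl⟩ := hO.frac u
    rw [Derivation.leibniz_div, h1 a ha, h1 b hb]; simp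
  obtain ⟨t0, ht0, hmin⟩ := Finset.exists_min_image T (fun t => ν.v (δ t)) hT
  have ht0' := Finset.mem_filter.1 ht0
  have hμ := hlift (ν.v (δ t0)) (fun t ht => by
    by_cases h : δ t = 0
    · exact Or.inl h
    · exact Or.inr (hmin t (Finset.mem_filter.2 ⟨ht, h⟩)))
  obtain ⟨c, hcp⟩ := residue hres hc (hsO ht0'.1)
  obtain ⟨b, hb, e⟩ := span_range (hz.gen (show t0 - algebraMap k K c ∈ maxIdealSet O from
    hc.nonunit_iff.2 ⟨O.sub_mem (hsO ht0'.1) (hO.algk c), hcp⟩))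
  have e2 : δ t0 = ∑ i, z i * δ (b i) := by
    have := congrArg δ e
    simp only [map_sub, Derivation.map_algebraMap, sub_zero, map_sum, Derivation.leibniz, hδ,
      smul_zero, zero_add, smul_eq_mul, mul_zero] at this
    exact this
  have h5 : ∃ ε > 0, ∀ i, VGe ν ε (z i) := by
    rcases isEmpty_or_nonempty (Fin m) with hm | hm
    · exact ⟨1, one_pos, fun i => hm.elim i⟩
    · obtain ⟨i0, -, hi0⟩ := Finset.exists_min_image Finset.univ (fun i => ν.v (z i)) Finset.univ_nonempty
      exact ⟨ν.v (z i0), ((hc.nonunit_iff.1 (hz.mem i0)).2).resolve_left (hz.ne_zero hc i0),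
        fun i => Or.inr (hi0 i (Finset.mem_univ i))⟩
  obtain ⟨ε, hε, h5⟩ := h5
  have h6 : VGe ν (ε + ν.v (δ t0)) (δ t0) := by
    nth_rewrite 2 [e2]
    exact VGe.sum fun i _ => (h5 i).mul (hμ _ (hb i))
  have := h6.resolve_left ht0'.2
  linarith

/-- S4 -/
lemma der_preserve (hres : ν.ResidueFieldIsK) (hO : IsLocalModel k O) (hc : CenteredAt ν O)
    {m : ℕ} {z : Fin m → K} (hz : IsRSP O z) (δ : Derivation k K K) (hδ : ∀ i, δ (z i) ∈ O) :
    ∀ a ∈ O, δ a ∈ O := by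
  obtain ⟨s, hsO, hs⟩ := hO.essFinType
  have hadjO : ∀ p ∈ Algebra.adjoin k (s : Set K), p ∈ O := by
    intro p hp
    induction hp using Algebra.adjoin_induction with
    | mem x hx => exact hsO hx
    | algebraMap c => exact hO.algk c
    | add a b _ _ ha hb => exact O.add_mem ha hb
    | mul a b _ _ ha hb => exact O.mul_mem ha hb
  let E : Submodule O K := Submodule.span O (δ '' (s : Set K))
  have hsm : ∀ a ∈ O, ∀ b ∈ E, a * b ∈ E := fun a ha b hb => E.smul_mem ⟨a, ha⟩ hb
  have hadj : ∀ p ∈ Algebra.adjoin k (s : Set K), δ p ∈ E := by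
    intro p hp
    induction hp using Algebra.adjoin_induction with
    | mem x hx => exact Submodule.subset_span ⟨x, hx, rfl⟩
    | algebraMap c => simp
    | add a b _ _ ha hb => rw [map_add]; exact E.add_mem ha hb
    | mul a b hpa hpb ha hb =>
      rw [Derivation.leibniz]
      exact E.add_mem (hsm _ (hadjO a hpa) _ hb) (hsm _ (hadjO b hpb) _ ha)
  have hE : ∀ a ∈ O, δ a ∈ E := by
    intro a ha
    obtain ⟨p, q, hp, hq, hqO, hqu, e⟩ := hs a ha
    have hq0 : q ≠ 0 := fun h0 => hqu ⟨hqO, Or.inl h0⟩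
    have hqi : q⁻¹ ∈ O := by
      by_contra h; exact hqu ⟨hqO, Or.inr h⟩
    have e2 : δ a = q⁻¹ * (δ p - a * δ q) := by
      have := congrArg δ e
      rw [Derivation.leibniz, smul_eq_mul, smul_eq_mul] at this
      rw [← this]; field_simp; ring
    rw [e2]
    exact hsm _ hqi _ (E.sub_mem (hadj p hp) (hsm _ ha _ (hadj q hq)))
  let I : Ideal O := Ideal.span (Set.range fun i => (⟨z i, (hz.mem i).1⟩ : O))
  have hI : I ≤ Ideal.jacobson ⊥ := by
    refine Ideal.span_le.2 ?_
    rintro _ ⟨i, rfl⟩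
    refine Ideal.mem_jacobson_bot.2 fun y => ?_
    have hp : VPos ν (z i * y) := ((hc.nonunit_iff.1 (hz.mem i)).2).mul (hc.vge y.2)
    have hu := v_unit_add (ν := ν) (c := 1) one_ne_zero hp
    rw [map_one, add_comm] at hu
    refine IsUnit.of_mul_eq_one ⟨(z i * y + 1)⁻¹, ?_⟩ ?_
    · exact hc.inv_mem' (O.add_mem (O.mul_mem (hz.mem i).1 y.2) O.one_mem) hu.1 hu.2
    · apply Subtype.ext
      simp [hu.1]
  let N : Submodule O K := Submodule.span O {1}
  have hN : ∀ a, a ∈ N → a ∈ O := by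
    intro a ha
    obtain ⟨t, rfl⟩ := Submodule.mem_span_singleton.1 ha
    rw [Subring.smul_def]; simp
  have hNO : ∀ a, a ∈ O → a ∈ N := fun a ha =>
    Submodule.mem_span_singleton.2 ⟨⟨a, ha⟩, by rw [Subring.smul_def]; simp⟩
  have hle : E ≤ N ⊔ I • E := by
    refine Submodule.span_le.2 ?_
    rintro _ ⟨t, ht, rfl⟩
    obtain ⟨c, hcp⟩ := residue hres hc (hsO ht)
    obtain ⟨b, hb, e⟩ := span_range (hz.gen (show t - algebraMap k K c ∈ maxIdealSet O from
      hc.nonunit_iff.2 ⟨O.sub_mem (hsO ht) (hO.algk c), hcp⟩))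
    have e2 : δ t = ∑ i, b i * δ (z i) + ∑ i, z i * δ (b i) := by
      have := congrArg δ e
      simp only [map_sub, Derivation.map_algebraMap, sub_zero, map_sum, Derivation.leibniz,
        smul_eq_mul, Finset.sum_add_distrib] at this
      exact this
    rw [e2]
    refine Submodule.add_mem_sup (hNO _ (O.sum_mem fun i _ => O.mul_mem (hb i) (hδ i))) ?_
    refine Submodule.sum_mem _ fun i _ => ?_
    exact Submodule.smul_mem_smul (r := (⟨z i, (hz.mem i).1⟩ : O))
      (Ideal.subset_span ⟨i, rfl⟩) (hE _ (hb i))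
  have hfin : E.FG := Submodule.fg_span (s.finite_toSet.image _)
  have := Submodule.le_of_le_smul_of_le_jacobson_bot hfin hI hle
  intro a ha
  exact hN _ (this (hE a ha))

lemma setup_chart [CharZero k] (hK : IsFunctionField k K 3) (hres : ν.ResidueFieldIsK)
    (hO : IsLocalModel k O) (hc : CenteredAt ν O) {z : Fin 3 → K} (hz : IsRSP O z) :
    Chart ν O (z 0) (z 1) (z 2) := by
  obtain ⟨-, t, ht⟩ := hK
  have hzero := der_eq_zero hres hO hc hz
  obtain ⟨D, hD⟩ := exists_dual t ht z hzero
  have hv : ∀ i, 0 < ν.v (z i) := fun i =>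
    ((hc.nonunit_iff.1 (hz.mem i)).2).resolve_left (hz.ne_zero hc i)
  have hpres : ∀ i, ∀ a ∈ O, D i a ∈ O := by
    intro i
    refine der_preserve hres hO hc hz (D i) fun j => ?_
    rw [hD]; split_ifs
    · exact O.one_mem
    · exact O.zero_mem
  refine ⟨hc, hO.algk, (hz.mem 0).1, (hz.mem 1).1, (hz.mem 2).1, hz.ne_zero hc 0, hz.ne_zero hc 1,
    hz.ne_zero hc 2, hv 0, hv 1, hv 2, ?_, D 0, D 1, D 2, hpres 0, hpres 1, hpres 2, ?_, ?_, ?_, ?_⟩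
  · intro a ha
    obtain ⟨c, hcp⟩ := residue hres hc ha
    obtain ⟨b, hb, e⟩ := span_range (hz.gen (show a - algebraMap k K c ∈ maxIdealSet O from
      hc.nonunit_iff.2 ⟨O.sub_mem ha (hO.algk c), hcp⟩))
    refine ⟨c, b 0, hb 0, b 1, hb 1, b 2, hb 2, ?_⟩
    rw [Fin.sum_univ_three] at e
    linear_combination e
  · simp [hD]
  · simp [hD]
  · simp [hD]
  · intro ξ a
    have : ξ - (ξ (z 0) • D 0 + ξ (z 1) • D 1 + ξ (z 2) • D 2) = 0 := by
      apply hzero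
      intro i
      fin_cases i <;> simp [hD]
    have h2 := congrArg (fun η : Derivation k K K => η a) this
    simp at h2
    linear_combination h2

end

/-- the sequence of approximations of the maximal contact series -/
structure FSeq (ν : KValuation k K ℝ) (O : Subring K) (x y : K) (f : ℕ → K) : Prop where
  chart : ∀ i, Chart ν O x y (f i)
  lim : ∀ B : ℝ, ∃ i₀, ∀ i, i₀ ≤ i → B < ν.v (f i)
  rel : ∀ i, ∃ b₁ ∈ O, ∃ b₂ ∈ O, ∃ u ∈ O, ¬ VPos ν u ∧ f i = b₁ * x + b₂ * y + u * f 0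

lemma FSeq.trans {ν : KValuation k K ℝ} {O O' : Subring K} {x y x' y' : K} {f : ℕ → K}
    (h : FSeq ν O x y f) (hO : O ≤ O') (hc : Chart ν O' x' y' (f 0))
    (hx : ∃ a ∈ O', ∃ b ∈ O', x = a * x' + b * y') (hy : ∃ a ∈ O', ∃ b ∈ O', y = a * x' + b * y') :
    FSeq ν O' x' y' f := by
  have hrel : ∀ i, ∃ b₁ ∈ O', ∃ b₂ ∈ O', ∃ u ∈ O', ¬ VPos ν u ∧ f i = b₁ * x' + b₂ * y' + u * f 0 := by
    intro i
    obtain ⟨b₁, h₁, b₂, h₂, u, hu, hn, e⟩ := h.rel i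
    obtain ⟨a, ha, b, hb, ex⟩ := hx
    obtain ⟨a', ha', b', hb', ey⟩ := hy
    refine ⟨b₁ * a + b₂ * a', O'.add_mem (O'.mul_mem (hO h₁) ha) (O'.mul_mem (hO h₂) ha'),
      b₁ * b + b₂ * b', O'.add_mem (O'.mul_mem (hO h₁) hb) (O'.mul_mem (hO h₂) hb'), u, hO hu, hn, ?_⟩
    rw [e, ex, ey]; ring
  refine ⟨fun i => ?_, h.lim, hrel⟩
  obtain ⟨b₁, h₁, b₂, h₂, u, hu, hn, e⟩ := hrel i
  exact hc.change3 h₁ h₂ hu hn e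

/-- reachable by a finite sequence of steps, with increasing rings -/
def Reach (ν : KValuation k K ℝ) (O O' : Subring K) : Prop :=
  Relation.ReflTransGen (LocalBlowUpStep ν) O O' ∧ O ≤ O'

lemma Reach.refl (ν : KValuation k K ℝ) (O : Subring K) : Reach ν O O :=
  ⟨Relation.ReflTransGen.refl, le_rfl⟩

lemma Reach.trans {ν : KValuation k K ℝ} {O O' O'' : Subring K} (h : Reach ν O O')
    (h' : Reach ν O' O'') : Reach ν O O'' := ⟨h.1.trans h'.1, h.2.trans h'.2⟩

section
variable {ν : KValuation k K ℝ} {O : Subring K} {x y z : K}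

lemma Chart.e1 (h : Chart ν O x y z) (hv : ν.v x < ν.v y) :
    ∃ O', Reach ν O O' ∧ Chart ν O' x (y / x) z := by
  have := h.blowup 0 (by simpa using ⟨h.y0, h.x0⟩) (by
    rw [map_zero, sub_zero, v_div ν _ _ h.y0 h.x0]; linarith)
  obtain ⟨O', h1, h2, h3⟩ := this
  exact ⟨O', ⟨Relation.ReflTransGen.single h1, h2⟩, by simpa using h3⟩

lemma Chart.e1z (h : Chart ν O x y z) (hv : ν.v x < ν.v z) :
    ∃ O', Reach ν O O' ∧ Chart ν O' x y (z / x) := by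
  obtain ⟨O', h1, h2⟩ := h.swap23.e1 hv
  exact ⟨O', h1, h2.swap23⟩

lemma Chart.e2 (h : Chart ν O x y z) (hv : ν.v y < ν.v x) :
    ∃ O', Reach ν O O' ∧ Chart ν O' (x / y) y z := by
  obtain ⟨O', h1, h2⟩ := h.swap12.e1 hv
  exact ⟨O', h1, h2.swap12⟩

lemma Chart.sub_ne (h : Chart ν O x y z) (c : k) : y / x - algebraMap k K c ≠ 0 := by
  intro h0
  obtain ⟨X, Y, Z, pX, pY, pZ, hX, hY, hZ, hd⟩ := h.der
  have e : y = algebraMap k K c * x := by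
    have := h.x0
    field_simp at h0
    linear_combination h0
  have := congrArg Y e
  rw [Derivation.leibniz, hY.1, hY.2.1] at this
  simp at this

lemma Chart.e3 (hres : ν.ResidueFieldIsK) (h : Chart ν O x y z) (hv : ν.v y = ν.v x) :
    ∃ O', Reach ν O O' ∧ ∃ c : k, c ≠ 0 ∧ Chart ν O' x (y / x - algebraMap k K c) z := by
  obtain ⟨c, hc, hc'⟩ := hres (y / x) (div_ne_zero h.y0 h.x0) (by
    rw [v_div ν _ _ h.y0 h.x0]; linarith)
  have hn := h.sub_ne c
  obtain ⟨O', h1, h2, h3⟩ := h.blowup c hn (hc'.resolve_left fun e => hn (by rw [e, sub_self]))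
  exact ⟨O', ⟨Relation.ReflTransGen.single h1, h2⟩, c, hc, h3⟩

lemma Chart.divPow (h : Chart ν O x y z) (N : ℕ) (hv : N * ν.v x < ν.v z) :
    ∃ O', Reach ν O O' ∧ Chart ν O' x y (z / x ^ N) := by
  induction N with
  | zero => exact ⟨O, Reach.refl ν O, by simpa using h⟩
  | succ N ih =>
    push_cast at hv
    obtain ⟨O', h1, h2⟩ := ih (by nlinarith [h.vx])
    obtain ⟨O'', h3, h4⟩ := h2.e1z (by
      rw [v_div ν _ _ h.z0 (pow_ne_zero _ h.x0), v_pow ν _ h.x0]; linarith)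
    refine ⟨O'', h1.trans h3, ?_⟩
    rwa [pow_succ, ← div_div]

/-- the powers of the ideal `(x, y)` -/
def pw (O : Subring K) (x y : K) : ℕ → Set K
  | 0 => (O : Set K)
  | M + 1 => {g | ∃ a ∈ pw O x y M, ∃ b ∈ pw O x y M, g = x * a + y * b}

lemma pw_zero_mem (M : ℕ) : (0 : K) ∈ pw O x y M := by
  induction M with
  | zero => exact O.zero_mem
  | succ M ih => exact ⟨0, ih, 0, ih, by ring⟩

lemma pw_add {M : ℕ} {a b : K} (ha : a ∈ pw O x y M) (hb : b ∈ pw O x y M) : a + b ∈ pw O x y M := by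
  induction M generalizing a b with
  | zero => exact O.add_mem ha hb
  | succ M ih =>
    obtain ⟨a1, h1, a2, h2, rfl⟩ := ha
    obtain ⟨b1, h3, b2, h4, rfl⟩ := hb
    exact ⟨_, ih h1 h3, _, ih h2 h4, by ring⟩

lemma pw_mul {M : ℕ} {a b : K} (ha : a ∈ O) (hb : b ∈ pw O x y M) : a * b ∈ pw O x y M := by
  induction M generalizing b with
  | zero => exact O.mul_mem ha hb
  | succ M ih =>
    obtain ⟨b1, h3, b2, h4, rfl⟩ := hb
    exact ⟨_, ih h3, _, ih h4, by ring⟩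

lemma pw_sum {ι : Type*} (s : Finset ι) (g : ι → K) {M : ℕ} (h : ∀ i ∈ s, g i ∈ pw O x y M) :
    ∑ i ∈ s, g i ∈ pw O x y M := by
  induction s using Finset.induction_on with
  | empty => simpa using pw_zero_mem M
  | insert a s ha ih =>
    rw [Finset.sum_insert ha]
    exact pw_add (h a (by simp)) (ih fun i hi => h i (by simp [hi]))

lemma pw_anti (hx : x ∈ O) (hy : y ∈ O) {M M' : ℕ} (h : M ≤ M') : pw O x y M' ⊆ pw O x y M := by
  induction h with
  | refl => exact subset_rfl
  | step h ih =>
    refine Set.Subset.trans ?_ ih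
    rintro _ ⟨a, ha, b, hb, rfl⟩
    exact pw_add (pw_mul hx ha) (pw_mul hy hb)

lemma pw_monom (hx : x ∈ O) (hy : y ∈ O) (u v : ℕ) : x ^ u * y ^ v ∈ pw O x y (u + v) := by
  induction u with
  | zero =>
    induction v with
    | zero => simpa [pw] using O.one_mem
    | succ v ih => exact ⟨0, pw_zero_mem _, _, ih, by ring⟩
  | succ u ih =>
    rw [show u + 1 + v = (u + v) + 1 by ring]
    exact ⟨_, ih, 0, pw_zero_mem _, by ring⟩

/-- if `x, y` are multiples of `t` then `pw M` consists of multiples of `t ^ M` -/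
lemma pw_sub {O' : Subring K} (hO : O ≤ O') {t : K} (hx : ∃ a ∈ O', x = t * a)
    (hy : ∃ a ∈ O', y = t * a) {M : ℕ} {g : K} (hg : g ∈ pw O x y M) : ∃ a ∈ O', g = t ^ M * a := by
  induction M generalizing g with
  | zero => exact ⟨g, hO hg, by simp⟩
  | succ M ih =>
    obtain ⟨a, ha, b, hb, rfl⟩ := hg
    obtain ⟨a', ha', rfl⟩ := ih ha
    obtain ⟨b', hb', rfl⟩ := ih hb
    obtain ⟨s, hs, rfl⟩ := hx
    obtain ⟨s', hs', rfl⟩ := hy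
    exact ⟨s * a' + s' * b', O'.add_mem (O'.mul_mem hs ha') (O'.mul_mem hs' hb'), by ring⟩

lemma pw_vge (hc : CenteredAt ν O) {ε : ℝ} (hx : VGe ν ε x) (hy : VGe ν ε y) {M : ℕ} {g : K}
    (hg : g ∈ pw O x y M) : VGe ν (M * ε) g := by
  induction M generalizing g with
  | zero => simpa using hc.vge hg
  | succ M ih =>
    obtain ⟨a, ha, b, hb, rfl⟩ := hg
    have := (hx.mul (ih ha)).add (hy.mul (ih hb))
    push_cast
    convert this using 1
    ring

end

/-- polynomials in two variables: outer variable `X`, inner variable `Y` -/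
abbrev Pol (k : Type) [Field k] := Polynomial (Polynomial k)

open Polynomial in
/-- evaluation at `(x, y)` -/
def ev (k : Type) [Field k] [Algebra k K] (x y : K) : Pol k →+* K :=
  Polynomial.eval₂RingHom (Polynomial.aeval (R := k) y).toRingHom x

/-- the polynomial has a nonzero coefficient of degree less than `D` -/
def Low (D : ℕ) (P : Pol k) : Prop := ∃ u v, u + v < D ∧ (P.coeff u).coeff v ≠ 0

lemma ev_eq_sum (x y : K) (P : Pol k) :
    ev k x y P = ∑ u ∈ P.support, ∑ v ∈ (P.coeff u).support,
      algebraMap k K ((P.coeff u).coeff v) * (x ^ u * y ^ v) := by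
  unfold ev
  rw [Polynomial.coe_eval₂RingHom, Polynomial.eval₂_eq_sum, Polynomial.sum_def]
  refine Finset.sum_congr rfl fun u _ => ?_
  rw [AlgHom.toRingHom_eq_coe, RingHom.coe_coe, Polynomial.aeval_eq_sum_range' (n := (P.coeff u).natDegree + 1) (Nat.lt_succ_self _),
    Finset.sum_mul]
  symm
  refine Finset.sum_subset_zero_on_sdiff Polynomial.supp_subset_range_natDegree_succ ?_ ?_
  · intro v hv
    have : (P.coeff u).coeff v = 0 := by simpa using (Finset.mem_sdiff.1 hv).2
    simp [this]
  · intro v _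
    rw [Algebra.smul_def]; ring

section
variable {ν : KValuation k K ℝ} {O : Subring K} {x y z : K}

lemma ev_mem (hk : ∀ c : k, algebraMap k K c ∈ O) (hx : x ∈ O) (hy : y ∈ O) (P : Pol k) :
    ev k x y P ∈ O := by
  rw [ev_eq_sum]
  exact O.sum_mem fun u _ => O.sum_mem fun v _ => O.mul_mem (hk _) (O.mul_mem (O.pow_mem hx _) (O.pow_mem hy _))

lemma ev_mem_pw (hk : ∀ c : k, algebraMap k K c ∈ O) (hx : x ∈ O) (hy : y ∈ O) {D : ℕ} {P : Pol k}
    (h : ¬ Low D P) : ev k x y P ∈ pw O x y D := by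
  rw [ev_eq_sum]
  refine pw_sum _ _ fun u hu => pw_sum _ _ fun v hv => pw_mul (hk _) ?_
  refine pw_anti hx hy ?_ (pw_monom hx hy u v)
  by_contra hlt
  exact h ⟨u, v, by omega, by simpa using hv⟩

lemma ev_C (x y : K) (c : k) : ev k x y (Polynomial.C (Polynomial.C c)) = algebraMap k K c := by
  simp [ev]
lemma ev_X (x y : K) : ev k x y Polynomial.X = x := by
  simp [ev]
lemma ev_Y (x y : K) : ev k x y (Polynomial.C Polynomial.X) = y := by
  simp [ev]

lemma Chart.expand (h : Chart ν O x y z) (M : ℕ) {g : K} (hg : g ∈ O) :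
    ∃ P : Pol k, ∃ e ∈ pw O x y M, ∃ s ∈ O, g = ev k x y P + z * s + e := by
  induction M generalizing g with
  | zero => exact ⟨0, g, hg, 0, O.zero_mem, by simp⟩
  | succ M ih =>
    obtain ⟨c, b₁, h₁, b₂, h₂, b₃, h₃, e⟩ := h.gen g hg
    obtain ⟨P1, e1, he1, s1, hs1, E1⟩ := ih h₁
    obtain ⟨P2, e2, he2, s2, hs2, E2⟩ := ih h₂
    refine ⟨Polynomial.C (Polynomial.C c) + Polynomial.X * P1 + Polynomial.C Polynomial.X * P2,
      x * e1 + y * e2, ⟨e1, he1, e2, he2, rfl⟩, x * s1 + y * s2 + b₃,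
      O.add_mem (O.add_mem (O.mul_mem h.hx hs1) (O.mul_mem h.hy hs2)) h₃, ?_⟩
    rw [map_add, map_add, map_mul, map_mul, ev_C, ev_X, ev_Y, e]
    linear_combination x * E1 + y * E2

/-- a fixed nonzero element has an expansion with a low order term -/
lemma Chart.low (h : Chart ν O x y z) {g : K} (h0 : g ≠ 0) (hz : ν.v g < ν.v z) {D M : ℕ} {ε : ℝ}
    (hεx : ε ≤ ν.v x) (hεy : ε ≤ ν.v y) (hD : ν.v g < D * ε) (hM : D ≤ M) {P : Pol k} {e s : K}
    (he : e ∈ pw O x y M) (hs : s ∈ O) (E : g = ev k x y P + z * s + e) : Low D P := by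
  by_contra hn
  have h1 := ev_mem_pw h.algk h.hx h.hy hn
  have h2 : VGe ν (D * ε) (ev k x y P + e) :=
    pw_vge h.cen (Or.inr hεx) (Or.inr hεy) (pw_add h1 (pw_anti h.hx h.hy hM he))
  have h3 : VGe ν (ν.v z) (z * s) := by
    have := VGe.mul (show VGe ν (ν.v z) z from Or.inr le_rfl) (h.cen.vge hs)
    rwa [add_zero] at this
  have h4 : VGe ν (min (D * ε) (ν.v z)) g := by
    have := (h2.mono (min_le_left _ (ν.v z))).add (h3.mono (min_le_right (D * ε) _))
    rwa [show ev k x y P + e + z * s = g by rw [E]; ring] at this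
  have h5 := h4.resolve_left h0
  exact absurd (lt_min hD hz) (not_lt.2 h5)

end

section
open Polynomial

/-- the substitution `X ↦ X^d W^α`, `Y ↦ X^p W^β`, `W = Y + c`. -/
def sig (d p α β : ℕ) (c : k) : Pol k →+* Pol k :=
  Polynomial.eval₂RingHom
    (Polynomial.aeval (R := k) ((X : Pol k) ^ p * C ((X + C c) ^ β))).toRingHom
    (X ^ d * C ((X + C c) ^ α))

lemma sig_coeff (d p α β : ℕ) (c : k) (F : Pol k) (j : ℕ) :
    (sig d p α β c F).coeff j = ∑ u ∈ F.support, ∑ v ∈ (F.coeff u).support,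
      if d * u + p * v = j then C ((F.coeff u).coeff v) * (X + C c) ^ (α * u + β * v) else 0 := by
  unfold sig
  rw [Polynomial.coe_eval₂RingHom, Polynomial.eval₂_eq_sum, Polynomial.sum_def, Polynomial.finset_sum_coeff]
  refine Finset.sum_congr rfl fun u _ => ?_
  rw [AlgHom.toRingHom_eq_coe, RingHom.coe_coe, Polynomial.aeval_eq_sum_range' (n := (F.coeff u).natDegree + 1) (Nat.lt_succ_self _),
    Finset.sum_mul, Polynomial.finset_sum_coeff]
  symm
  refine Finset.sum_subset_zero_on_sdiff Polynomial.supp_subset_range_natDegree_succ ?_ ?_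
  · intro v hv
    have : (F.coeff u).coeff v = 0 := by simpa using (Finset.mem_sdiff.1 hv).2
    simp [this]
  · intro v _
    have e : ((F.coeff u).coeff v • ((X : Pol k) ^ p * C ((X + C c) ^ β)) ^ v) * (X ^ d * C ((X + C c) ^ α)) ^ u
      = C (C ((F.coeff u).coeff v) * (X + C c) ^ (α * u + β * v)) * X ^ (d * u + p * v) := by
      rw [Algebra.smul_def, show algebraMap k (Pol k) ((F.coeff u).coeff v) = C (C ((F.coeff u).coeff v)) from rfl]
      rw [mul_pow, mul_pow, ← pow_mul, ← pow_mul, ← C_pow, ← C_pow, ← pow_mul, ← pow_mul, C_mul,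
        pow_add, pow_add, C_mul]
      ring
    rw [e, Polynomial.coeff_C_mul_X_pow]
    simp only [eq_comm]

lemma ev_sig (d p α β : ℕ) (c : k) {x y x₁ y₁ : K}
    (hx : x = x₁ ^ d * (y₁ + algebraMap k K c) ^ α) (hy : y = x₁ ^ p * (y₁ + algebraMap k K c) ^ β)
    (F : Pol k) : ev k x₁ y₁ (sig d p α β c F) = ev k x y F := by
  have : (ev k x₁ y₁).comp (sig d p α β c) = ev k x y := by
    apply Polynomial.ringHom_ext'
    · apply Polynomial.ringHom_ext'
      · ext a
        simp [ev, sig]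
      · simp only [ev, sig, RingHom.comp_apply, coe_eval₂RingHom, eval₂_C, AlgHom.toRingHom_eq_coe, RingHom.coe_coe, aeval_X, hy, eval₂_mul, eval₂_pow, eval₂_add, eval₂_X, map_pow, map_add, aeval_C]
    · simp only [ev, sig, RingHom.comp_apply, coe_eval₂RingHom, eval₂_C, AlgHom.toRingHom_eq_coe, RingHom.coe_coe, aeval_X, hx, eval₂_mul, eval₂_pow, eval₂_add, eval₂_X, map_pow, map_add, aeval_C]
  exact DFunLike.congr_fun this F

/-- coefficient -/
abbrev cf (F : Pol k) (u v : ℕ) : k := (F.coeff u).coeff v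

/-- order bound: if `q = ∑_{n} e_n W^n` with `n ∈ [n₀, n₀ + m]` is nonzero then `Y^{m+1} ∤ q` -/
lemma ord_bound {c : k} (hc : c ≠ 0) (g : k[X]) (hg : g ≠ 0) (n₀ m : ℕ)
    (hs : ∀ n ∈ g.support, n₀ ≤ n ∧ n ≤ n₀ + m) :
    ∃ v ≤ m, (g.comp (X + C c)).coeff v ≠ 0 := by
  by_contra hcon
  push Not at hcon
  have hd : (X : k[X]) ^ (m + 1) ∣ g.comp (X + C c) := by
    rw [Polynomial.X_pow_dvd_iff]
    intro v hv; exact hcon v (by omega)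
  obtain ⟨g', rfl⟩ : ∃ g', g = X ^ n₀ * g' := by
    have : X ^ n₀ ∣ g := by
      rw [Polynomial.X_pow_dvd_iff]
      intro v hv
      by_contra h
      have := (hs v (by simpa using h)).1
      omega
    exact this
  have hg' : g' ≠ 0 := by rintro rfl; simp at hg
  have hdeg : g'.natDegree ≤ m := by
    have hmem := (hs (n₀ + g'.natDegree) (by
      rw [Polynomial.mem_support_iff, Polynomial.coeff_X_pow_mul', if_pos (by omega)]
      simpa using hg')).2
    omega
  have hcop : IsCoprime ((X : k[X]) ^ (m + 1)) ((X + C c) ^ n₀) := by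
    apply IsCoprime.pow
    refine ⟨-C c⁻¹, C c⁻¹, ?_⟩
    have : C c⁻¹ * C c = (1 : k[X]) := by rw [← C_mul, inv_mul_cancel₀ hc, C_1]
    linear_combination this
  rw [mul_comp, pow_comp, X_comp] at hd
  have h2 := hcop.dvd_of_dvd_mul_left hd
  have h3 : g'.comp (X + C c) ≠ 0 := by
    intro h
    have := congrArg (fun q : k[X] => q.comp (X - C c)) h
    simp [Polynomial.comp_assoc] at this
    exact hg' this
  have h4 := Polynomial.natDegree_le_of_dvd h2 h3
  rw [Polynomial.natDegree_comp, Polynomial.natDegree_X_pow, Polynomial.natDegree_X_add_C, mul_one] at h4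
  omega

/-- weight `μ` part in the variable `W` -/
def wpart (d p α β : ℕ) (F : Pol k) (j : ℕ) : k[X] :=
  ∑ u ∈ F.support, ∑ v ∈ (F.coeff u).support,
      if d * u + p * v = j then C ((F.coeff u).coeff v) * X ^ (α * u + β * v) else 0

lemma sig_coeff' (d p α β : ℕ) (c : k) (F : Pol k) (j : ℕ) :
    (sig d p α β c F).coeff j = (wpart d p α β F j).comp (X + C c) := by
  rw [sig_coeff, wpart, ← Polynomial.coe_compRingHom_apply, map_sum]
  refine Finset.sum_congr rfl fun u _ => ?_
  rw [map_sum]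
  refine Finset.sum_congr rfl fun v _ => ?_
  split_ifs <;> simp

lemma sig_coeff_zero {d p α β : ℕ} {c : k} {F : Pol k} {j : ℕ}
    (h : ∀ u v, cf F u v ≠ 0 → d * u + p * v ≠ j) : (sig d p α β c F).coeff j = 0 := by
  rw [sig_coeff]
  refine Finset.sum_eq_zero fun u _ => Finset.sum_eq_zero fun v hv => if_neg (h u v (by simpa using hv))

lemma wpart_supp {d p α β : ℕ} {F : Pol k} {j n : ℕ} (hn : n ∈ (wpart d p α β F j).support) :
    ∃ u v, cf F u v ≠ 0 ∧ d * u + p * v = j ∧ n = α * u + β * v := by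
  by_contra hcon
  push Not at hcon
  rw [Polynomial.mem_support_iff] at hn
  apply hn
  rw [wpart, Polynomial.finset_sum_coeff]
  refine Finset.sum_eq_zero fun u _ => ?_
  rw [Polynomial.finset_sum_coeff]
  refine Finset.sum_eq_zero fun v hv => ?_
  split_ifs with h
  · rw [Polynomial.coeff_C_mul_X_pow, if_neg (hcon u v (by simpa using hv) h)]
  · simp

lemma weight_n {d p α β u v μ : ℕ} (hd : d * β = p * α + 1) (h : d * u + p * v = μ) :
    d * (α * u + β * v) = α * μ + v := by
  subst h
  linear_combination v * hd

lemma wpart_coeff {d p α β : ℕ} (hd0 : 1 ≤ d) (hd : d * β = p * α + 1) {F : Pol k} {u v j : ℕ}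
    (h : d * u + p * v = j) :
    (wpart d p α β F j).coeff (α * u + β * v) = cf F u v := by
  rw [wpart, Polynomial.finset_sum_coeff]
  have key : ∀ u' v', d * u' + p * v' = j → α * u + β * v = α * u' + β * v' → u' = u ∧ v' = v := by
    intro u' v' h' e
    have h1 := weight_n hd h
    have h2 := weight_n hd h'
    rw [e] at h1
    have hv : v' = v := by omega
    subst hv
    refine ⟨?_, rfl⟩
    have : d * u' = d * u := by omega
    exact Nat.eq_of_mul_eq_mul_left (by omega) this
  rw [Finset.sum_eq_single u]
  · rw [Polynomial.finset_sum_coeff, Finset.sum_eq_single v]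
    · rw [if_pos h, Polynomial.coeff_C_mul_X_pow, if_pos rfl]
    · intro v' _ hv'
      split_ifs with h'
      · rw [Polynomial.coeff_C_mul_X_pow, if_neg]
        intro e; exact hv' (key u v' h' e).2
      · simp
    · intro hv
      rw [if_pos h, Polynomial.coeff_C_mul_X_pow, if_pos rfl]
      simpa using hv
  · intro u' _ hu'
    rw [Polynomial.finset_sum_coeff]
    refine Finset.sum_eq_zero fun v' _ => ?_
    split_ifs with h'
    · rw [Polynomial.coeff_C_mul_X_pow, if_neg]
      intro e; exact hu' (key u' v' h' e).1
    · simp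
  · intro hu
    have : F.coeff u = 0 := by simpa using hu
    simp [this]

lemma sig_ne_zero {d p α β : ℕ} {c : k} (hd0 : 1 ≤ d) (hd : d * β = p * α + 1) {F : Pol k} {u v μ : ℕ}
    (h : d * u + p * v = μ) (hF : cf F u v ≠ 0) : (sig d p α β c F).coeff μ ≠ 0 := by
  rw [sig_coeff']
  intro h0
  have := congrArg (fun q : k[X] => q.comp (X - C c)) h0
  simp [Polynomial.comp_assoc] at this
  have h2 := wpart_coeff hd0 hd (F := F) h
  rw [this] at h2
  exact hF h2.symm

lemma sig_ord {d p α β : ℕ} {c : k} (hc : c ≠ 0) (hd0 : 1 ≤ d) (hd : d * β = p * α + 1) {F : Pol k}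
    {μ v0 H : ℕ} (hF : (sig d p α β c F).coeff μ ≠ 0)
    (hv : ∀ u v, cf F u v ≠ 0 → d * u + p * v = μ → v0 ≤ v ∧ v ≤ H) :
    ∃ v ≤ (H - v0) / d, cf (sig d p α β c F) μ v ≠ 0 := by
  unfold cf
  rw [sig_coeff'] at hF ⊢
  have hg : wpart d p α β F μ ≠ 0 := by intro h; simp [h] at hF
  have hne : (wpart d p α β F μ).support.Nonempty := by
    rwa [Polynomial.support_nonempty]
  obtain ⟨n₀, hn₀, hmin⟩ := Finset.exists_min_image _ id hne
  refine ord_bound hc _ hg n₀ _ fun n hn => ⟨hmin n hn, ?_⟩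
  obtain ⟨u, v, h1, h2, rfl⟩ := wpart_supp hn
  obtain ⟨u', v', h1', h2', e⟩ := wpart_supp hn₀
  have e1 := weight_n hd h2
  have e2 := weight_n hd h2'
  have b1 := hv u v h1 h2
  have b2 := hv u' v' h1' h2'
  have h5 := hmin _ hn
  simp only [id] at h5
  rw [← e] at e2
  obtain ⟨t, ht⟩ := Nat.exists_eq_add_of_le h5
  rw [ht] at e1 ⊢
  have : d * t ≤ H - v0 := by
    rw [mul_add] at e1; omega
  have := (Nat.le_div_iff_mul_le (by omega : 0 < d)).2 ((mul_comm t d).trans_le this)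
  omega

end

section
open Polynomial

/-- multiplication by `Y` -/
def mY (A : Pol k) : Pol k := C X * A

lemma cf_mY_zero (A : Pol k) (u : ℕ) : cf (mY A) u 0 = 0 := by simp [mY, cf]
lemma cf_mY_succ (A : Pol k) (u v : ℕ) : cf (mY A) u (v + 1) = cf A u v := by
  simp [mY, cf, Polynomial.coeff_X_mul]

def stepA (d p α β : ℕ) (c : k) (A B : Pol k) : Pol k :=
  (β : Pol k) * sig d p α β c (mY A) - (α : Pol k) * sig d p α β c B
def stepB (d p α β : ℕ) (c : k) (A B : Pol k) : Pol k :=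
  C (X + C c) * sig d p α β c ((d : Pol k) * B - (p : Pol k) * mY A)
def stepC (d p α β : ℕ) (c : k) (G : Pol k) : Pol k := sig d p α β c (mY G)

/-- height control -/
def HL (mb H : ℕ) (A B G : Pol k) : Prop :=
  ∃ m ≤ mb, (∀ u < m, A.coeff u = 0 ∧ B.coeff u = 0 ∧ G.coeff u = 0) ∧
    ((∃ v, v + 1 ≤ H ∧ (cf A m v ≠ 0 ∨ cf G m v ≠ 0)) ∨ ∃ v ≤ H, cf B m v ≠ 0)

lemma HL.mono {mb mb' H H' : ℕ} {A B G : Pol k} (h : HL mb H A B G) (hm : mb ≤ mb') (hH : H ≤ H') :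
    HL mb' H' A B G := by
  obtain ⟨m, h1, h2, h3⟩ := h
  refine ⟨m, h1.trans hm, h2, ?_⟩
  rcases h3 with ⟨v, h, h'⟩ | ⟨v, h, h'⟩
  · exact Or.inl ⟨v, h.trans hH, h'⟩
  · exact Or.inr ⟨v, h.trans hH, h'⟩

lemma step_core [CharZero k] {d p α β : ℕ} {c : k} (hc : c ≠ 0) (hd0 : 1 ≤ d) (hd : d * β = p * α + 1)
    {A B G : Pol k} {μ H : ℕ}
    (h1 : ∀ u v, cf A u v ≠ 0 ∨ cf G u v ≠ 0 → μ ≤ d * u + p * (v + 1) ∧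
      (d * u + p * (v + 1) = μ → v + 1 ≤ H))
    (h2 : ∀ u v, cf B u v ≠ 0 → μ ≤ d * u + p * v ∧ (d * u + p * v = μ → v ≤ H))
    (hex : ∃ u v, ((cf A u v ≠ 0 ∨ cf G u v ≠ 0) ∧ d * u + p * (v + 1) = μ) ∨
      (cf B u v ≠ 0 ∧ d * u + p * v = μ)) :
    HL μ (max (H / d) ((H - 1) / d + 1)) (stepA d p α β c A B) (stepB d p α β c A B)
      (stepC d p α β c G) := by
  have hA : ∀ u v, cf (mY A) u v ≠ 0 → μ ≤ d * u + p * v ∧ (d * u + p * v = μ → 1 ≤ v ∧ v ≤ H) := by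
    intro u v h
    cases v with
    | zero => exact absurd (cf_mY_zero A u) h
    | succ v =>
      rw [cf_mY_succ] at h
      exact ⟨(h1 u v (Or.inl h)).1, fun e => ⟨by omega, (h1 u v (Or.inl h)).2 e⟩⟩
  have hG : ∀ u v, cf (mY G) u v ≠ 0 → μ ≤ d * u + p * v ∧ (d * u + p * v = μ → 1 ≤ v ∧ v ≤ H) := by
    intro u v h
    cases v with
    | zero => exact absurd (cf_mY_zero G u) h
    | succ v =>
      rw [cf_mY_succ] at h
      exact ⟨(h1 u v (Or.inr h)).1, fun e => ⟨by omega, (h1 u v (Or.inr h)).2 e⟩⟩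
  set P : Pol k := (d : Pol k) * B - (p : Pol k) * mY A with hP
  have cfP : ∀ u v, cf P u v = d * cf B u v - p * cf (mY A) u v := by
    intro u v
    simp [hP, cf, Polynomial.coeff_natCast_mul]
  have hPw : ∀ u v, cf P u v ≠ 0 → μ ≤ d * u + p * v ∧ (d * u + p * v = μ → v ≤ H) := by
    intro u v h
    by_cases hb : cf B u v = 0
    · have : cf (mY A) u v ≠ 0 := by
        intro h0; rw [cfP, hb, h0] at h; simp at h
      exact ⟨(hA u v this).1, fun e => ((hA u v this).2 e).2⟩
    · exact h2 u v hb
  have zA : ∀ j < μ, (sig d p α β c (mY A)).coeff j = 0 := fun j hj =>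
    sig_coeff_zero fun u v h e => by have := (hA u v h).1; omega
  have zG : ∀ j < μ, (sig d p α β c (mY G)).coeff j = 0 := fun j hj =>
    sig_coeff_zero fun u v h e => by have := (hG u v h).1; omega
  have zB : ∀ j < μ, (sig d p α β c B).coeff j = 0 := fun j hj =>
    sig_coeff_zero fun u v h e => by have := (h2 u v h).1; omega
  have zP : ∀ j < μ, (sig d p α β c P).coeff j = 0 := fun j hj =>
    sig_coeff_zero fun u v h e => by have := (hPw u v h).1; omega
  refine ⟨μ, le_rfl, ?_, ?_⟩
  · intro u hu
    refine ⟨?_, ?_, zG u hu⟩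
    · simp [stepA, Polynomial.coeff_natCast_mul, zA u hu, zB u hu]
    · unfold stepB
      rw [Polynomial.coeff_C_mul, ← hP, zP u hu, mul_zero]
  by_cases q3 : (sig d p α β c (mY G)).coeff μ = 0
  swap
  · obtain ⟨v, hv, hv'⟩ := sig_ord hc hd0 hd q3 (fun u v h => (hG u v h).2)
    exact Or.inl ⟨v, le_max_of_le_right (by omega), Or.inr hv'⟩
  by_cases qP : (sig d p α β c P).coeff μ = 0
  swap
  · have hex2 := sig_ord hc hd0 hd qP (v0 := 0) (H := H) (fun u v h e => ⟨Nat.zero_le _, (hPw u v h).2 e⟩)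
    right
    obtain ⟨v, hv, hv'⟩ := hex2
    have hf : ∃ v, cf (sig d p α β c P) μ v ≠ 0 := ⟨v, hv'⟩
    refine ⟨Nat.find hf, le_max_of_le_left ((Nat.find_min' hf hv').trans (by simpa using hv)), ?_⟩
    have e : cf (stepB d p α β c A B) μ (Nat.find hf) = c * cf (sig d p α β c P) μ (Nat.find hf) := by
      unfold stepB cf
      rw [← hP, Polynomial.coeff_C_mul, add_mul, Polynomial.coeff_add, Polynomial.coeff_C_mul]
      have : (X * (sig d p α β c P).coeff μ).coeff (Nat.find hf) = 0 := by
        rcases hn : Nat.find hf with _ | n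
        · simp
        · rw [Polynomial.coeff_X_mul]
          by_contra h
          have := Nat.find_min' hf h
          omega
      rw [this, zero_add]
    rw [e]
    exact mul_ne_zero hc (Nat.find_spec hf)
  -- remaining case
  have ePσ : (d : k[X]) * (sig d p α β c B).coeff μ = (p : k[X]) * (sig d p α β c (mY A)).coeff μ := by
    rw [hP, map_sub, map_mul, map_mul, map_natCast, map_natCast, Polynomial.coeff_sub,
      Polynomial.coeff_natCast_mul, Polynomial.coeff_natCast_mul] at qP
    exact sub_eq_zero.1 qP
  have hdk : (d : k[X]) ≠ 0 := by exact_mod_cast (by omega : d ≠ 0)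
  have qA : (sig d p α β c (mY A)).coeff μ ≠ 0 := by
    intro h0
    rw [h0, mul_zero] at ePσ
    have hB0 := (mul_eq_zero.1 ePσ).resolve_left hdk
    obtain ⟨u, v, ⟨h, e⟩ | ⟨h, e⟩⟩ := hex
    · rcases h with h | h
      · exact sig_ne_zero hd0 hd (F := mY A) (v := v + 1) e (by rwa [cf_mY_succ]) h0
      · exact sig_ne_zero hd0 hd (F := mY G) (v := v + 1) e (by rwa [cf_mY_succ]) q3
    · exact sig_ne_zero hd0 hd e h hB0
  obtain ⟨v, hv, hv'⟩ := sig_ord hc hd0 hd qA (fun u v h => (hA u v h).2)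
  refine Or.inl ⟨v, le_max_of_le_right (by omega), Or.inl ?_⟩
  intro h0
  apply hv'
  have e2 : (d : k[X]) * (stepA d p α β c A B).coeff μ = (sig d p α β c (mY A)).coeff μ := by
    unfold stepA
    rw [Polynomial.coeff_sub, Polynomial.coeff_natCast_mul, Polynomial.coeff_natCast_mul]
    have : (d : k[X]) * β = p * α + 1 := by exact_mod_cast hd
    linear_combination (sig d p α β c (mY A)).coeff μ * this - (α : k[X]) * ePσ
  unfold cf at h0 ⊢
  rw [← e2, Polynomial.coeff_natCast_mul, h0, mul_zero]

lemma step_HL [CharZero k] {d p α β : ℕ} {c : k} (hc : c ≠ 0) (hd0 : 1 ≤ d) (hp : 1 ≤ p)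
    (hd : d * β = p * α + 1)
    {A B G : Pol k} {mb H : ℕ} (h : HL mb H A B G) :
    HL (d * mb + p * H) (max (H / d) ((H - 1) / d + 1)) (stepA d p α β c A B) (stepB d p α β c A B)
      (stepC d p α β c G) := by
  obtain ⟨m, hm, hz, hpt⟩ := h
  -- weights
  let W : ℕ → Prop := fun w => ∃ u v, ((cf A u v ≠ 0 ∨ cf G u v ≠ 0) ∧ d * u + p * (v + 1) = w) ∨
      (cf B u v ≠ 0 ∧ d * u + p * v = w)
  have hmle : ∀ u v, (cf A u v ≠ 0 ∨ cf G u v ≠ 0) ∨ cf B u v ≠ 0 → m ≤ u := by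
    intro u v h
    by_contra hlt
    obtain ⟨z1, z2, z3⟩ := hz u (by omega)
    simp [cf, z1, z2, z3] at h
  obtain ⟨w0, hw0, hw0'⟩ : ∃ w0, W w0 ∧ w0 ≤ d * m + p * H := by
    rcases hpt with ⟨v, h, h'⟩ | ⟨v, h, h'⟩
    · exact ⟨_, ⟨m, v, Or.inl ⟨h', rfl⟩⟩, by gcongr⟩
    · exact ⟨_, ⟨m, v, Or.inr ⟨h', rfl⟩⟩, by gcongr⟩
  have hW : ∃ w, W w := ⟨w0, hw0⟩
  have hμ : Nat.find hW ≤ d * m + p * H := (Nat.find_min' hW hw0).trans hw0'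
  have key : ∀ u v, m ≤ u → d * u + p * v = Nat.find hW → v ≤ H := by
    intro u v hu e
    have h1 : d * m ≤ d * u := by gcongr
    have : p * v ≤ p * H := by omega
    exact Nat.le_of_mul_le_mul_left this (by omega)
  refine (step_core hc hd0 hd (μ := Nat.find hW) (H := H) ?_ ?_ (Nat.find_spec hW)).mono ?_ le_rfl
  · intro u v h
    exact ⟨Nat.find_min' hW ⟨u, v, Or.inl ⟨h, rfl⟩⟩, fun e => key u (v + 1) (hmle u v (Or.inl h)) e⟩
  · intro u v h
    exact ⟨Nat.find_min' hW ⟨u, v, Or.inr ⟨h, rfl⟩⟩, fun e => key u v (hmle u v (Or.inr h)) e⟩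
  · refine hμ.trans ?_
    gcongr

lemma step_first [CharZero k] {d p α β : ℕ} {c : k} (hc : c ≠ 0) (hd0 : 1 ≤ d) (hp : 1 ≤ p)
    (hd : d * β = p * α + 1)
    {A B G : Pol k} {D : ℕ} (h : Low D A ∨ Low D B ∨ Low D G) :
    HL ((d + p) * D) ((d + p) * D + 1) (stepA d p α β c A B) (stepB d p α β c A B)
      (stepC d p α β c G) := by
  let W : ℕ → Prop := fun w => ∃ u v, ((cf A u v ≠ 0 ∨ cf G u v ≠ 0) ∧ d * u + p * (v + 1) = w) ∨
      (cf B u v ≠ 0 ∧ d * u + p * v = w)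
  have hb : ∀ u v, u + v < D → d * u + p * (v + 1) ≤ (d + p) * D := by
    intro u v h
    have h1 : d * u ≤ d * D := by gcongr; omega
    have h2 : p * (v + 1) ≤ p * D := by gcongr; omega
    rw [add_mul]; omega
  obtain ⟨w0, hw0, hw0'⟩ : ∃ w0, W w0 ∧ w0 ≤ (d + p) * D := by
    rcases h with ⟨u, v, h, h'⟩ | ⟨u, v, h, h'⟩ | ⟨u, v, h, h'⟩
    · exact ⟨_, ⟨u, v, Or.inl ⟨Or.inl h', rfl⟩⟩, hb u v h⟩
    · refine ⟨_, ⟨u, v, Or.inr ⟨h', rfl⟩⟩, le_trans ?_ (hb u v h)⟩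
      gcongr; omega
    · exact ⟨_, ⟨u, v, Or.inl ⟨Or.inr h', rfl⟩⟩, hb u v h⟩
  have hW : ∃ w, W w := ⟨w0, hw0⟩
  have hμ : Nat.find hW ≤ (d + p) * D := (Nat.find_min' hW hw0).trans hw0'
  have key : ∀ u v, d * u + p * v = Nat.find hW → v ≤ (d + p) * D := by
    intro u v e
    have : v ≤ p * v := Nat.le_mul_of_pos_left v (by omega)
    omega
  refine (step_core hc hd0 hd (μ := Nat.find hW) (H := (d + p) * D) ?_ ?_ (Nat.find_spec hW)).mono hμ ?_
  · intro u v h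
    exact ⟨Nat.find_min' hW ⟨u, v, Or.inl ⟨h, rfl⟩⟩, fun e => key u (v + 1) e⟩
  · intro u v h
    exact ⟨Nat.find_min' hW ⟨u, v, Or.inr ⟨h, rfl⟩⟩, fun e => key u v e⟩
  · have h1 := Nat.div_le_self ((d + p) * D) d
    have h2 := Nat.div_le_self ((d + p) * D - 1) d
    omega

lemma height_le {H d : ℕ} (hH : 1 ≤ H) : max (H / d) ((H - 1) / d + 1) ≤ H := by
  have h1 := Nat.div_le_self H d
  have h2 := Nat.div_le_self (H - 1) d
  omega

lemma height_lt {H d : ℕ} (hd : 2 ≤ d) : max ((H + 2) / d) ((H + 2 - 1) / d + 1) ≤ H + 1 := by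
  have h1 : (H + 2) / d ≤ (H + 2) / 2 := Nat.div_le_div_left hd (by norm_num)
  have h2 : (H + 2 - 1) / d ≤ (H + 2 - 1) / 2 := Nat.div_le_div_left hd (by norm_num)
  omega

end

/-- the equations of a Puiseux package -/
structure IsPkg (x y x₁ y₁ : K) (d p α β : ℕ) (c : k) : Prop where
  hd : 1 ≤ d
  hp : 1 ≤ p
  bez : d * β = p * α + 1
  hc : c ≠ 0
  ex : x = x₁ ^ d * (y₁ + algebraMap k K c) ^ α
  ey : y = x₁ ^ p * (y₁ + algebraMap k K c) ^ β
  unram : d = 1 → α = 0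

lemma exists_pkg_aux {ν : KValuation k K ℝ} (hres : ν.ResidueFieldIsK) (n : ℕ) :
    ∀ (O : Subring K) (x y z : K), Chart ν O x y z → ∀ (d p : ℕ) (g : ℝ), d + p ≤ n → 1 ≤ d → 1 ≤ p →
      Nat.Coprime d p → ν.v x = d * g → ν.v y = p * g →
      ∃ (O' : Subring K) (x₁ y₁ : K) (α β : ℕ) (c : k), Reach ν O O' ∧ Chart ν O' x₁ y₁ z ∧
        IsPkg x y x₁ y₁ d p α β c := by
  induction n with
  | zero => intros; omega
  | succ n ih =>
    intro O x y z h d p g hn hd hp hcop ex ey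
    have hg : 0 < g := by
      have := h.vx
      rw [ex] at this
      exact pos_of_mul_pos_right this (by positivity)
    have hx0 := h.x0
    have hy0 := h.y0
    rcases lt_trichotomy d p with hlt | heq | hgt
    · obtain ⟨O₁, r₁, h₁⟩ := h.e1 (by rw [ex, ey]; gcongr)
      obtain ⟨t, rfl⟩ := Nat.exists_eq_add_of_lt hlt
      obtain ⟨O₂, x₁, y₁, α, β, c, r₂, h₂, pk⟩ := ih O₁ x (y / x) z h₁ d (t + 1) g (by omega) hd (by omega)
        (by rwa [add_assoc, Nat.coprime_self_add_right] at hcop) ex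
        (by rw [v_div ν _ _ h.y0 h.x0, ex, ey]; push_cast; ring)
      refine ⟨O₂, x₁, y₁, α, α + β, c, r₁.trans r₂, h₂, hd, hp, ?_, pk.hc, pk.ex, ?_, pk.unram⟩
      · linear_combination pk.bez
      · have e2 := pk.ey
        have : y = x * (y / x) := by field_simp
        rw [this, e2]
        nth_rewrite 1 [pk.ex]
        ring
    · subst heq
      have hd1 : d = 1 := by simpa using hcop
      subst hd1
      obtain ⟨O₁, r₁, c, hc, h₁⟩ := h.e3 hres (by rw [ex, ey])
      refine ⟨O₁, x, _, 0, 1, c, r₁, h₁, le_rfl, le_rfl, by norm_num, hc, by simp, ?_, fun _ => rfl⟩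
      rw [sub_add_cancel, pow_one, pow_one]; field_simp
    · obtain ⟨O₁, r₁, h₁⟩ := h.e2 (by rw [ex, ey]; gcongr)
      obtain ⟨t, rfl⟩ := Nat.exists_eq_add_of_lt hgt
      obtain ⟨O₂, x₁, y₁, α, β, c, r₂, h₂, pk⟩ := ih O₁ (x / y) y z h₁ (t + 1) p g (by omega) (by omega) hp
        (by rwa [add_assoc, Nat.coprime_self_add_left] at hcop)
        (by rw [v_div ν _ _ h.x0 h.y0, ex, ey]; push_cast; ring) ey
      refine ⟨O₂, x₁, y₁, α + β, β, c, r₁.trans r₂, h₂, hd, hp, ?_, pk.hc, ?_, pk.ey, ?_⟩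
      · linear_combination pk.bez
      · have e2 := pk.ex
        have : x = (x / y) * y := by field_simp
        rw [this, e2]
        nth_rewrite 1 [pk.ey]
        ring
      · intro h1; omega

lemma exists_pkg {ν : KValuation k K ℝ} (hres : ν.ResidueFieldIsK) (hrk : ν.HasRationalRank 1)
    {O : Subring K} {x y z : K} (h : Chart ν O x y z) :
    ∃ (O' : Subring K) (x₁ y₁ : K) (d p α β : ℕ) (c : k), Reach ν O O' ∧ Chart ν O' x₁ y₁ z ∧
        IsPkg x y x₁ y₁ d p α β c := by
  obtain ⟨d, p, hd, hp, e⟩ : ∃ d p : ℕ, 1 ≤ d ∧ 1 ≤ p ∧ (p : ℝ) * ν.v x = d * ν.v y := by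
    have h2 := hrk.2
    push Not at h2
    have h3 := h2 ![x, y] (by intro i; fin_cases i; exacts [h.x0, h.y0])
    rw [Fintype.not_linearIndependent_iff] at h3
    obtain ⟨g, hg, i, hi⟩ := h3
    rw [Fin.sum_univ_two] at hg
    simp only [Matrix.cons_val_zero, Matrix.cons_val_one, zsmul_eq_mul] at hg
    have vx := h.vx
    have vy := h.vy
    have key : ∀ m n : ℤ, (m : ℝ) * ν.v x = n * ν.v y → 0 < m → 0 < n := by
      intro m n e hm
      have hm' : (0 : ℝ) < m := by exact_mod_cast hm
      have : 0 < (n : ℝ) * ν.v y := by rw [← e]; positivity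
      have := pos_of_mul_pos_left this vy.le
      exact_mod_cast this
    have h0 : g 0 ≠ 0 := by
      intro h0
      rw [h0] at hg
      simp at hg
      rcases hg with h1 | h1
      · fin_cases i
        · exact hi h0
        · exact hi h1
      · exact vy.ne' h1
    rcases lt_or_gt_of_ne h0 with hlt | hgt
    · have h5 := key (-g 0) (g 1) (by push_cast; linarith) (by omega)
      refine ⟨(g 1).toNat, (-g 0).toNat, by omega, by omega, ?_⟩
      have e1 : (((g 1).toNat : ℤ) : ℝ) = g 1 := by exact_mod_cast Int.toNat_of_nonneg h5.le
      have e2 : (((-g 0).toNat : ℤ) : ℝ) = ((-g 0 : ℤ) : ℝ) := by exact_mod_cast Int.toNat_of_nonneg (by omega : 0 ≤ -g 0)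
      rw [Int.cast_natCast] at e1 e2
      rw [e1, e2]; push_cast; linarith
    · have h5 := key (g 0) (-g 1) (by push_cast; linarith) (by omega)
      refine ⟨(-g 1).toNat, (g 0).toNat, by omega, by omega, ?_⟩
      have e1 : (((-g 1).toNat : ℤ) : ℝ) = ((-g 1 : ℤ) : ℝ) := by exact_mod_cast Int.toNat_of_nonneg h5.le
      have e2 : (((g 0).toNat : ℤ) : ℝ) = ((g 0 : ℤ) : ℝ) := by exact_mod_cast Int.toNat_of_nonneg hgt.le
      rw [Int.cast_natCast] at e1 e2
      rw [e1, e2]; push_cast; linarith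
  obtain ⟨G, d', p', hG, hcop, rfl, rfl⟩ := Nat.exists_coprime' (Nat.gcd_pos_of_pos_left p hd : 0 < Nat.gcd d p)
  have hd' : 1 ≤ d' := Nat.pos_of_ne_zero (by rintro rfl; simp at hd)
  have hp' : 1 ≤ p' := Nat.pos_of_ne_zero (by rintro rfl; simp at hp)
  have hdr : (0 : ℝ) < d' := by exact_mod_cast hd'
  have hGr : (0 : ℝ) < G := by exact_mod_cast hG
  push_cast at e
  have e' : (p' : ℝ) * ν.v x = d' * ν.v y := by
    apply mul_left_cancel₀ hGr.ne'
    linear_combination e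
  obtain ⟨O', x₁, y₁, α, β, c, h1, h2, h3⟩ := exists_pkg_aux hres _ O x y z h d' p' (ν.v x / d') le_rfl hd' hp' hcop
    (by field_simp) (by field_simp; linear_combination -e')
  exact ⟨O', x₁, y₁, d', p', α, β, c, h1, h2, h3⟩

/-- an infinite tower of Puiseux packages -/
structure Tower (ν : KValuation k K ℝ) (z : K) where
  O : ℕ → Subring K
  x : ℕ → K
  y : ℕ → K
  d : ℕ → ℕ
  p : ℕ → ℕ
  α : ℕ → ℕ
  β : ℕ → ℕ
  c : ℕ → k
  chart : ∀ t, Chart ν (O t) (x t) (y t) z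
  reach : ∀ t, Reach ν (O t) (O (t + 1))
  pkg : ∀ t, IsPkg (x t) (y t) (x (t + 1)) (y (t + 1)) (d t) (p t) (α t) (β t) (c t)

lemma exists_tower {ν : KValuation k K ℝ} (hres : ν.ResidueFieldIsK) (hrk : ν.HasRationalRank 1)
    {O : Subring K} {x y z : K} (h : Chart ν O x y z) :
    ∃ T : Tower ν z, T.O 0 = O ∧ T.x 0 = x ∧ T.y 0 = y := by
  let S := {q : Subring K × K × K // Chart ν q.1 q.2.1 q.2.2 z}
  have hstep : ∀ q : S, ∃ (q' : S) (d p α β : ℕ) (c : k), Reach ν q.1.1 q'.1.1 ∧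
      IsPkg q.1.2.1 q.1.2.2 q'.1.2.1 q'.1.2.2 d p α β c := by
    intro q
    obtain ⟨O', x₁, y₁, d, p, α, β, c, h1, h2, h3⟩ := exists_pkg hres hrk q.2
    exact ⟨⟨(O', x₁, y₁), h2⟩, d, p, α, β, c, h1, h3⟩
  choose nx d p α β c hr hp using hstep
  let s : ℕ → S := fun n => Nat.rec ⟨(O, x, y), h⟩ (fun _ q => nx q) n
  exact ⟨⟨fun t => (s t).1.1, fun t => (s t).1.2.1, fun t => (s t).1.2.2, fun t => d (s t), fun t => p (s t),
    fun t => α (s t), fun t => β (s t), fun t => c (s t), fun t => (s t).2, fun t => hr (s t),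
    fun t => hp (s t)⟩, rfl, rfl, rfl⟩

namespace Tower
variable {ν : KValuation k K ℝ} {z : K} (T : Tower ν z)

lemma reach_le {s t : ℕ} (h : s ≤ t) : Reach ν (T.O s) (T.O t) := by
  induction h with
  | refl => exact Reach.refl _ _
  | step h ih => exact ih.trans (T.reach _)

/-- the unit `w` -/
def w (t : ℕ) : K := T.y (t + 1) + algebraMap k K (T.c t)

lemma w_mem (t : ℕ) : T.w t ∈ T.O (t + 1) :=
  (T.O (t + 1)).add_mem (T.chart (t + 1)).hy ((T.chart (t + 1)).algk _)

lemma w_ne (t : ℕ) : T.w t ≠ 0 := by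
  have := (v_unit_add (T.pkg t).hc (T.chart (t + 1)).my).1
  rwa [add_comm] at this

lemma dvd_succ (t : ℕ) : (∃ a ∈ T.O (t + 1), T.x t = T.x (t + 1) * a) ∧
    (∃ a ∈ T.O (t + 1), T.y t = T.x (t + 1) * a) := by
  have hd := (T.pkg t).hd
  have hp := (T.pkg t).hp
  have hx := (T.chart (t + 1)).hx
  have hw := T.w_mem t
  obtain ⟨d', hd'⟩ := Nat.exists_eq_add_of_le' hd
  obtain ⟨p', hp'⟩ := Nat.exists_eq_add_of_le' hp
  refine ⟨⟨T.x (t + 1) ^ d' * T.w t ^ T.α t, (T.O (t + 1)).mul_mem ((T.O (t + 1)).pow_mem hx _) ((T.O (t + 1)).pow_mem hw _), ?_⟩,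
    ⟨T.x (t + 1) ^ p' * T.w t ^ T.β t, (T.O (t + 1)).mul_mem ((T.O (t + 1)).pow_mem hx _) ((T.O (t + 1)).pow_mem hw _), ?_⟩⟩
  · rw [(T.pkg t).ex, hd', w]; ring
  · rw [(T.pkg t).ey, hp', w]; ring

lemma dvd (s : ℕ) : (∃ a ∈ T.O (s + 1), T.x 0 = T.x (s + 1) * a) ∧
    (∃ a ∈ T.O (s + 1), T.y 0 = T.x (s + 1) * a) := by
  induction s with
  | zero => exact T.dvd_succ 0
  | succ s ih =>
    obtain ⟨⟨a, ha, ea⟩, ⟨b, hb, eb⟩⟩ := ih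
    obtain ⟨e, he, ee⟩ := (T.dvd_succ (s + 1)).1
    have hle := (T.reach (s + 1)).2
    exact ⟨⟨e * a, (T.O _).mul_mem he (hle ha), by rw [ea, ee]; ring⟩,
      ⟨e * b, (T.O _).mul_mem he (hle hb), by rw [eb, ee]; ring⟩⟩

/-- evolution of triples of polynomials -/
def tri (A B G : Pol k) : ℕ → Pol k × Pol k × Pol k
  | 0 => (A, B, G)
  | t + 1 => (stepA (T.d t) (T.p t) (T.α t) (T.β t) (T.c t) (tri A B G t).1 (tri A B G t).2.1,
      stepB (T.d t) (T.p t) (T.α t) (T.β t) (T.c t) (tri A B G t).1 (tri A B G t).2.1,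
      stepC (T.d t) (T.p t) (T.α t) (T.β t) (T.c t) (tri A B G t).2.2)

lemma tri_zero (G : Pol k) (t : ℕ) : (T.tri 0 0 G t).1 = 0 ∧ (T.tri 0 0 G t).2.1 = 0 := by
  induction t with
  | zero => exact ⟨rfl, rfl⟩
  | succ t ih => simp [tri, stepA, stepB, ih.1, ih.2, mY]

/-- uniform height control after `s` stages -/
def HS (D s mb H : ℕ) : Prop := ∀ A B G : Pol k, Low D A ∨ Low D B ∨ Low D G →
  HL mb H (T.tri A B G s).1 (T.tri A B G s).2.1 (T.tri A B G s).2.2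

lemma HS_step [CharZero k] {D s mb H : ℕ} (h : T.HS D s mb H) :
    T.HS D (s + 1) (T.d s * mb + T.p s * H) (max (H / T.d s) ((H - 1) / T.d s + 1)) :=
  fun A B G hl => step_HL (T.pkg s).hc (T.pkg s).hd (T.pkg s).hp (T.pkg s).bez (h A B G hl)

lemma HS_le [CharZero k] {D s H t : ℕ} (hH : 1 ≤ H) (h : ∃ mb, T.HS D s mb H) (hst : s ≤ t) :
    ∃ mb, T.HS D t mb H := by
  induction hst with
  | refl => exact h
  | step _ ih =>
    obtain ⟨mb, ih⟩ := ih
    exact ⟨_, fun A B G hl => (T.HS_step ih A B G hl).mono le_rfl (height_le hH)⟩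

lemma HS_one [CharZero k] (hnf : ∀ t, ∃ t' ≥ t, 2 ≤ T.d t') (D : ℕ) : ∃ s mb, T.HS D (s + 1) mb 1 := by
  have base : ∃ mb H, T.HS D 1 mb (H + 1) := ⟨_, _, fun A B G hl =>
    step_first (T.pkg 0).hc (T.pkg 0).hd (T.pkg 0).hp (T.pkg 0).bez hl⟩
  obtain ⟨mb, H, h⟩ := base
  have main : ∀ H s, (∃ mb, T.HS D (s + 1) mb (H + 1)) → ∃ s mb, T.HS D (s + 1) mb 1 := by
    intro H
    induction H with
    | zero => rintro s ⟨mb, h⟩; exact ⟨s, mb, h⟩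
    | succ H ih =>
      intro s h
      obtain ⟨t, ht, hd⟩ := hnf (s + 1)
      obtain ⟨mb, h'⟩ := T.HS_le (by omega) h ht
      exact ih t ⟨_, fun A B G hl => (T.HS_step h' A B G hl).mono le_rfl (height_lt hd)⟩
  exact main H 0 ⟨mb, h⟩

/-- the accumulated factor -/
def lam (t : ℕ) : K := ∏ j ∈ Finset.range t, T.y j

lemma lam_ne (t : ℕ) : T.lam t ≠ 0 := Finset.prod_ne_zero_iff.2 fun j _ => (T.chart j).y0

lemma lam_mem (t : ℕ) : T.lam t ∈ T.O t :=
  (T.O t).prod_mem fun j hj => (T.reach_le (Finset.mem_range.1 hj).le).2 (T.chart j).hy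

/-- error sets -/
def J (M t : ℕ) : Set K := {g | ∃ s ∈ T.O t, ∃ e ∈ pw (T.O t) (T.x 0) (T.y 0) M, g = z * s + e}

end Tower

lemma pw_mono {O O' : Subring K} (h : O ≤ O') {x y : K} (M : ℕ) : pw O x y M ⊆ pw O' x y M := by
  induction M with
  | zero => exact h
  | succ M ih =>
    rintro _ ⟨a, ha, b, hb, rfl⟩
    exact ⟨a, ih ha, b, ih hb, rfl⟩

/-- logarithmic derivative -/
def ld (ξ : Derivation k K K) (u : K) : K := ξ u / u

lemma ld_mul (ξ : Derivation k K K) {a b : K} (ha : a ≠ 0) (hb : b ≠ 0) :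
    ld ξ (a * b) = ld ξ a + ld ξ b := by
  unfold ld; rw [Derivation.leibniz, smul_eq_mul, smul_eq_mul]; field_simp; ring

lemma ld_pow (ξ : Derivation k K K) {a : K} (ha : a ≠ 0) (n : ℕ) : ld ξ (a ^ n) = n * ld ξ a := by
  induction n with
  | zero => simp [ld]
  | succ n ih => rw [pow_succ, ld_mul ξ (pow_ne_zero _ ha) ha, ih]; push_cast; ring

lemma ld_div (ξ : Derivation k K K) {a b : K} (ha : a ≠ 0) (hb : b ≠ 0) :
    ld ξ (a / b) = ld ξ a - ld ξ b := by
  have := ld_mul ξ (div_ne_zero ha hb) hb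
  rw [div_mul_cancel₀ _ hb] at this
  rw [this]; ring

lemma ld_mul_self (ξ : Derivation k K K) {a : K} (ha : a ≠ 0) : ld ξ a * a = ξ a := by
  unfold ld; field_simp

/-- error sets -/
def Er (O : Subring K) (x y z : K) (M : ℕ) : Set K := {g | ∃ s ∈ O, ∃ e ∈ pw O x y M, g = z * s + e}

section
variable {O O' : Subring K} {x y z : K} {M : ℕ}

lemma Er.add {a b : K} (ha : a ∈ Er O x y z M) (hb : b ∈ Er O x y z M) : a + b ∈ Er O x y z M := by
  obtain ⟨s, hs, e, he, rfl⟩ := ha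
  obtain ⟨s', hs', e', he', rfl⟩ := hb
  exact ⟨s + s', O.add_mem hs hs', e + e', pw_add he he', by ring⟩

lemma Er.mul {a b : K} (ha : a ∈ O) (hb : b ∈ Er O x y z M) : a * b ∈ Er O x y z M := by
  obtain ⟨s', hs', e', he', rfl⟩ := hb
  exact ⟨a * s', O.mul_mem ha hs', a * e', pw_mul ha he', by ring⟩

lemma Er.neg {b : K} (hb : b ∈ Er O x y z M) : -b ∈ Er O x y z M := by
  have := Er.mul (O.neg_mem O.one_mem) hb
  simpa using this

lemma Er.sub {a b : K} (ha : a ∈ Er O x y z M) (hb : b ∈ Er O x y z M) : a - b ∈ Er O x y z M := by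
  rw [sub_eq_add_neg]; exact Er.add ha (Er.neg hb)

lemma Er.zero : (0 : K) ∈ Er O x y z M := ⟨0, O.zero_mem, 0, pw_zero_mem M, by ring⟩

lemma Er.mono (h : O ≤ O') {a : K} (ha : a ∈ Er O x y z M) : a ∈ Er O' x y z M := by
  obtain ⟨s, hs, e, he, rfl⟩ := ha
  exact ⟨s, h hs, e, pw_mono h M he, rfl⟩
end

namespace Tower
variable {ν : KValuation k K ℝ} {z : K} (T : Tower ν z)

lemma ld_step (ξ : Derivation k K K) (t : ℕ) :
    T.y t * ld ξ (T.x (t + 1)) = T.β t * (T.y t * ld ξ (T.x t)) - T.α t * ξ (T.y t) ∧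
    T.y t * ξ (T.y (t + 1)) = T.w t * (T.d t * ξ (T.y t) - T.p t * (T.y t * ld ξ (T.x t))) := by
  have pk := T.pkg t
  have hx := (T.chart (t + 1)).x0
  have hw : T.w t ≠ 0 := T.w_ne t
  have e1 : ld ξ (T.x t) = T.d t * ld ξ (T.x (t + 1)) + T.α t * ld ξ (T.w t) := by
    rw [pk.ex, ← w, ld_mul ξ (pow_ne_zero _ hx) (pow_ne_zero _ hw), ld_pow ξ hx, ld_pow ξ hw]
  have e2 : ld ξ (T.y t) = T.p t * ld ξ (T.x (t + 1)) + T.β t * ld ξ (T.w t) := by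
    rw [pk.ey, ← w, ld_mul ξ (pow_ne_zero _ hx) (pow_ne_zero _ hw), ld_pow ξ hx, ld_pow ξ hw]
  have e3 : ξ (T.y t) = T.y t * ld ξ (T.y t) := by rw [mul_comm, ld_mul_self ξ (T.chart t).y0]
  have e4 : ξ (T.y (t + 1)) = T.w t * ld ξ (T.w t) := by
    rw [mul_comm, ld_mul_self ξ hw, w]; simp
  have bez : (T.d t : K) * T.β t = T.p t * T.α t + 1 := by exact_mod_cast congrArg (Nat.cast : ℕ → K) pk.bez
  rw [e3, e4, e1, e2]
  constructor
  · linear_combination (-T.y t * ld ξ (T.x (t+1))) * bez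
  · linear_combination (-T.w t * T.y t * ld ξ (T.w t)) * bez

lemma lam_succ (t : ℕ) : T.lam (t + 1) = T.lam t * T.y t := Finset.prod_range_succ _ _

lemma eval_tri (ξ : Derivation k K K) (r f : K) (A B G : Pol k) (M : ℕ)
    (hA : ld ξ (T.x 0) - ev k (T.x 0) (T.y 0) A ∈ Er (T.O 0) (T.x 0) (T.y 0) f M)
    (hB : ξ (T.y 0) - ev k (T.x 0) (T.y 0) B ∈ Er (T.O 0) (T.x 0) (T.y 0) f M)
    (hG : r - ev k (T.x 0) (T.y 0) G ∈ Er (T.O 0) (T.x 0) (T.y 0) f M) (t : ℕ) :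
    T.lam t * ld ξ (T.x t) - ev k (T.x t) (T.y t) (T.tri A B G t).1 ∈ Er (T.O t) (T.x 0) (T.y 0) f M ∧
    T.lam t * ξ (T.y t) - ev k (T.x t) (T.y t) (T.tri A B G t).2.1 ∈ Er (T.O t) (T.x 0) (T.y 0) f M ∧
    T.lam t * r - ev k (T.x t) (T.y t) (T.tri A B G t).2.2 ∈ Er (T.O t) (T.x 0) (T.y 0) f M := by
  induction t with
  | zero => simpa [lam, tri] using ⟨hA, hB, hG⟩
  | succ t ih =>
    obtain ⟨h1, h2, h3⟩ := ih
    have hle := (T.reach t).2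
    replace h1 := Er.mono hle h1
    replace h2 := Er.mono hle h2
    replace h3 := Er.mono hle h3
    have hy : T.y t ∈ T.O (t + 1) := hle (T.chart t).hy
    have pk := T.pkg t
    have hs := fun F => ev_sig (T.d t) (T.p t) (T.α t) (T.β t) (T.c t) pk.ex pk.ey F
    obtain ⟨s1, s2⟩ := T.ld_step ξ t
    have hn : ∀ n : ℕ, (n : K) ∈ T.O (t + 1) := fun n => natCast_mem _ n
    simp only [tri, stepA, stepB, stepC]
    have eX : ev k (T.x (t + 1)) (T.y (t + 1)) (Polynomial.C (Polynomial.X + Polynomial.C (T.c t))) = T.w t := by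
      rw [Polynomial.C_add, map_add, ev_Y, ev_C, w]
    refine ⟨?_, ?_, ?_⟩
    · convert Er.sub (Er.mul (hn (T.β t)) (Er.mul hy h1)) (Er.mul (hn (T.α t)) h2) using 1
      rw [map_sub, map_mul, map_mul, map_natCast, map_natCast, hs, hs, mY, map_mul, ev_Y, lam_succ]
      linear_combination T.lam t * s1
    · convert Er.mul (T.w_mem t) (Er.sub (Er.mul (hn (T.d t)) h2) (Er.mul (hn (T.p t)) (Er.mul hy h1))) using 1
      rw [map_mul, eX, hs, map_sub, map_mul, map_mul, map_natCast, map_natCast, mY, map_mul, ev_Y, lam_succ]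
      linear_combination T.lam t * s2
    · convert Er.mul hy h3 using 1
      rw [hs, mY, map_mul, ev_Y, lam_succ]
      ring

lemma Er_stage (s M : ℕ) {f g : K} (h : g ∈ Er (T.O (s + 1)) (T.x 0) (T.y 0) f M) :
    ∃ a ∈ T.O (s + 1), ∃ b ∈ T.O (s + 1), g = f * a + T.x (s + 1) ^ M * b := by
  obtain ⟨a, ha, e, he, rfl⟩ := h
  obtain ⟨b, hb, rfl⟩ := pw_sub le_rfl (T.dvd s).1 (T.dvd s).2 he
  exact ⟨a, ha, b, hb, rfl⟩

end Tower

/-- a polynomial divisible by `X ^ m` -/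
lemma ev_factor {P : Pol k} {m : ℕ} (h : ∀ u < m, P.coeff u = 0) (x y : K) {O : Subring K}
    (hk : ∀ c : k, algebraMap k K c ∈ O) (hx : x ∈ O) (hy : y ∈ O) :
    ∃ a ∈ O, ∃ b ∈ O, ev k x y P = x ^ m * (algebraMap k K (cf P m 0) + algebraMap k K (cf P m 1) * y
      + y ^ 2 * a + x * b) := by
  obtain ⟨Q, rfl⟩ := Polynomial.X_pow_dvd_iff.2 h
  have hQ : ∀ v, cf (Polynomial.X ^ m * Q) m v = cf Q 0 v := by
    intro v; unfold cf
    rw [Polynomial.coeff_X_pow_mul', if_pos le_rfl, Nat.sub_self]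
  rw [hQ, hQ, map_mul, map_pow, ev_X]
  have e1 : Q = Polynomial.X * Q.divX + Polynomial.C (Q.coeff 0) := (Polynomial.X_mul_divX_add Q).symm
  set q := Q.coeff 0 with hq
  have e2 : q = Polynomial.X * (Polynomial.X * q.divX.divX + Polynomial.C (q.divX.coeff 0)) + Polynomial.C (q.coeff 0) := by
    rw [Polynomial.X_mul_divX_add, Polynomial.X_mul_divX_add]
  refine ⟨ev k x y (Polynomial.C q.divX.divX), ev_mem hk hx hy _, ev k x y Q.divX, ev_mem hk hx hy _, ?_⟩
  congr 1
  have c0 : cf Q 0 0 = q.coeff 0 := rfl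
  have c1 : cf Q 0 1 = q.divX.coeff 0 := by rw [Polynomial.coeff_divX]
  rw [c0, c1]
  conv_lhs => rw [e1]
  rw [map_add, map_mul, ev_X]
  conv_lhs => rw [e2]
  simp only [Polynomial.C_add, Polynomial.C_mul, map_add, map_mul, ev_C, ev_Y]
  ring

lemma not_vpos_add {ν : KValuation k K ℝ} {c : k} (hc : c ≠ 0) {b : K} (hb : VPos ν b) :
    ¬ VPos ν (algebraMap k K c + b) := by
  obtain ⟨h1, h2⟩ := v_unit_add hc hb
  rintro (h | h)
  · exact h1 h
  · linarith

lemma der_divPow (ξ : Derivation k K K) {f x : K} (hx : x ≠ 0) (hf : f ≠ 0) (N : ℕ) :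
    ξ (f / x ^ N) = ξ f / x ^ N - N * (f / x ^ N) * ld ξ x := by
  have hxN := pow_ne_zero N hx
  rw [← ld_mul_self ξ (div_ne_zero hf hxN), ld_div ξ hf hxN, ld_pow ξ hx, ← ld_mul_self ξ hf]
  field_simp

lemma ld_smul (q : K) (ξ : Derivation k K K) (x : K) : ld (q • ξ) x = q * ld ξ x := by
  unfold ld; rw [Derivation.smul_apply, smul_eq_mul]; ring

lemma exists_mult_gt (B : ℝ) {ε : ℝ} (h : 0 < ε) : ∃ D : ℕ, B < D * ε := by
  obtain ⟨D, hD⟩ := exists_nat_gt (B / ε)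
  exact ⟨D, by rwa [div_lt_iff₀ h] at hD⟩

namespace Tower
variable {ν : KValuation k K ℝ} {f : ℕ → K} (T : Tower ν (f 0))

lemma fseq (F : FSeq ν (T.O 0) (T.x 0) (T.y 0) f) (s : ℕ) :
    FSeq ν (T.O (s + 1)) (T.x (s + 1)) (T.y (s + 1)) f := by
  obtain ⟨⟨a, ha, ea⟩, ⟨b, hb, eb⟩⟩ := T.dvd s
  exact F.trans (T.reach_le (Nat.zero_le _)).2 (T.chart _) ⟨a, ha, 0, (T.O _).zero_mem, by rw [ea]; ring⟩
    ⟨b, hb, 0, (T.O _).zero_mem, by rw [eb]; ring⟩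

lemma fin_form {s M N m : ℕ} {O' : Subring K} (hle : T.O (s + 1) ≤ O') {z g : K} {P : Pol k}
    (hz : z / T.x (s + 1) ^ N ∈ O') (hg : g - ev k (T.x (s + 1)) (T.y (s + 1)) P ∈ Er (T.O (s + 1)) (T.x 0) (T.y 0) z M)
    (hP : ∀ u < m, P.coeff u = 0) (hN : m + 1 ≤ N) (hM : m + 1 ≤ M) :
    ∃ a ∈ O', ∃ b ∈ O', g = T.x (s + 1) ^ m * (algebraMap k K (cf P m 0) +
      algebraMap k K (cf P m 1) * T.y (s + 1) + T.y (s + 1) ^ 2 * a + T.x (s + 1) * b) := by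
  have C := T.chart (s + 1)
  obtain ⟨a1, ha1, b1, hb1, e1⟩ := T.Er_stage s M hg
  obtain ⟨a, ha, b, hb, e⟩ := ev_factor hP (T.x (s + 1)) (T.y (s + 1)) C.algk C.hx C.hy
  obtain ⟨N', rfl⟩ := Nat.exists_eq_add_of_le hN
  obtain ⟨M', rfl⟩ := Nat.exists_eq_add_of_le hM
  have hx' := hle C.hx
  refine ⟨a, hle ha, b + T.x (s + 1) ^ N' * (z / T.x (s + 1) ^ (m + 1 + N')) * a1 + T.x (s + 1) ^ M' * b1,
    O'.add_mem (O'.add_mem (hle hb) (O'.mul_mem (O'.mul_mem (O'.pow_mem hx' _) hz) (hle ha1)))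
      (O'.mul_mem (O'.pow_mem hx' _) (hle hb1)), ?_⟩
  have ez : z = T.x (s + 1) ^ (m + 1 + N') * (z / T.x (s + 1) ^ (m + 1 + N')) := by
    have := C.x0
    field_simp
  generalize hq : z / T.x (s + 1) ^ (m + 1 + N') = q at *
  rw [ez] at e1
  linear_combination e1 + e

lemma NF_nonzero (F : FSeq ν (T.O 0) (T.x 0) (T.y 0) f) (ξ : Derivation k K K) [CharZero k] (hnf : ∀ t, ∃ t' ≥ t, 2 ≤ T.d t') (hpres : ∀ a ∈ T.O 0, ξ a ∈ T.O 0)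
    (hld : ld ξ (T.x 0) ∈ T.O 0) (D : ℕ)
    (hD : ∀ i₀, ∃ i ≥ i₀, ξ (f i) ∉ Er (T.O 0) (T.x 0) (T.y 0) (f i) D) : Goal ν (T.O 0) ξ := by
  obtain ⟨s, mb, hs⟩ := T.HS_one hnf D
  have F1 := T.fseq F s
  have hin : ∀ z g : K, g ∈ T.O 0 → g - ev k (T.x 0) (T.y 0) (0 : Pol k) ∈ Er (T.O 0) (T.x 0) (T.y 0) z 0 := by
    intro z g hg
    exact ⟨0, (T.O 0).zero_mem, g, hg, by simp⟩
  obtain ⟨h1, h2, -⟩ := T.eval_tri ξ 0 0 0 0 0 0 (hin _ _ hld) (hin _ _ (hpres _ (T.chart 0).hy)) (hin _ _ (T.O 0).zero_mem) (s + 1)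
  rw [(T.tri_zero 0 _).1, map_zero, sub_zero] at h1
  rw [(T.tri_zero 0 _).2, map_zero, sub_zero] at h2
  have h1' : T.lam (s + 1) * ld ξ (T.x (s + 1)) ∈ T.O (s + 1) := by
    obtain ⟨a, ha, b, hb, e⟩ := T.Er_stage s 0 h1
    rw [e]; simpa using hb
  have h2' : T.lam (s + 1) * ξ (T.y (s + 1)) ∈ T.O (s + 1) := by
    obtain ⟨a, ha, b, hb, e⟩ := T.Er_stage s 0 h2
    rw [e]; simpa using hb
  clear h1 h2
  obtain ⟨i₀, hi₀⟩ := F1.lim ((mb + 1 : ℕ) * ν.v (T.x (s + 1)))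
  obtain ⟨i, hi, hni⟩ := hD i₀
  obtain ⟨P, e, he, r, hr, E⟩ := (F.chart i).expand (D + mb + 1) (hpres _ (F.chart i).hz)
  have hlow : Low D P := by
    by_contra hn
    apply hni
    have C := T.chart 0
    refine ⟨r, hr, ev k (T.x 0) (T.y 0) P + e, pw_add (ev_mem_pw C.algk C.hx C.hy hn) (pw_anti C.hx C.hy (by omega) he), ?_⟩
    rw [E]; ring
  obtain ⟨m, hm, hdiv, hc⟩ := hs 0 0 P (Or.inr (Or.inr hlow))
  rw [(T.tri_zero P _).1, (T.tri_zero P _).2] at hc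
  have hc0 : cf (T.tri 0 0 P (s + 1)).2.2 m 0 ≠ 0 := by
    rcases hc with ⟨v, hv, h | h⟩ | ⟨v, hv, h⟩
    · simp [cf] at h
    · obtain rfl : v = 0 := by omega
      exact h
    · simp [cf] at h
  obtain ⟨-, -, h3⟩ := T.eval_tri (0 : Derivation k K K) (ξ (f i)) (f i) 0 0 P (D + mb + 1) (by simpa [ld] using Er.zero)
    (by simpa using Er.zero) ⟨r, hr, e, he, by rw [E]; ring⟩ (s + 1)
  obtain ⟨O', hR, C'⟩ := (F1.chart i).divPow (mb + 1) (hi₀ i hi)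
  have hle := hR.2
  obtain ⟨a, ha, b, hb, E3⟩ := T.fin_form hle C'.hz h3 (fun u hu => (hdiv u hu).2.2) (by omega) (by omega)
  set x := T.x (s + 1) with hx
  set y := T.y (s + 1) with hy
  set lam := T.lam (s + 1) with hlam
  set z := f i / x ^ (mb + 1) with hz
  obtain ⟨l, hl⟩ := Nat.exists_eq_add_of_le hm
  refine Goal.trans (T.reach_le (Nat.zero_le (s + 1))).1 (Goal.trans hR.1 (Goal.smul (x ^ (l + 1) * lam) ?_))
  have hx0 : x ≠ 0 := C'.x0
  have hxl : x ^ (l + 1) ∈ O' := O'.pow_mem C'.hx _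
  have ez : ((x ^ (l + 1) * lam) • ξ) z = algebraMap k K (cf (T.tri 0 0 P (s + 1)).2.2 m 0) +
      (y * (algebraMap k K (cf (T.tri 0 0 P (s + 1)).2.2 m 1) + y * a) + x * (b -
        (mb + 1 : ℕ) * z * (x ^ l * (lam * ld ξ x)))) := by
    rw [Derivation.smul_apply, smul_eq_mul, hz, der_divPow ξ hx0 (F1.chart i).z0, ← hz]
    have : x ^ (l + 1) * lam * (ξ (f i) / x ^ (mb + 1)) = (lam * ξ (f i)) / x ^ m := by
      rw [hl]; field_simp; ring
    rw [mul_sub, this, E3]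
    field_simp
    ring
  have m1 : algebraMap k K (cf (T.tri 0 0 P (s + 1)).2.2 m 1) + y * a ∈ O' :=
    O'.add_mem (C'.algk _) (O'.mul_mem C'.hy ha)
  have m2 : b - (mb + 1 : ℕ) * z * (x ^ l * (lam * ld ξ x)) ∈ O' :=
    O'.sub_mem hb (O'.mul_mem (O'.mul_mem (natCast_mem _ _) C'.hz) (O'.mul_mem (O'.pow_mem C'.hx _) (hle h1')))
  refine C'.goal_one _ (a := x ^ (l + 1) * (lam * ld ξ x)) (b := x ^ (l + 1) * (lam * ξ y)) (O'.mul_mem hxl (hle h1'))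
    (O'.mul_mem hxl (hle h2')) ?_ ?_ ?_ ez ?_
  · exact O'.add_mem (C'.algk _) (O'.add_mem (O'.mul_mem C'.hy m1) (O'.mul_mem C'.hx m2))
  · rw [Derivation.smul_apply, smul_eq_mul, ← ld_mul_self ξ hx0]; ring
  · rw [Derivation.smul_apply, smul_eq_mul]; ring
  · refine Or.inr (Or.inr (C'.not_sq_unit (not_vpos_add hc0 ?_)))
    exact (C'.my.mul (C'.cen.vge m1)).add (C'.mx.mul (C'.cen.vge m2))

lemma NF_zero (F : FSeq ν (T.O 0) (T.x 0) (T.y 0) f) (ξ : Derivation k K K) [CharZero k] (hnf : ∀ t, ∃ t' ≥ t, 2 ≤ T.d t') (hξ : ξ ≠ 0) (hpres : ∀ a ∈ T.O 0, ξ a ∈ T.O 0)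
    (hld : ld ξ (T.x 0) ∈ T.O 0) 
    (hD : ∀ D, ∃ i₀, ∀ i ≥ i₀, ξ (f i) ∈ Er (T.O 0) (T.x 0) (T.y 0) (f i) D) : Goal ν (T.O 0) ξ := by
  have C := T.chart 0
  by_cases htriv : ld ξ (T.x 0) = 0 ∧ ξ (T.y 0) = 0
  · refine C.goal_trivial ξ hξ ?_ htriv.2
    rw [← ld_mul_self ξ C.x0, htriv.1, zero_mul]
  obtain ⟨ε, hε, hεx, hεy⟩ : ∃ ε : ℝ, 0 < ε ∧ ε ≤ ν.v (T.x 0) ∧ ε ≤ ν.v (T.y 0) :=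
    ⟨min (ν.v (T.x 0)) (ν.v (T.y 0)), lt_min C.vx C.vy, min_le_left _ _, min_le_right _ _⟩
  obtain ⟨D, hDa⟩ := exists_mult_gt (max (ν.v (ld ξ (T.x 0))) (ν.v (ξ (T.y 0)))) hε
  obtain ⟨s, mb, hs⟩ := T.HS_one hnf D
  have F1 := T.fseq F s
  obtain ⟨i₁, hi₁⟩ := F1.lim ((mb + 2 : ℕ) * ν.v (T.x (s + 1)))
  obtain ⟨i₂, hi₂⟩ := F.lim (max (ν.v (ld ξ (T.x 0))) (ν.v (ξ (T.y 0))))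
  obtain ⟨i₃, hi₃⟩ := hD (D + mb + 2 + mb + 2)
  obtain ⟨i, j1, j2, j3⟩ : ∃ i, i₁ ≤ i ∧ i₂ ≤ i ∧ i₃ ≤ i := ⟨i₁ + i₂ + i₃, by omega, by omega, by omega⟩
  replace hi₁ := hi₁ i j1
  replace hi₂ := hi₂ i j2
  obtain ⟨r, hr, e, he, Er0⟩ := hi₃ i j3
  obtain ⟨PA, eA, heA, sA, hsA, EA⟩ := (F.chart i).expand (D + mb + 2 + mb + 2) hld
  obtain ⟨PB, eB, heB, sB, hsB, EB⟩ := (F.chart i).expand (D + mb + 2 + mb + 2) (hpres _ C.hy)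
  obtain ⟨PG, eG, heG, sG, hsG, EG⟩ := (F.chart i).expand (D + mb + 2 + mb + 2) hr
  have hlow : Low D PA ∨ Low D PB ∨ Low D PG := by
    by_cases h0 : ld ξ (T.x 0) = 0
    · have h1 : ξ (T.y 0) ≠ 0 := fun h1 => htriv ⟨h0, h1⟩
      exact Or.inr (Or.inl ((F.chart i).low h1 ((le_max_right _ _).trans_lt hi₂) hεx hεy
        ((le_max_right _ _).trans_lt hDa) (by omega) heB hsB EB))
    · exact Or.inl ((F.chart i).low h0 ((le_max_left _ _).trans_lt hi₂) hεx hεy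
        ((le_max_left _ _).trans_lt hDa) (by omega) heA hsA EA)
  obtain ⟨m, hm, hdiv, hc⟩ := hs PA PB PG hlow
  obtain ⟨h1, h2, h3⟩ := T.eval_tri ξ r (f i) PA PB PG (D + mb + 2 + mb + 2) ⟨sA, hsA, eA, heA, by rw [EA]; ring⟩
    ⟨sB, hsB, eB, heB, by rw [EB]; ring⟩ ⟨sG, hsG, eG, heG, by rw [EG]; ring⟩ (s + 1)
  obtain ⟨O', hR, C'⟩ := (F1.chart i).divPow (mb + 2) hi₁
  have hle := hR.2
  obtain ⟨a1, ha1, b1, hb1, E1⟩ := T.fin_form hle C'.hz h1 (fun u hu => (hdiv u hu).1) (by omega) (by omega)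
  obtain ⟨a2, ha2, b2, hb2, E2⟩ := T.fin_form hle C'.hz h2 (fun u hu => (hdiv u hu).2.1) (by omega) (by omega)
  obtain ⟨a3, ha3, b3, hb3, E3⟩ := T.fin_form hle C'.hz h3 (fun u hu => (hdiv u hu).2.2) (by omega) (by omega)
  obtain ⟨e', he', ee⟩ := pw_sub (T.reach_le (Nat.zero_le (s + 1))).2 (T.dvd s).1 (T.dvd s).2 he
  generalize (T.tri PA PB PG (s + 1)).1 = A at *
  generalize (T.tri PA PB PG (s + 1)).2.1 = B at *
  generalize (T.tri PA PB PG (s + 1)).2.2 = G at *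
  have hlamm := hle (T.lam_mem (s + 1))
  set x := T.x (s + 1) with hx
  set y := T.y (s + 1) with hy
  set lam := T.lam (s + 1) with hlam
  set z := f i / x ^ (mb + 2) with hz
  obtain ⟨l, hl⟩ := Nat.exists_eq_add_of_le hm
  refine Goal.trans (T.reach_le (Nat.zero_le (s + 1))).1 (Goal.trans hR.1 (Goal.smul (lam / x ^ m) ?_))
  have hx0 : x ≠ 0 := C'.x0
  set as := algebraMap k K (cf A m 0) + (y * (algebraMap k K (cf A m 1) + y * a1) + x * b1) with has
  set bs := algebraMap k K (cf B m 0) + (y * (algebraMap k K (cf B m 1) + y * a2) + x * b2) with hbs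
  set rs := algebraMap k K (cf G m 0) + (y * (algebraMap k K (cf G m 1) + y * a3) + x * b3) with hrs
  have mem1 : ∀ P : Pol k, ∀ a ∈ O', algebraMap k K (cf P m 1) + y * a ∈ O' := fun P a ha =>
    O'.add_mem (C'.algk _) (O'.mul_mem C'.hy ha)
  have mem2 : ∀ P : Pol k, ∀ a ∈ O', ∀ b ∈ O', y * (algebraMap k K (cf P m 1) + y * a) + x * b ∈ O' := fun P a ha b hb =>
    O'.add_mem (O'.mul_mem C'.hy (mem1 P a ha)) (O'.mul_mem C'.hx hb)
  have pos2 : ∀ P : Pol k, ∀ a ∈ O', ∀ b ∈ O', VPos ν (y * (algebraMap k K (cf P m 1) + y * a) + x * b) := fun P a ha b hb =>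
    (C'.my.mul (C'.cen.vge (mem1 P a ha))).add (C'.mx.mul (C'.cen.vge hb))
  have mas : as ∈ O' := O'.add_mem (C'.algk _) (mem2 A a1 ha1 b1 hb1)
  have mbs : bs ∈ O' := O'.add_mem (C'.algk _) (mem2 B a2 ha2 b2 hb2)
  have mrs : rs ∈ O' := O'.add_mem (C'.algk _) (mem2 G a3 ha3 b3 hb3)
  have F1' : lam * ld ξ x = x ^ m * as := by rw [E1, has]; ring
  have F2' : lam * ξ y = x ^ m * bs := by rw [E2, hbs]; ring
  have F3' : lam * r = x ^ m * rs := by rw [E3, hrs]; ring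
  have mN : ((mb + 2 : ℕ) : K) ∈ O' := natCast_mem _ _
  have mt : x ^ (D + l + 1) * (lam * e') ∈ O' := O'.mul_mem (O'.pow_mem C'.hx _) (O'.mul_mem hlamm (hle he'))
  have ez : ((lam / x ^ m) • ξ) z = x ^ (D + l + 1) * (lam * e') * x + 0 * y + (rs - (mb + 2 : ℕ) * as) * z := by
    rw [Derivation.smul_apply, smul_eq_mul, hz, der_divPow ξ hx0 (F1.chart i).z0, ← hz, Er0, ee]
    have q1 : lam / x ^ m * ((f i * r + x ^ (D + mb + 2 + mb + 2) * e') / x ^ (mb + 2)) = rs * z + x ^ (D + l + 2) * (lam * e') := by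
      rw [hz, hl]
      have : lam / x ^ m * ((f i * r + x ^ (D + (m + l) + 2 + (m + l) + 2) * e') / x ^ (m + l + 2))
         = ((lam * r) / x ^ m) * (f i / x ^ (m + l + 2)) + x ^ (D + l + 2) * (lam * e') := by
        field_simp; ring
      rw [this, F3']
      field_simp
    have q2 : lam / x ^ m * ((mb + 2 : ℕ) * z * ld ξ x) = (mb + 2 : ℕ) * z * as := by
      have : lam / x ^ m * ((mb + 2 : ℕ) * z * ld ξ x) = (mb + 2 : ℕ) * z * (lam * ld ξ x) / x ^ m := by ring
      rw [this, F1']; field_simp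
    rw [mul_sub, q1, q2]; ring
  refine C'.goal_one _ (a := as) (b := bs) mas mbs ?_ ?_ ?_ ez ?_
  · exact O'.add_mem (O'.add_mem (O'.mul_mem mt C'.hx) (O'.mul_mem O'.zero_mem C'.hy)) (O'.mul_mem (O'.sub_mem mrs (O'.mul_mem mN mas)) C'.hz)
  · rw [Derivation.smul_apply, smul_eq_mul, ← ld_mul_self ξ hx0]
    have : lam / x ^ m * (ld ξ x * x) = (lam * ld ξ x) * x / x ^ m := by ring
    rw [this, F1']; field_simp
  · rw [Derivation.smul_apply, smul_eq_mul]
    have : lam / x ^ m * ξ y = (lam * ξ y) / x ^ m := by ring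
    rw [this, F2']; field_simp
  · by_cases hA0 : cf A m 0 = 0
    swap
    · exact Or.inl (C'.not_sq_unit (not_vpos_add hA0 (pos2 A a1 ha1 b1 hb1)))
    have pas : VPos ν as := by
      rw [has, hA0, map_zero, zero_add]; exact pos2 A a1 ha1 b1 hb1
    rcases hc with ⟨v, hv, h | h⟩ | ⟨v, hv, h⟩
    · obtain rfl : v = 0 := by omega
      exact absurd hA0 h
    · obtain rfl : v = 0 := by omega
      refine Or.inr (Or.inr (C'.not_sq_lin mt O'.zero_mem (O'.sub_mem mrs (O'.mul_mem mN mas)) (Or.inr (Or.inr ?_))))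
      rw [hrs, add_sub_assoc]
      exact not_vpos_add h ((pos2 G a3 ha3 b3 hb3).sub (VPos.mul' (C'.cen.vge mN) pas))
    · refine Or.inr (Or.inl ?_)
      by_cases hB0 : cf B m 0 = 0
      · obtain rfl : v = 1 := by
          rcases Nat.le_one_iff_eq_zero_or_eq_one.1 hv with rfl | rfl
          · exact absurd hB0 h
          · rfl
        have : bs = b2 * x + (algebraMap k K (cf B m 1) + y * a2) * y + 0 * z := by
          rw [hbs, hB0, map_zero]; ring
        rw [this]
        refine C'.not_sq_lin hb2 (mem1 B a2 ha2) O'.zero_mem (Or.inr (Or.inl ?_))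
        exact not_vpos_add h (C'.my.mul (C'.cen.vge ha2))
      · exact C'.not_sq_unit (not_vpos_add hB0 (pos2 B a2 ha2 b2 hb2))

lemma NF (F : FSeq ν (T.O 0) (T.x 0) (T.y 0) f) (ξ : Derivation k K K) [CharZero k] (hnf : ∀ t, ∃ t' ≥ t, 2 ≤ T.d t') (hξ : ξ ≠ 0) (hpres : ∀ a ∈ T.O 0, ξ a ∈ T.O 0)
    (hld : ld ξ (T.x 0) ∈ T.O 0) : Goal ν (T.O 0) ξ := by
  by_cases h : ∀ D, ∃ i₀, ∀ i ≥ i₀, ξ (f i) ∈ Er (T.O 0) (T.x 0) (T.y 0) (f i) D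
  · exact T.NF_zero F ξ hnf hξ hpres hld h
  · push Not at h
    obtain ⟨D, hD⟩ := h
    exact T.NF_nonzero F ξ hnf hpres hld D hD

end Tower

/-- the ideal `(x ^ j, y, z)` -/
def Ix (O : Subring K) (x y z : K) (j : ℕ) : Set K :=
  {g | ∃ u ∈ O, ∃ b ∈ O, ∃ c ∈ O, g = x ^ j * u + y * b + z * c}

/-- order exactly `j` along `y = z = 0` -/
def Uo (ν : KValuation k K ℝ) (O : Subring K) (x y z : K) (j : ℕ) : Set K :=
  {g | ∃ u ∈ O, ¬ VPos ν u ∧ ∃ b ∈ O, ∃ c ∈ O, g = x ^ j * u + y * b + z * c}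

section
variable {ν : KValuation k K ℝ} {O O' : Subring K} {x y z : K}

lemma Uo.mem {j : ℕ} {g : K} (h : g ∈ Uo ν O x y z j) : g ∈ Ix O x y z j := by
  obtain ⟨u, hu, -, b, hb, c, hc, e⟩ := h
  exact ⟨u, hu, b, hb, c, hc, e⟩

lemma order_cases (h : Chart ν O x y z) {g : K} (hg : g ∈ O) (j : ℕ) :
    g ∈ Ix O x y z j ∨ ∃ m < j, g ∈ Uo ν O x y z m := by
  induction j with
  | zero => exact Or.inl ⟨g, hg, 0, O.zero_mem, 0, O.zero_mem, by ring⟩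
  | succ j ih =>
    rcases ih with ⟨u, hu, b, hb, c, hc, e⟩ | ⟨m, hm, h'⟩
    · by_cases hp : VPos ν u
      · left
        obtain ⟨b₁, h₁, b₂, h₂, b₃, h₃, e'⟩ := h.gen_pos hu hp
        refine ⟨b₁, h₁, x ^ j * b₂ + b, O.add_mem (O.mul_mem (O.pow_mem h.hx _) h₂) hb,
          x ^ j * b₃ + c, O.add_mem (O.mul_mem (O.pow_mem h.hx _) h₃) hc, ?_⟩
        rw [e, e']; ring
      · exact Or.inr ⟨j, by omega, u, hu, hp, b, hb, c, hc, e⟩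
    · exact Or.inr ⟨m, by omega, h'⟩

lemma min_order (h : Chart ν O x y z) (G : Set K) (hG : ∀ g ∈ G, g ∈ O) {j : ℕ}
    (hex : ∃ g ∈ G, ∃ m < j, g ∈ Uo ν O x y z m) :
    ∃ j₀ < j, (∀ g ∈ G, g ∈ Ix O x y z j₀) ∧ ∃ g ∈ G, g ∈ Uo ν O x y z j₀ := by
  have hP : ∃ m, ∃ g ∈ G, g ∈ Uo ν O x y z m := by
    obtain ⟨g, hg, m, -, hm⟩ := hex
    exact ⟨m, g, hg, hm⟩
  refine ⟨Nat.find hP, ?_, ?_, Nat.find_spec hP⟩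
  · obtain ⟨g, hg, m, hm, hm'⟩ := hex
    exact (Nat.find_min' hP ⟨g, hg, hm'⟩).trans_lt hm
  · intro g hg
    rcases order_cases h (hG g hg) (Nat.find hP) with h1 | ⟨m, hm, h1⟩
    · exact h1
    · exact absurd ⟨g, hg, h1⟩ (Nat.find_min hP hm)

lemma Ix_div {y' z' : K} {N j : ℕ} (hO : O ≤ O') (hx : x ∈ O') (hx0 : x ≠ 0) (hy : y' ∈ O') (hz : z' ∈ O')
    (ey : y = x ^ N * y') (ez : z = x ^ N * z') (hj : j ≤ N) {g : K} (hg : g ∈ Ix O x y z j) :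
    g / x ^ j ∈ O' := by
  obtain ⟨u, hu, b, hb, c, hc, e⟩ := hg
  obtain ⟨l, rfl⟩ := Nat.exists_eq_add_of_le hj
  have : g / x ^ j = u + x ^ l * (y' * b + z' * c) := by
    rw [e, ey, ez]; field_simp; ring
  rw [this]
  exact O'.add_mem (hO hu) (O'.mul_mem (O'.pow_mem hx _) (O'.add_mem (O'.mul_mem hy (hO hb)) (O'.mul_mem hz (hO hc))))

lemma Uo_div {y' z' : K} {N j : ℕ} (hO : O ≤ O') (C : Chart ν O' x y' z')
    (ey : y = x ^ N * y') (ez : z = x ^ N * z') (hj : j + 1 ≤ N) {g : K} (hg : g ∈ Uo ν O x y z j) :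
    ¬ VPos ν (g / x ^ j) := by
  obtain ⟨u, hu, hn, b, hb, c, hc, e⟩ := hg
  obtain ⟨l, rfl⟩ := Nat.exists_eq_add_of_le hj
  have hx0 := C.x0
  have : g / x ^ j = u + x * (x ^ l * (y' * b + z' * c)) := by
    rw [e, ey, ez]; field_simp; ring
  rw [this]
  intro hp
  apply hn
  have h2 : VPos ν (x * (x ^ l * (y' * b + z' * c))) := C.mx.mul (C.cen.vge
    (O'.mul_mem (O'.pow_mem C.hx _) (O'.add_mem (O'.mul_mem C.hy (hO hb)) (O'.mul_mem C.hz (hO hc)))))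
  simpa using hp.sub h2

lemma divPow_both (h : Chart ν O x y z) (N : ℕ) (hy : N * ν.v x < ν.v y) (hz : N * ν.v x < ν.v z) :
    ∃ O', Reach ν O O' ∧ Chart ν O' x (y / x ^ N) (z / x ^ N) := by
  obtain ⟨O₁, r₁, h₁⟩ := h.divPow N hz
  obtain ⟨O₂, r₂, h₂⟩ := h₁.swap23.divPow N hy
  exact ⟨O₂, r₁.trans r₂, h₂.swap23⟩

lemma not_vpos_sub {a b : K} (ha : ¬ VPos ν a) (hb : VPos ν b) : ¬ VPos ν (a - b) := by
  intro h; apply ha; simpa using h.add hb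

lemma F_nonzero (ξ : Derivation k K K) {a : K} (ha : a ∈ O) (hax : ξ x = a * x) (h : Chart ν O x y z)
    (hpres : ∀ g ∈ O, ξ g ∈ O) (j : ℕ) (hy : (j + 1 : ℕ) * ν.v x < ν.v y) (hz : (j + 1 : ℕ) * ν.v x < ν.v z)
    (hn : ¬ (ξ y ∈ Ix O x y z j ∧ ξ z ∈ Ix O x y z j)) : Goal ν O ξ := by
  have hx0 := h.x0
  obtain ⟨j₀, hj, h1, h2⟩ := min_order h {ξ y, ξ z} (by
      rintro g (rfl | rfl)
      exacts [hpres _ h.hy, hpres _ h.hz]) (j := j) (by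
      by_contra hc
      apply hn
      push Not at hc
      constructor
      · rcases order_cases h (hpres _ h.hy) j with h1 | ⟨m, hm, h1⟩
        · exact h1
        · exact absurd h1 (hc _ (by simp) m hm)
      · rcases order_cases h (hpres _ h.hz) j with h1 | ⟨m, hm, h1⟩
        · exact h1
        · exact absurd h1 (hc _ (by simp) m hm))
  obtain ⟨O', hR, C⟩ := divPow_both h (j + 1) hy hz
  have hxN := pow_ne_zero (j + 1) hx0
  have ey : y = x ^ (j + 1) * (y / x ^ (j + 1)) := by field_simp
  have ez : z = x ^ (j + 1) * (z / x ^ (j + 1)) := by field_simp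
  have i1 := Ix_div hR.2 C.hx hx0 C.hy C.hz ey ez (by omega) (h1 _ (Or.inl rfl))
  have i2 := Ix_div hR.2 C.hx hx0 C.hy C.hz ey ez (by omega) (h1 _ (Or.inr rfl))
  obtain ⟨l, rfl⟩ := Nat.exists_eq_add_of_lt hj
  have ldx : ld ξ x = a := by unfold ld; rw [hax]; field_simp
  have key : ∀ g : K, g ≠ 0 → (x ^ (l + 2) • ξ) (g / x ^ (j₀ + l + 1 + 1)) = ξ g / x ^ j₀ -
      x * (x ^ (l + 1) * ((j₀ + l + 1 + 1 : ℕ) * (g / x ^ (j₀ + l + 1 + 1)) * a)) := by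
    intro g hg
    rw [Derivation.smul_apply, smul_eq_mul, der_divPow ξ hx0 hg, ldx]
    field_simp
    ring
  have mem : ∀ g ∈ O', x ^ (l + 1) * ((j₀ + l + 1 + 1 : ℕ) * g * a) ∈ O' := fun g hg =>
    O'.mul_mem (O'.pow_mem C.hx _) (O'.mul_mem (O'.mul_mem (natCast_mem _ _) hg) (hR.2 ha))
  refine Goal.trans hR.1 (Goal.smul (x ^ (l + 2)) (C.goal_one _ (a := x ^ (l + 2) * a) (O'.mul_mem (O'.pow_mem C.hx _) (hR.2 ha))
    (O'.sub_mem i1 (O'.mul_mem C.hx (mem _ C.hy))) (O'.sub_mem i2 (O'.mul_mem C.hx (mem _ C.hz))) ?_ (key y h.y0) (key z h.z0) ?_))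
  · rw [Derivation.smul_apply, smul_eq_mul, hax]; ring
  · obtain ⟨g, rfl | rfl, hg⟩ := h2
    · exact Or.inr (Or.inl (C.not_sq_unit (not_vpos_sub (Uo_div hR.2 C ey ez (by omega) hg) (C.mx.mul (C.cen.vge (mem _ C.hy))))))
    · exact Or.inr (Or.inr (C.not_sq_unit (not_vpos_sub (Uo_div hR.2 C ey ez (by omega) hg) (C.mx.mul (C.cen.vge (mem _ C.hz))))))

lemma F_zero (ξ : Derivation k K K) {a : K} (ha : a ∈ O) (ha0 : a ≠ 0) (hax : ξ x = a * x) (h : Chart ν O x y z)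
    (j : ℕ) (haj : ν.v a < j * ν.v x) (hay : ν.v a < ν.v y) (haz : ν.v a < ν.v z)
    (hy : (j + 2 : ℕ) * ν.v x < ν.v y) (hz : (j + 2 : ℕ) * ν.v x < ν.v z)
    (hyI : ξ y ∈ Ix O x y z (2 * j + 4)) (hzI : ξ z ∈ Ix O x y z (2 * j + 4)) : Goal ν O ξ := by
  have hx0 := h.x0
  obtain ⟨r, hr, s, hs, t, ht, e1⟩ := hyI
  obtain ⟨r', hr', s', hs', t', ht', e2⟩ := hzI
  obtain ⟨j₀, hj, h1, h2⟩ := min_order h {a, s, t, s', t'} (by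
      rintro g (rfl | rfl | rfl | rfl | rfl) <;> assumption) (j := j) (by
      refine ⟨a, by simp, ?_⟩
      rcases order_cases h ha j with ⟨u, hu, b, hb, c, hc, e⟩ | h1
      swap
      · exact h1
      exfalso
      have w1 : VGe ν (j * ν.v x) (x ^ j * u) := by
        have := VGe.mul (show VGe ν (j * ν.v x) (x ^ j) from Or.inr (v_pow ν x hx0 j).ge) (h.cen.vge hu)
        simpa using this
      have w2 : VGe ν (ν.v y) (y * b) := by
        have := VGe.mul (show VGe ν (ν.v y) y from Or.inr le_rfl) (h.cen.vge hb)
        simpa using this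
      have w3 : VGe ν (ν.v z) (z * c) := by
        have := VGe.mul (show VGe ν (ν.v z) z from Or.inr le_rfl) (h.cen.vge hc)
        simpa using this
      obtain ⟨q, hq, q1, q2, q3⟩ : ∃ q, ν.v a < q ∧ q ≤ j * ν.v x ∧ q ≤ ν.v y ∧ q ≤ ν.v z :=
        ⟨min (j * ν.v x) (min (ν.v y) (ν.v z)), by simp [haj, hay, haz], by simp, by simp, by simp⟩
      have := ((w1.mono q1).add (w2.mono q2)).add (w3.mono q3)
      rw [← e] at this
      rcases this with h0 | h0
      · exact ha0 h0
      · linarith)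
  obtain ⟨O', hR, C⟩ := divPow_both h (j + 2) hy hz
  have hxN := pow_ne_zero (j + 2) hx0
  have ey : y = x ^ (j + 2) * (y / x ^ (j + 2)) := by field_simp
  have ez : z = x ^ (j + 2) * (z / x ^ (j + 2)) := by field_simp
  have i := fun g hg => Ix_div hR.2 C.hx hx0 C.hy C.hz ey ez (by omega) (h1 g hg)
  have ia := i a (by simp)
  have is := i s (by simp)
  have it := i t (by simp)
  have is' := i s' (by simp)
  have it' := i t' (by simp)
  have iu : ∃ g ∈ ({a, s, t, s', t'} : Set K), ¬ VPos ν (g / x ^ j₀) := by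
    obtain ⟨g, hg, hg'⟩ := h2
    exact ⟨g, hg, Uo_div hR.2 C ey ez (by omega) hg'⟩
  clear i h1 h2
  obtain ⟨l, rfl⟩ := Nat.exists_eq_add_of_lt hj
  have ldx : ld ξ x = a := by unfold ld; rw [hax]; field_simp
  generalize hN : j₀ + l + 1 + 2 = N at *
  have eN : 2 * (j₀ + l + 1) + 4 = N + (l + 3) + j₀ := by omega
  set Y := y / x ^ N with hY
  set Z := z / x ^ N with hZ
  have mN : (N : K) ∈ O' := natCast_mem _ _
  have k1 : ((x ^ j₀)⁻¹ • ξ) Y = (x ^ (l + 2) * r) * x + (s / x ^ j₀ - N * (a / x ^ j₀)) * Y + (t / x ^ j₀) * Z := by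
    rw [Derivation.smul_apply, smul_eq_mul, hY, der_divPow ξ hx0 h.y0, ldx, e1, eN, hZ]
    field_simp
    ring
  have k2 : ((x ^ j₀)⁻¹ • ξ) Z = (x ^ (l + 2) * r') * x + (s' / x ^ j₀) * Y + (t' / x ^ j₀ - N * (a / x ^ j₀)) * Z := by
    rw [Derivation.smul_apply, smul_eq_mul, hZ, der_divPow ξ hx0 h.z0, ldx, e2, eN, hY]
    field_simp
    ring
  have m1 : x ^ (l + 2) * r ∈ O' := O'.mul_mem (O'.pow_mem C.hx _) (hR.2 hr)
  have m1' : x ^ (l + 2) * r' ∈ O' := O'.mul_mem (O'.pow_mem C.hx _) (hR.2 hr')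
  have m2 : s / x ^ j₀ - N * (a / x ^ j₀) ∈ O' := O'.sub_mem is (O'.mul_mem mN ia)
  have m2' : t' / x ^ j₀ - N * (a / x ^ j₀) ∈ O' := O'.sub_mem it' (O'.mul_mem mN ia)
  refine Goal.trans hR.1 (Goal.smul (x ^ j₀)⁻¹ (C.goal_one _ (a := a / x ^ j₀) ia ?_ ?_ ?_ k1 k2 ?_))
  · exact O'.add_mem (O'.add_mem (O'.mul_mem m1 C.hx) (O'.mul_mem m2 C.hy)) (O'.mul_mem it C.hz)
  · exact O'.add_mem (O'.add_mem (O'.mul_mem m1' C.hx) (O'.mul_mem is' C.hy)) (O'.mul_mem m2' C.hz)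
  · rw [Derivation.smul_apply, smul_eq_mul, hax]; field_simp
  · by_cases pa : VPos ν (a / x ^ j₀)
    swap
    · exact Or.inl (C.not_sq_unit pa)
    have pNa : VPos ν (N * (a / x ^ j₀)) := VPos.mul' (C.cen.vge mN) pa
    obtain ⟨g, rfl | rfl | rfl | rfl | rfl, hg⟩ := iu
    · exact absurd pa hg
    · exact Or.inr (Or.inl (C.not_sq_lin m1 m2 it (Or.inr (Or.inl (not_vpos_sub hg pNa)))))
    · exact Or.inr (Or.inl (C.not_sq_lin m1 m2 it (Or.inr (Or.inr hg))))
    · exact Or.inr (Or.inr (C.not_sq_lin m1' is' m2' (Or.inr (Or.inl hg))))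
    · exact Or.inr (Or.inr (C.not_sq_lin m1' is' m2' (Or.inr (Or.inr (not_vpos_sub hg pNa)))))

end

lemma F_main {ν : KValuation k K ℝ} {O : Subring K} {x : K} {Y f : ℕ → K} (C : ∀ n, Chart ν O x (Y n) (f n))
    (limY : ∀ B : ℝ, ∃ i₀, ∀ i, i₀ ≤ i → B < ν.v (Y i)) (limf : ∀ B : ℝ, ∃ i₀, ∀ i, i₀ ≤ i → B < ν.v (f i))
    (ξ : Derivation k K K) (hξ : ξ ≠ 0) {a : K} (ha : a ∈ O) (hax : ξ x = a * x) (hpres : ∀ g ∈ O, ξ g ∈ O)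
    (hY : ξ x = 0 → ∀ n, ξ (Y n) = ξ (Y 0)) : Goal ν O ξ := by
  have lim : ∀ B : ℝ, ∃ i₀, ∀ i, i₀ ≤ i → B < ν.v (Y i) ∧ B < ν.v (f i) := by
    intro B
    obtain ⟨i, hi⟩ := limY B
    obtain ⟨i', hi'⟩ := limf B
    exact ⟨i + i', fun j hj => ⟨hi j (by omega), hi' j (by omega)⟩⟩
  by_cases h : ∀ j, ∃ n₀, ∀ n ≥ n₀, ξ (Y n) ∈ Ix O x (Y n) (f n) j ∧ ξ (f n) ∈ Ix O x (Y n) (f n) j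
  swap
  · push Not at h
    obtain ⟨j, hj⟩ := h
    obtain ⟨n₀, hn₀⟩ := lim ((j + 1 : ℕ) * ν.v x)
    obtain ⟨n, hn, h'⟩ := hj n₀
    exact F_nonzero ξ ha hax (C n) hpres j (hn₀ n hn).1 (hn₀ n hn).2 (fun hh => h' hh.1 hh.2)
  · by_cases ha0 : a = 0
    · have hx : ξ x = 0 := by rw [hax, ha0, zero_mul]
      have hy0 : ξ (Y 0) = 0 := by
        by_contra hne
        obtain ⟨j, hj⟩ := exists_mult_gt (ν.v (ξ (Y 0))) (C 0).vx
        obtain ⟨n₁, hn₁⟩ := h j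
        obtain ⟨n₂, hn₂⟩ := lim (ν.v (ξ (Y 0)))
        obtain ⟨u, hu, b, hb, c, hc, e⟩ := (hn₁ (n₁ + n₂) (by omega)).1
        obtain ⟨q1, q2⟩ := hn₂ (n₁ + n₂) (by omega)
        have h := C (n₁ + n₂)
        rw [hY hx] at e
        generalize Y (n₁ + n₂) = y at *
        generalize f (n₁ + n₂) = z at *
        have w1 : VGe ν (j * ν.v x) (x ^ j * u) := by
          have := VGe.mul (show VGe ν (j * ν.v x) (x ^ j) from Or.inr (v_pow ν x h.x0 j).ge) (h.cen.vge hu)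
          simpa using this
        have w2 : VGe ν (ν.v y) (y * b) := by
          have := VGe.mul (show VGe ν (ν.v y) y from Or.inr le_rfl) (h.cen.vge hb)
          simpa using this
        have w3 : VGe ν (ν.v z) (z * c) := by
          have := VGe.mul (show VGe ν (ν.v z) z from Or.inr le_rfl) (h.cen.vge hc)
          simpa using this
        obtain ⟨q, hq, q1, q2, q3⟩ : ∃ q, ν.v (ξ (Y 0)) < q ∧ q ≤ j * ν.v x ∧ q ≤ ν.v y ∧ q ≤ ν.v z :=
          ⟨min (j * ν.v x) (min (ν.v y) (ν.v z)), by simp [hj, q1, q2], by simp, by simp, by simp⟩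
        have := ((w1.mono q1).add (w2.mono q2)).add (w3.mono q3)
        rw [← e] at this
        rcases this with h0 | h0
        · exact hne h0
        · linarith
      exact (C 0).goal_trivial ξ hξ hx hy0
    · obtain ⟨j, hj⟩ := exists_mult_gt (ν.v a) (C 0).vx
      obtain ⟨n₁, hn₁⟩ := h (2 * j + 4)
      obtain ⟨n₂, hn₂⟩ := lim (ν.v a)
      obtain ⟨n₃, hn₃⟩ := lim ((j + 2 : ℕ) * ν.v x)
      have q2 := hn₂ (n₁ + n₂ + n₃) (by omega)
      have q3 := hn₃ (n₁ + n₂ + n₃) (by omega)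
      have q1 := hn₁ (n₁ + n₂ + n₃) (by omega)
      exact F_zero ξ ha ha0 hax (C _) j hj q2.1 q2.2 q3.1 q3.2 q1.1 q1.2

namespace Tower
variable {ν : KValuation k K ℝ} {f : ℕ → K} (T : Tower ν (f 0))

lemma lam_ld_mem (ξ : Derivation k K K) (hpres : ∀ a ∈ T.O 0, ξ a ∈ T.O 0)
    (hld : ld ξ (T.x 0) ∈ T.O 0) (s : ℕ) : T.lam (s + 1) * ld ξ (T.x (s + 1)) ∈ T.O (s + 1) ∧
    T.lam (s + 1) * ξ (T.y (s + 1)) ∈ T.O (s + 1) := by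
  have hin : ∀ z g : K, g ∈ T.O 0 → g - ev k (T.x 0) (T.y 0) (0 : Pol k) ∈ Er (T.O 0) (T.x 0) (T.y 0) z 0 := by
    intro z g hg
    exact ⟨0, (T.O 0).zero_mem, g, hg, by simp⟩
  obtain ⟨h1, h2, -⟩ := T.eval_tri ξ 0 0 0 0 0 0 (hin _ _ hld) (hin _ _ (hpres _ (T.chart 0).hy)) (hin _ _ (T.O 0).zero_mem) (s + 1)
  rw [(T.tri_zero 0 _).1, map_zero, sub_zero] at h1
  rw [(T.tri_zero 0 _).2, map_zero, sub_zero] at h2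
  constructor
  · obtain ⟨a, ha, b, hb, e⟩ := T.Er_stage s 0 h1
    rw [e]; simpa using hb
  · obtain ⟨a, ha, b, hb, e⟩ := T.Er_stage s 0 h2
    rw [e]; simpa using hb

lemma caseF (F : FSeq ν (T.O 0) (T.x 0) (T.y 0) f) (ξ : Derivation k K K) (s : ℕ)
    (hF : ∀ t ≥ s, T.d t = 1) (hξ : ξ ≠ 0) (hpres : ∀ a ∈ T.O 0, ξ a ∈ T.O 0)
    (hld : ld ξ (T.x 0) ∈ T.O 0) : Goal ν (T.O 0) ξ := by
  have F1 := T.fseq F s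
  obtain ⟨h1, h2⟩ := T.lam_ld_mem ξ hpres hld s
  have hR := T.reach_le (Nat.zero_le (s + 1))
  have h3 : T.lam (s + 1) * ξ (f 0) ∈ T.O (s + 1) := (T.O _).mul_mem (T.lam_mem _) (hR.2 (hpres _ (T.chart 0).hz))
  have hx0 := (T.chart (s + 1)).x0
  have hs : ∀ n, T.x (s + 1 + (n + 1)) = T.x (s + 1 + n) ∧
      T.y (s + 1 + n) = T.x (s + 1 + (n + 1)) ^ T.p (s + 1 + n) * (T.y (s + 1 + (n + 1)) + algebraMap k K (T.c (s + 1 + n))) := by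
    intro n
    have pk := T.pkg (s + 1 + n)
    have hd := hF (s + 1 + n) (by omega)
    have ha := pk.unram hd
    have hb := pk.bez
    rw [ha, hd] at hb
    have ex := pk.ex
    have ey := pk.ey
    rw [hd, ha] at ex
    rw [show T.β (s + 1 + n) = 1 by omega] at ey
    exact ⟨by rw [ex, ← add_assoc]; ring, by rw [ey, ← add_assoc]; ring⟩
  have hx : ∀ n, T.x (s + 1 + n) = T.x (s + 1) := by
    intro n
    induction n with
    | zero => rfl
    | succ n ih => rw [(hs n).1, ih]
  set x := T.x (s + 1) with hxdef
  let Q : ℕ → ℕ := fun n => ∑ j ∈ Finset.range n, T.p (s + 1 + j)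
  have hQs : ∀ n, Q (n + 1) = Q n + T.p (s + 1 + n) := fun n => Finset.sum_range_succ _ _
  have hQ : ∀ n, n ≤ Q n := by
    intro n
    induction n with
    | zero => simp
    | succ n ih => have := (T.pkg (s + 1 + n)).hp; rw [hQs]; omega
  let Y : ℕ → K := fun n => x ^ Q n * T.y (s + 1 + n)
  have hYs : ∀ n, Y (n + 1) = Y n - algebraMap k K (T.c (s + 1 + n)) * x ^ (Q n + T.p (s + 1 + n)) := by
    intro n
    simp only [Y]
    rw [(hs n).2, hx, hQs]; ring
  have hC : ∀ n m, Chart ν (T.O (s + 1)) x (Y n) (f m) := by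
    intro n m
    induction n with
    | zero => simpa [Y, Q] using F1.chart m
    | succ n ih =>
      obtain ⟨p', hp'⟩ := Nat.exists_eq_add_of_le' (T.pkg (s + 1 + n)).hp
      refine ih.change (α := -(algebraMap k K (T.c (s + 1 + n)) * x ^ (Q n + p'))) (β := 1) (γ := 0)
        (Subring.neg_mem _ (Subring.mul_mem _ (ih.algk _) (Subring.pow_mem _ ih.hx _))) (Subring.one_mem _) (Subring.zero_mem _)
        not_vpos_one ?_
      rw [hYs, hp']; ring
  have hvx := (hC 0 0).vx
  refine Goal.trans hR.1 (Goal.smul (T.lam (s + 1)) (F_main (fun n => hC n n) ?_ F1.lim (T.lam (s + 1) • ξ) ?_ h1 ?_ ?_ ?_))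
  · intro B
    obtain ⟨D, hD⟩ := exists_mult_gt B hvx
    refine ⟨D, fun i hi => hD.trans_le ?_⟩
    have hy := T.chart (s + 1 + i)
    have : ν.v (Y i) = Q i * ν.v x + ν.v (T.y (s + 1 + i)) := by
      simp only [Y]
      rw [ν.map_mul' _ _ (pow_ne_zero _ hx0) hy.y0, v_pow ν _ hx0]
    rw [this]
    have h5 : (D : ℝ) ≤ Q i := by exact_mod_cast hi.trans (hQ i)
    nlinarith [hy.vy]
  · intro h0
    exact hξ ((smul_eq_zero.1 h0).resolve_left (T.lam_ne _))
  · rw [Derivation.smul_apply, smul_eq_mul, ← ld_mul_self ξ hx0]; ring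
  · apply (F1.chart 0).mapsInto
    · rw [Derivation.smul_apply, smul_eq_mul, ← ld_mul_self ξ hx0, ← mul_assoc]
      exact (T.O _).mul_mem h1 (F1.chart 0).hx
    · exact h2
    · exact h3
  · intro h0 n
    induction n with
    | zero => rfl
    | succ n ih =>
      have h0' : ξ x = 0 := (mul_eq_zero.1 h0).resolve_left (T.lam_ne _)
      rw [hYs, map_sub, ih, Derivation.leibniz, Derivation.leibniz_pow, h0]
      simp [h0']

lemma rank_one (F : FSeq ν (T.O 0) (T.x 0) (T.y 0) f) (ξ : Derivation k K K) [CharZero k] (hξ : ξ ≠ 0)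
    (hpres : ∀ a ∈ T.O 0, ξ a ∈ T.O 0) (hld : ld ξ (T.x 0) ∈ T.O 0) : Goal ν (T.O 0) ξ := by
  by_cases h : ∀ t, ∃ t' ≥ t, 2 ≤ T.d t'
  · exact T.NF F ξ h hξ hpres hld
  · push Not at h
    obtain ⟨s, hs⟩ := h
    refine T.caseF F ξ s (fun t ht => ?_) hξ hpres hld
    have := hs t ht
    have := (T.pkg t).hd
    omega

end Tower

lemma v_zpow (ν : KValuation k K ℝ) {a : K} (ha : a ≠ 0) (n : ℤ) : ν.v (a ^ n) = n * ν.v a := by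
  obtain ⟨m, rfl | rfl⟩ := n.eq_nat_or_neg
  · rw [zpow_natCast, v_pow ν a ha]; simp
  · rw [zpow_neg, zpow_natCast, v_inv ν _ (pow_ne_zero _ ha), v_pow ν a ha]; simp

lemma v_mon (ν : KValuation k K ℝ) {x y : K} (hx : x ≠ 0) (hy : y ≠ 0) (p q : ℤ) :
    ν.v (x ^ p * y ^ q) = p * ν.v x + q * ν.v y := by
  rw [ν.map_mul' _ _ (zpow_ne_zero _ hx) (zpow_ne_zero _ hy), v_zpow ν hx, v_zpow ν hy]

/-- toric modifications in the first two coordinates -/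
structure Tor (ν : KValuation k K ℝ) (O : Subring K) (x y z : K) (O' : Subring K) (x' y' : K) : Prop where
  reach : Reach ν O O'
  chart : Chart ν O' x' y' z
  li : ∀ p q : ℤ, (p : ℝ) * ν.v x' + q * ν.v y' = 0 → p = 0 ∧ q = 0
  rel : ∃ a b c d : ℕ, x = x' ^ a * y' ^ b ∧ y = x' ^ c * y' ^ d ∧ a * d = b * c + 1

section
variable {ν : KValuation k K ℝ} {O O₁ O₂ : Subring K} {x y z x₁ y₁ x₂ y₂ : K}

lemma Tor.trans (h : Tor ν O x y z O₁ x₁ y₁) (h' : Tor ν O₁ x₁ y₁ z O₂ x₂ y₂) : Tor ν O x y z O₂ x₂ y₂ := by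
  obtain ⟨a, b, c, d, e1, e2, e3⟩ := h.rel
  obtain ⟨a', b', c', d', e1', e2', e3'⟩ := h'.rel
  refine ⟨h.reach.trans h'.reach, h'.chart, h'.li, a * a' + b * c', a * b' + b * d', c * a' + d * c', c * b' + d * d', ?_, ?_, ?_⟩
  · rw [e1, e1', e2']; ring
  · rw [e2, e1', e2']; ring
  · zify at *; linear_combination (a' * d' - b' * c') * e3 + e3'

lemma Tor.mon (h : Tor ν O x y z O₁ x₁ y₁) (p q : ℤ) : ∃ p' q' : ℤ, x ^ p * y ^ q = x₁ ^ p' * y₁ ^ q' := by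
  obtain ⟨a, b, c, d, e1, e2, e3⟩ := h.rel
  have h1 := h.chart.x0
  have h2 := h.chart.y0
  refine ⟨a * p + c * q, b * p + d * q, ?_⟩
  rw [e1, e2, mul_zpow, mul_zpow, zpow_add₀ h1, zpow_add₀ h2, zpow_mul, zpow_mul, zpow_mul, zpow_mul]
  simp only [zpow_natCast]
  ring

lemma tor_e1 (h : Chart ν O x y z) (li : ∀ p q : ℤ, (p : ℝ) * ν.v x + q * ν.v y = 0 → p = 0 ∧ q = 0)
    (hv : ν.v x < ν.v y) : ∃ O', Tor ν O x y z O' x (y / x) := by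
  obtain ⟨O', hR, C⟩ := h.e1 hv
  have hx0 := h.x0
  refine ⟨O', hR, C, ?_, 1, 0, 1, 1, by simp, by field_simp, by norm_num⟩
  intro p q e
  rw [v_div ν _ _ h.y0 h.x0] at e
  have := li (p - q) q (by push_cast; linear_combination e)
  omega

lemma tor_e2 (h : Chart ν O x y z) (li : ∀ p q : ℤ, (p : ℝ) * ν.v x + q * ν.v y = 0 → p = 0 ∧ q = 0)
    (hv : ν.v y < ν.v x) : ∃ O', Tor ν O x y z O' (x / y) y := by
  obtain ⟨O', hR, C⟩ := h.e2 hv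
  have hy0 := h.y0
  refine ⟨O', hR, C, ?_, 1, 1, 0, 1, by field_simp, by simp, by norm_num⟩
  intro p q e
  rw [v_div ν _ _ h.x0 h.y0] at e
  have := li p (q - p) (by push_cast; linear_combination e)
  omega

lemma mon_mem (hx : x ∈ O) (hy : y ∈ O) {p q : ℤ} (hp : 0 ≤ p) (hq : 0 ≤ q) : x ^ p * y ^ q ∈ O := by
  lift p to ℕ using hp
  lift q to ℕ using hq
  rw [zpow_natCast, zpow_natCast]
  exact O.mul_mem (O.pow_mem hx _) (O.pow_mem hy _)

lemma tor_pair (n : ℕ) : ∀ (O : Subring K) (x y z : K), Chart ν O x y z →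
    (∀ p q : ℤ, (p : ℝ) * ν.v x + q * ν.v y = 0 → p = 0 ∧ q = 0) → ∀ p q : ℤ, p.natAbs + q.natAbs ≤ n →
    0 ≤ (p : ℝ) * ν.v x + q * ν.v y → ∃ O' x' y', Tor ν O x y z O' x' y' ∧ x ^ p * y ^ q ∈ O' := by
  induction n with
  | zero =>
    intro O x y z h li p q hn _
    obtain rfl : p = 0 := by omega
    obtain rfl : q = 0 := by omega
    exact ⟨O, x, y, ⟨Reach.refl _ _, h, li, 1, 0, 0, 1, by simp, by simp, by norm_num⟩, by simpa using O.one_mem⟩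
  | succ n ih =>
    intro O x y z h li p q hn hv
    have vx := h.vx
    have vy := h.vy
    have hx0 := h.x0
    have hy0 := h.y0
    by_cases hnn : 0 ≤ p ∧ 0 ≤ q
    · exact ⟨O, x, y, ⟨Reach.refl _ _, h, li, 1, 0, 0, 1, by simp, by simp, by norm_num⟩, mon_mem h.hx h.hy hnn.1 hnn.2⟩
    rcases lt_trichotomy (ν.v x) (ν.v y) with hlt | heq | hgt
    · obtain ⟨O₁, T⟩ := tor_e1 h li hlt
      have e : x ^ p * y ^ q = x ^ (p + q) * (y / x) ^ q := by
        rw [zpow_add₀ hx0, div_zpow]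
        have := zpow_ne_zero q hx0
        field_simp
      by_cases hnn' : 0 ≤ p + q ∧ 0 ≤ q
      · exact ⟨O₁, x, y / x, T, by rw [e]; exact mon_mem T.chart.hx T.chart.hy hnn'.1 hnn'.2⟩
      have hlt' : (p + q).natAbs + q.natAbs ≤ n := by
        rcases lt_or_ge q 0 with hq | hq
        · have hp : 0 < p + q := by
            by_contra hc
            have hc' : (p : ℝ) ≤ -q := by exact_mod_cast (by omega : p ≤ -q)
            have hq' : (q : ℝ) < 0 := by exact_mod_cast hq
            nlinarith
          omega
        · have hq0 : q ≠ 0 := by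
            rintro rfl
            have hp : (p : ℝ) ≤ -1 := by exact_mod_cast (by omega : p ≤ -1)
            simp only [Int.cast_zero, zero_mul, add_zero] at hv
            nlinarith
          omega
      obtain ⟨O₂, x₂, y₂, T₂, m₂⟩ := ih O₁ x (y / x) z T.chart T.li (p + q) q hlt' (by
        rw [v_div ν _ _ hy0 hx0]; push_cast; nlinarith)
      exact ⟨O₂, x₂, y₂, T.trans T₂, by rwa [e]⟩
    · have := li 1 (-1) (by push_cast; linarith)
      omega
    · obtain ⟨O₁, T⟩ := tor_e2 h li hgt
      have e : x ^ p * y ^ q = (x / y) ^ p * y ^ (p + q) := by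
        rw [zpow_add₀ hy0, div_zpow]
        have := zpow_ne_zero p hy0
        field_simp
      by_cases hnn' : 0 ≤ p ∧ 0 ≤ p + q
      · exact ⟨O₁, x / y, y, T, by rw [e]; exact mon_mem T.chart.hx T.chart.hy hnn'.1 hnn'.2⟩
      have hlt' : p.natAbs + (p + q).natAbs ≤ n := by
        rcases lt_or_ge p 0 with hq | hq
        · have hp : 0 < p + q := by
            by_contra hc
            have hc' : (q : ℝ) ≤ -p := by exact_mod_cast (by omega : q ≤ -p)
            have hq' : (p : ℝ) < 0 := by exact_mod_cast hq
            nlinarith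
          omega
        · have hq0 : p ≠ 0 := by
            rintro rfl
            have hp : (q : ℝ) ≤ -1 := by exact_mod_cast (by omega : q ≤ -1)
            simp only [Int.cast_zero, zero_mul, zero_add] at hv
            nlinarith
          omega
      obtain ⟨O₂, x₂, y₂, T₂, m₂⟩ := ih O₁ (x / y) y z T.chart T.li p (p + q) hlt' (by
        rw [v_div ν _ _ hx0 hy0]; push_cast; nlinarith)
      exact ⟨O₂, x₂, y₂, T.trans T₂, by rwa [e]⟩

lemma tor_finset (h : Chart ν O x y z) (li : ∀ p q : ℤ, (p : ℝ) * ν.v x + q * ν.v y = 0 → p = 0 ∧ q = 0)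
    (S : Finset (ℤ × ℤ)) (hS : ∀ s ∈ S, 0 ≤ (s.1 : ℝ) * ν.v x + s.2 * ν.v y) :
    ∃ O' x' y', Tor ν O x y z O' x' y' ∧ ∀ s ∈ S, x ^ s.1 * y ^ s.2 ∈ O' := by
  induction S using Finset.induction_on with
  | empty => exact ⟨O, x, y, ⟨Reach.refl _ _, h, li, 1, 0, 0, 1, by simp, by simp, by norm_num⟩, by simp⟩
  | insert s S hs ih =>
    obtain ⟨O₁, x₁, y₁, T, hT⟩ := ih fun s' hs' => hS s' (by simp [hs'])
    obtain ⟨p', q', e⟩ := T.mon s.1 s.2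
    obtain ⟨O₂, x₂, y₂, T₂, m₂⟩ := tor_pair _ O₁ x₁ y₁ z T.chart T.li p' q' le_rfl (by
      rw [← v_mon ν T.chart.x0 T.chart.y0, ← e, v_mon ν h.x0 h.y0]
      exact hS s (by simp))
    refine ⟨O₂, x₂, y₂, T.trans T₂, ?_⟩
    intro s' hs'
    rcases Finset.mem_insert.1 hs' with rfl | hs'
    · rwa [e]
    · exact T₂.reach.2 (hT s' hs')

end

/-- the maximal ideal, as a set -/
def mS (ν : KValuation k K ℝ) (O : Subring K) : Set K := {a | a ∈ O ∧ VPos ν a}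

section
variable {ν : KValuation k K ℝ} {O O' : Subring K} {x y z : K}

lemma mS_add {a b : K} (ha : a ∈ mS ν O) (hb : b ∈ mS ν O) : a + b ∈ mS ν O := ⟨O.add_mem ha.1 hb.1, ha.2.add hb.2⟩
lemma mS_mul (hc : CenteredAt ν O) {a b : K} (ha : a ∈ O) (hb : b ∈ mS ν O) : a * b ∈ mS ν O :=
  ⟨O.mul_mem ha hb.1, VPos.mul' (hc.vge ha) hb.2⟩
lemma mS_zero : (0 : K) ∈ mS ν O := ⟨O.zero_mem, Or.inl rfl⟩
lemma mS_sum {ι : Type*} (s : Finset ι) (g : ι → K) (h : ∀ i ∈ s, g i ∈ mS ν O) : ∑ i ∈ s, g i ∈ mS ν O := by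
  induction s using Finset.induction_on with
  | empty => simpa using mS_zero
  | insert a s ha ih =>
    rw [Finset.sum_insert ha]
    exact mS_add (h a (by simp)) (ih fun i hi => h i (by simp [hi]))

lemma pw_mS (hO : O ≤ O') (hc : CenteredAt ν O') {M : ℕ} : ∀ {q e : K}, (∀ u v, u + v = M → x ^ u * y ^ v * q ∈ mS ν O') →
    e ∈ pw O x y M → e * q ∈ mS ν O' := by
  induction M with
  | zero =>
    intro q e h he
    exact mS_mul hc (hO he) (by simpa using h 0 0 rfl)
  | succ M ih =>
    intro q e h he
    obtain ⟨a, ha, b, hb, rfl⟩ := he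
    have h1 := ih (q := x * q) (fun u v huv => by
      convert h (u + 1) v (by omega) using 1; ring) ha
    have h2 := ih (q := y * q) (fun u v huv => by
      convert h u (v + 1) (by omega) using 1; ring) hb
    convert mS_add h1 h2 using 1
    ring

/-- result of the toric preparation -/
structure Prep (ν : KValuation k K ℝ) (O : Subring K) (x y z : K) (D M : ℕ) (S : Finset (ℕ × ℕ)) (γ : ℕ × ℕ)
    (O' : Subring K) (x' y' : K) : Prop where
  mem : γ ∈ S
  reach : Reach ν O O'
  chart : Chart ν O' x' y' (z / (x ^ D * y ^ D))
  rel : ∃ a b c d : ℕ, x = x' ^ a * y' ^ b ∧ y = x' ^ c * y' ^ d ∧ a * d = b * c + 1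
  hS : ∀ δ ∈ S, δ ≠ γ → x ^ δ.1 * y ^ δ.2 * (x ^ γ.1 * y ^ γ.2)⁻¹ ∈ mS ν O'
  hN : x ^ D * y ^ D * (x ^ γ.1 * y ^ γ.2)⁻¹ ∈ mS ν O'
  hM : ∀ u v, u + v = M → x ^ u * y ^ v * ((x ^ γ.1 * y ^ γ.2)⁻¹ * ((x * y) ^ (D + 1))⁻¹) ∈ mS ν O'

lemma exists_prep (h : Chart ν O x y z) (li : ∀ p q : ℤ, (p : ℝ) * ν.v x + q * ν.v y = 0 → p = 0 ∧ q = 0)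
    {ε : ℝ} (hx : ε ≤ ν.v x) (hy : ε ≤ ν.v y) {D M : ℕ} (hM : (2 * D + 1) * (ν.v x + ν.v y) < M * ε)
    (hz : D * (ν.v x + ν.v y) < ν.v z) (S : Finset (ℕ × ℕ)) (hS : ∃ γ ∈ S, γ.1 + γ.2 < D) :
    ∃ γ O' x' y', Prep ν O x y z D M S γ O' x' y' := by
  have vx := h.vx
  have vy := h.vy
  have hx0 := h.x0
  have hy0 := h.y0
  obtain ⟨γ₀, hγ₀, hlt⟩ := hS
  obtain ⟨γ, hγ, hmin⟩ := S.exists_min_image (fun δ => (δ.1 : ℝ) * ν.v x + δ.2 * ν.v y) ⟨γ₀, hγ₀⟩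
  have hγD : (γ.1 : ℝ) * ν.v x + γ.2 * ν.v y < D * (ν.v x + ν.v y) := by
    refine (hmin γ₀ hγ₀).trans_lt ?_
    have h1 : (γ₀.1 : ℝ) < D := by exact_mod_cast (by omega : γ₀.1 < D)
    have h2 : (γ₀.2 : ℝ) < D := by exact_mod_cast (by omega : γ₀.2 < D)
    nlinarith
  -- divide `z`
  obtain ⟨O₁, r₁, C₁⟩ := h.divPow D (by nlinarith)
  obtain ⟨O₂, r₂, C₂⟩ := C₁.swap12.divPow D (by
    rw [v_div ν _ _ h.z0 (pow_ne_zero _ hx0), v_pow ν _ hx0]; nlinarith)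
  replace C₂ := C₂.swap12
  rw [div_div] at C₂
  have hcast : ∀ u v : ℕ, x ^ u * y ^ v * (x ^ γ.1 * y ^ γ.2)⁻¹ = x ^ ((u : ℤ) - γ.1) * y ^ ((v : ℤ) - γ.2) := by
    intro u v
    rw [zpow_sub₀ hx0, zpow_sub₀ hy0, zpow_natCast, zpow_natCast, zpow_natCast, zpow_natCast]
    field_simp
  have hcast2 : ∀ u v : ℕ, x ^ u * y ^ v * ((x ^ γ.1 * y ^ γ.2)⁻¹ * ((x * y) ^ (D + 1))⁻¹) =
      x ^ ((u : ℤ) - γ.1 - (D + 1 : ℕ)) * y ^ ((v : ℤ) - γ.2 - (D + 1 : ℕ)) := by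
    intro u v
    rw [zpow_sub₀ hx0, zpow_sub₀ hy0, zpow_sub₀ hx0, zpow_sub₀ hy0, zpow_natCast, zpow_natCast, zpow_natCast, zpow_natCast,
      zpow_natCast, zpow_natCast, mul_pow]
    field_simp
  let S1 : Finset (ℤ × ℤ) := (S.erase γ).image fun δ => ((δ.1 : ℤ) - γ.1, (δ.2 : ℤ) - γ.2)
  let S2 : Finset (ℤ × ℤ) := {((D : ℤ) - γ.1, (D : ℤ) - γ.2)}
  let S3 : Finset (ℤ × ℤ) := (Finset.HasAntidiagonal.antidiagonal M).image fun δ => ((δ.1 : ℤ) - γ.1 - (D + 1 : ℕ), (δ.2 : ℤ) - γ.2 - (D + 1 : ℕ))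
  have hpos : ∀ s ∈ S1 ∪ S2 ∪ S3, 0 < (s.1 : ℝ) * ν.v x + s.2 * ν.v y := by
    intro s hs
    rw [Finset.mem_union, Finset.mem_union] at hs
    rcases hs with (hs | hs) | hs
    · obtain ⟨δ, hδ, rfl⟩ := Finset.mem_image.1 hs
      rw [Finset.mem_erase] at hδ
      have h1 := hmin δ hδ.2
      refine lt_of_le_of_ne (by push_cast; linarith) fun h0 => hδ.1 ?_
      have := li _ _ h0.symm
      dsimp only at this
      ext <;> omega
    · rw [Finset.mem_singleton.1 hs]
      push_cast; linarith
    · obtain ⟨δ, hδ, rfl⟩ := Finset.mem_image.1 hs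
      rw [Finset.HasAntidiagonal.mem_antidiagonal] at hδ
      have h1 : ((δ.1 : ℝ) + δ.2) = M := by exact_mod_cast hδ
      have h2 : (0 : ℝ) ≤ δ.1 := by positivity
      have h3 : (0 : ℝ) ≤ δ.2 := by positivity
      have h4 : M * ε ≤ δ.1 * ν.v x + δ.2 * ν.v y := by rw [← h1]; nlinarith
      push_cast
      nlinarith
  obtain ⟨O₃, x', y', T, hT⟩ := tor_finset C₂ li (S1 ∪ S2 ∪ S3) fun s hs => (hpos s hs).le
  have hm : ∀ s ∈ S1 ∪ S2 ∪ S3, x ^ s.1 * y ^ s.2 ∈ mS ν O₃ := fun s hs =>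
    ⟨hT s hs, Or.inr (by rw [v_mon ν hx0 hy0]; exact hpos s hs)⟩
  refine ⟨γ, O₃, x', y', hγ, (r₁.trans r₂).trans T.reach, T.chart, T.rel, ?_, ?_, ?_⟩
  · intro δ hδ hne
    rw [hcast]
    exact hm _ (Finset.mem_union_left _ (Finset.mem_union_left _ (Finset.mem_image.2 ⟨δ, Finset.mem_erase.2 ⟨hne, hδ⟩, rfl⟩)))
  · rw [hcast]
    exact hm _ (Finset.mem_union_left _ (Finset.mem_union_right _ (Finset.mem_singleton.2 rfl)))
  · intro u v huv
    rw [hcast2]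
    exact hm _ (Finset.mem_union_right _ (Finset.mem_image.2 ⟨(u, v), Finset.HasAntidiagonal.mem_antidiagonal.2 huv, rfl⟩))

/-- bidegree support -/
def supp2 (P : Pol k) : Finset (ℕ × ℕ) := P.support.biUnion fun u => (P.coeff u).support.image fun v => (u, v)

lemma mem_supp2 {P : Pol k} {δ : ℕ × ℕ} : δ ∈ supp2 P ↔ cf P δ.1 δ.2 ≠ 0 := by
  obtain ⟨u, v⟩ := δ
  simp only [supp2, Finset.mem_biUnion, Finset.mem_image, cf, Polynomial.mem_support_iff, Prod.mk.injEq]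
  constructor
  · rintro ⟨a, h1, b, h2, rfl, rfl⟩; exact h2
  · intro h
    exact ⟨u, fun h0 => h (by rw [h0]; simp), v, h, rfl, rfl⟩

lemma ev_supp2 (x y : K) (P : Pol k) : ev k x y P = ∑ δ ∈ supp2 P, algebraMap k K (cf P δ.1 δ.2) * (x ^ δ.1 * y ^ δ.2) := by
  rw [ev_eq_sum, supp2, Finset.sum_biUnion]
  · refine Finset.sum_congr rfl fun u _ => ?_
    rw [Finset.sum_image]
    intro a _ b _ h; simpa using h
  · intro a _ b _ hab
    rw [Function.onFun, Finset.disjoint_left]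
    rintro ⟨u, v⟩ h1 h2
    simp only [Finset.mem_image, Prod.mk.injEq] at h1 h2
    obtain ⟨_, _, h1, _⟩ := h1
    obtain ⟨_, _, h2, _⟩ := h2
    exact hab (h1.trans h2.symm)

namespace Prep
variable {D M : ℕ} {S : Finset (ℕ × ℕ)} {γ : ℕ × ℕ} {x' y' : K}

lemma xy_mem (h : Prep ν O x y z D M S γ O' x' y') (C : Chart ν O x y z) : x * y ∈ O' := h.reach.2 (O.mul_mem C.hx C.hy)

lemma hM' (h : Prep ν O x y z D M S γ O' x' y') (C : Chart ν O x y z) : ∀ u v, u + v = M → x ^ u * y ^ v * (x ^ γ.1 * y ^ γ.2)⁻¹ ∈ mS ν O' := by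
  intro u v huv
  convert mS_mul h.chart.cen (O'.pow_mem (h.xy_mem C) (D + 1)) (h.hM u v huv) using 1
  have := C.x0
  have := C.y0
  field_simp

lemma form (h : Prep ν O x y z D M S γ O' x' y') (C : Chart ν O x y z) {P : Pol k} (hP : supp2 P ⊆ S) {g s e : K} (hs : s ∈ O) (he : e ∈ pw O x y M)
    (E : g = ev k x y P + z * s + e) : ∃ b ∈ mS ν O', g * (x ^ γ.1 * y ^ γ.2)⁻¹ = algebraMap k K (cf P γ.1 γ.2) + b := by
  have hx0 := C.x0
  have hy0 := C.y0
  have C' := h.chart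
  have h1 : z * s * (x ^ γ.1 * y ^ γ.2)⁻¹ ∈ mS ν O' := by
    convert mS_mul C'.cen (O'.mul_mem C'.hz (h.reach.2 hs)) h.hN using 1
    field_simp
  have h2 := pw_mS h.reach.2 C'.cen (h.hM' C) he
  have h3 : ∃ b ∈ mS ν O', ev k x y P * (x ^ γ.1 * y ^ γ.2)⁻¹ = algebraMap k K (cf P γ.1 γ.2) + b := by
    rw [ev_supp2, Finset.sum_mul]
    refine ⟨∑ δ ∈ (supp2 P).erase γ, algebraMap k K (cf P δ.1 δ.2) * (x ^ δ.1 * y ^ δ.2) * (x ^ γ.1 * y ^ γ.2)⁻¹, ?_, ?_⟩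
    · refine mS_sum _ _ fun δ hδ => ?_
      rw [Finset.mem_erase] at hδ
      rw [mul_assoc]
      exact mS_mul C'.cen (C'.algk _) (h.hS δ (hP hδ.2) hδ.1)
    · by_cases hγ : γ ∈ supp2 P
      · rw [← Finset.add_sum_erase _ _ hγ]
        congr 1
        field_simp
      · rw [Finset.erase_eq_of_notMem hγ]
        have : cf P γ.1 γ.2 = 0 := by
          by_contra h0; exact hγ (mem_supp2.2 h0)
        rw [this, map_zero, zero_add]
  obtain ⟨b, hb, e3⟩ := h3
  refine ⟨b + z * s * (x ^ γ.1 * y ^ γ.2)⁻¹ + e * (x ^ γ.1 * y ^ γ.2)⁻¹, mS_add (mS_add hb h1) h2, ?_⟩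
  rw [E]; linear_combination e3

end Prep
end

lemma ld_toric (ξ : Derivation k K K) {x y x' y' : K} (hx : x' ≠ 0) (hy : y' ≠ 0) {a b c d : ℕ}
    (e1 : x = x' ^ a * y' ^ b) (e2 : y = x' ^ c * y' ^ d) (e3 : a * d = b * c + 1) :
    ld ξ x = a * ld ξ x' + b * ld ξ y' ∧ ld ξ y = c * ld ξ x' + d * ld ξ y' ∧
    ld ξ x' = d * ld ξ x - b * ld ξ y ∧ ld ξ y' = a * ld ξ y - c * ld ξ x := by
  have h1 : ld ξ x = a * ld ξ x' + b * ld ξ y' := by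
    rw [e1, ld_mul ξ (pow_ne_zero _ hx) (pow_ne_zero _ hy), ld_pow ξ hx, ld_pow ξ hy]
  have h2 : ld ξ y = c * ld ξ x' + d * ld ξ y' := by
    rw [e2, ld_mul ξ (pow_ne_zero _ hx) (pow_ne_zero _ hy), ld_pow ξ hx, ld_pow ξ hy]
  have h3 : (a * d : K) = b * c + 1 := by exact_mod_cast congrArg (Nat.cast : ℕ → K) e3
  refine ⟨h1, h2, ?_, ?_⟩
  · linear_combination (-(d : K)) * h1 + b * h2 - ld ξ x' * h3
  · linear_combination (-(a : K)) * h2 + c * h1 - ld ξ y' * h3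

lemma der_divxy (ξ : Derivation k K K) {z x y : K} (hz : z ≠ 0) (hx : x ≠ 0) (hy : y ≠ 0) (D : ℕ) :
    ξ (z / (x ^ D * y ^ D)) = ξ z / (x ^ D * y ^ D) - D * (z / (x ^ D * y ^ D)) * (ld ξ x + ld ξ y) := by
  have h1 := der_divPow ξ (mul_ne_zero hx hy) hz D
  rw [ld_mul ξ hx hy, mul_pow] at h1
  exact h1

lemma low_supp2 {D : ℕ} {P : Pol k} (h : Low D P) : ∃ γ ∈ supp2 P, γ.1 + γ.2 < D := by
  obtain ⟨u, v, h1, h2⟩ := h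
  exact ⟨(u, v), mem_supp2.2 h2, h1⟩

section
variable {ν : KValuation k K ℝ} {O : Subring K} {x y : K} {f : ℕ → K}

lemma rank_two_nonzero (F : FSeq ν O x y f) (li : ∀ p q : ℤ, (p : ℝ) * ν.v x + q * ν.v y = 0 → p = 0 ∧ q = 0)
    (ξ : Derivation k K K) (hpres : ∀ a ∈ O, ξ a ∈ O) (hlx : ld ξ x ∈ O) (hly : ld ξ y ∈ O) (D : ℕ)
    (hD : ∀ i₀, ∃ i ≥ i₀, ξ (f i) ∉ Er O x y (f i) D) : Goal ν O ξ := by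
  have vx := (F.chart 0).vx
  have vy := (F.chart 0).vy
  obtain ⟨ε, hε, hεx, hεy⟩ : ∃ ε : ℝ, 0 < ε ∧ ε ≤ ν.v x ∧ ε ≤ ν.v y :=
    ⟨min (ν.v x) (ν.v y), lt_min vx vy, min_le_left _ _, min_le_right _ _⟩
  obtain ⟨M₀, hM₀⟩ := exists_mult_gt ((2 * D + 1) * (ν.v x + ν.v y)) hε
  obtain ⟨M, hM, hDM⟩ : ∃ M : ℕ, (2 * D + 1) * (ν.v x + ν.v y) < M * ε ∧ D ≤ M := by
    refine ⟨M₀ + D, ?_, by omega⟩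
    push_cast
    have : (0 : ℝ) ≤ D * ε := by positivity
    nlinarith
  obtain ⟨i₀, hi₀⟩ := F.lim (D * (ν.v x + ν.v y))
  obtain ⟨i, hi, hn⟩ := hD i₀
  replace hi₀ := hi₀ i hi
  have C := F.chart i
  generalize f i = z at *
  obtain ⟨P, e, he, s, hs, E⟩ := C.expand M (hpres z C.hz)
  have hlow : Low D P := by
    by_contra h
    refine hn ⟨s, hs, ev k x y P + e, pw_add (ev_mem_pw C.algk C.hx C.hy h) (pw_anti C.hx C.hy hDM he), ?_⟩
    rw [E]; ring
  obtain ⟨γ, O', x', y', R⟩ := exists_prep C li hεx hεy hM hi₀ (supp2 P) (low_supp2 hlow)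
  obtain ⟨β, hβ, Eβ⟩ := R.form C (Finset.Subset.refl _) hs he E
  obtain ⟨a, b, c, d, e1, e2, e3⟩ := R.rel
  have C' := R.chart
  have hx0 := C.x0
  have hy0 := C.y0
  obtain ⟨l1, l2, l3, l4⟩ := ld_toric ξ C'.x0 C'.y0 e1 e2 e3
  refine Goal.trans R.reach.1 (Goal.smul (x ^ D * y ^ D * (x ^ γ.1 * y ^ γ.2)⁻¹) ?_)
  have hq := R.hN
  have hlx' := R.reach.2 hlx
  have hly' := R.reach.2 hly
  have hγ0 : cf P γ.1 γ.2 ≠ 0 := mem_supp2.1 R.mem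
  have hder : ξ (z / (x ^ D * y ^ D)) = ξ z / (x ^ D * y ^ D) - D * (z / (x ^ D * y ^ D)) * (ld ξ x + ld ξ y) :=
    der_divxy ξ C.z0 hx0 hy0 D
  set z' := z / (x ^ D * y ^ D) with hz'
  have hm : -(D * z' * (ld ξ x + ld ξ y)) * (x ^ D * y ^ D * (x ^ γ.1 * y ^ γ.2)⁻¹) ∈ mS ν O' :=
    mS_mul C'.cen (O'.neg_mem (O'.mul_mem (O'.mul_mem (natCast_mem O' D) C'.hz) (O'.add_mem hlx' hly'))) hq
  have hc3 : (x ^ D * y ^ D * (x ^ γ.1 * y ^ γ.2)⁻¹) * ξ z' = algebraMap k K (cf P γ.1 γ.2) +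
      (β + -(D * z' * (ld ξ x + ld ξ y)) * (x ^ D * y ^ D * (x ^ γ.1 * y ^ γ.2)⁻¹)) := by
    rw [← add_assoc, ← Eβ, hder]
    field_simp
    ring
  refine C'.goal_two _ (a := x ^ D * y ^ D * (x ^ γ.1 * y ^ γ.2)⁻¹ * ld ξ x') (b := x ^ D * y ^ D * (x ^ γ.1 * y ^ γ.2)⁻¹ * ld ξ y')
    ?_ ?_ (c := algebraMap k K (cf P γ.1 γ.2) + (β + -(D * z' * (ld ξ x + ld ξ y)) * (x ^ D * y ^ D * (x ^ γ.1 * y ^ γ.2)⁻¹)))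
    (O'.add_mem (C'.algk _) (mS_add hβ hm).1) ?_ ?_ ?_ ?_
  · rw [l3]
    exact O'.mul_mem hq.1 (O'.sub_mem (O'.mul_mem (natCast_mem O' _) hlx') (O'.mul_mem (natCast_mem O' _) hly'))
  · rw [l4]
    exact O'.mul_mem hq.1 (O'.sub_mem (O'.mul_mem (natCast_mem O' _) hly') (O'.mul_mem (natCast_mem O' _) hlx'))
  · rw [Derivation.smul_apply, smul_eq_mul, mul_assoc _ (ld ξ x'), ld_mul_self ξ C'.x0]
  · rw [Derivation.smul_apply, smul_eq_mul, mul_assoc _ (ld ξ y'), ld_mul_self ξ C'.y0]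
  · rw [Derivation.smul_apply, smul_eq_mul, hc3]
  · exact Or.inr (Or.inr (C'.not_sq_unit (not_vpos_add hγ0 (mS_add hβ hm).2)))

lemma rank_two_zero (F : FSeq ν O x y f) (li : ∀ p q : ℤ, (p : ℝ) * ν.v x + q * ν.v y = 0 → p = 0 ∧ q = 0)
    (ξ : Derivation k K K) (hξ : ξ ≠ 0) (hlx : ld ξ x ∈ O) (hly : ld ξ y ∈ O)
    (hD : ∀ D, ∃ i₀, ∀ i ≥ i₀, ξ (f i) ∈ Er O x y (f i) D) : Goal ν O ξ := by
  have C0 := F.chart 0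
  have vx := C0.vx
  have vy := C0.vy
  by_cases htriv : ld ξ x = 0 ∧ ld ξ y = 0
  · refine C0.goal_trivial ξ hξ ?_ ?_
    · rw [← ld_mul_self ξ C0.x0, htriv.1, zero_mul]
    · rw [← ld_mul_self ξ C0.y0, htriv.2, zero_mul]
  obtain ⟨ε, hε, hεx, hεy⟩ : ∃ ε : ℝ, 0 < ε ∧ ε ≤ ν.v x ∧ ε ≤ ν.v y :=
    ⟨min (ν.v x) (ν.v y), lt_min vx vy, min_le_left _ _, min_le_right _ _⟩
  obtain ⟨D, hDa⟩ := exists_mult_gt (max (ν.v (ld ξ x)) (ν.v (ld ξ y))) hε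
  obtain ⟨M₀, hM₀⟩ := exists_mult_gt ((2 * D + 1) * (ν.v x + ν.v y)) hε
  obtain ⟨M, hM, hDM⟩ : ∃ M : ℕ, (2 * D + 1) * (ν.v x + ν.v y) < M * ε ∧ D ≤ M := by
    refine ⟨M₀ + D, ?_, by omega⟩
    push_cast
    have : (0 : ℝ) ≤ D * ε := by positivity
    nlinarith
  obtain ⟨i₁, hi₁⟩ := F.lim (D * (ν.v x + ν.v y))
  obtain ⟨i₂, hi₂⟩ := F.lim (max (ν.v (ld ξ x)) (ν.v (ld ξ y)))
  obtain ⟨i₃, hi₃⟩ := hD M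
  obtain ⟨i, j1, j2, j3⟩ : ∃ i, i₁ ≤ i ∧ i₂ ≤ i ∧ i₃ ≤ i := ⟨i₁ + i₂ + i₃, by omega, by omega, by omega⟩
  replace hi₁ := hi₁ i j1
  replace hi₂ := hi₂ i j2
  obtain ⟨r, hr, e, he, Er0⟩ := hi₃ i j3
  have C := F.chart i
  generalize f i = z at *
  obtain ⟨PA, eA, heA, sA, hsA, EA⟩ := C.expand M hlx
  obtain ⟨PB, eB, heB, sB, hsB, EB⟩ := C.expand M hly
  obtain ⟨PG, eG, heG, sG, hsG, EG⟩ := C.expand M hr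
  have hlow : ∃ γ ∈ supp2 PA ∪ supp2 PB ∪ supp2 PG, γ.1 + γ.2 < D := by
    by_cases h0 : ld ξ x = 0
    · have h1 : ld ξ y ≠ 0 := fun h1 => htriv ⟨h0, h1⟩
      obtain ⟨γ, h2, h3⟩ := low_supp2 (C.low h1 ((le_max_right _ _).trans_lt hi₂) hεx hεy
        ((le_max_right _ _).trans_lt hDa) hDM heB hsB EB)
      exact ⟨γ, by simp [h2], h3⟩
    · obtain ⟨γ, h2, h3⟩ := low_supp2 (C.low h0 ((le_max_left _ _).trans_lt hi₂) hεx hεy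
        ((le_max_left _ _).trans_lt hDa) hDM heA hsA EA)
      exact ⟨γ, by simp [h2], h3⟩
  obtain ⟨γ, O', x', y', R⟩ := exists_prep C li hεx hεy hM hi₁ _ hlow
  obtain ⟨bA, hbA, FA⟩ := R.form C (fun δ hδ => by simp [hδ]) hsA heA EA
  obtain ⟨bB, hbB, FB⟩ := R.form C (fun δ hδ => by simp [hδ]) hsB heB EB
  obtain ⟨bG, hbG, FG⟩ := R.form C (fun δ hδ => by simp [hδ]) hsG heG EG
  have hne : cf PA γ.1 γ.2 ≠ 0 ∨ cf PB γ.1 γ.2 ≠ 0 ∨ cf PG γ.1 γ.2 ≠ 0 := by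
    have := R.mem
    simp only [Finset.mem_union, mem_supp2] at this
    tauto
  obtain ⟨a, b, c, d, e1, e2, e3⟩ := R.rel
  have C' := R.chart
  have hx0 := C.x0
  have hy0 := C.y0
  obtain ⟨l1, l2, l3, l4⟩ := ld_toric ξ C'.x0 C'.y0 e1 e2 e3
  have hder : ξ (z / (x ^ D * y ^ D)) = ξ z / (x ^ D * y ^ D) - D * (z / (x ^ D * y ^ D)) * (ld ξ x + ld ξ y) :=
    der_divxy ξ C.z0 hx0 hy0 D
  have ht : e * ((x ^ γ.1 * y ^ γ.2)⁻¹ * ((x * y) ^ (D + 1))⁻¹) ∈ O' := (pw_mS R.reach.2 C'.cen R.hM he).1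
  set t := e * ((x ^ γ.1 * y ^ γ.2)⁻¹ * ((x * y) ^ (D + 1))⁻¹) with htdef
  set z' := z / (x ^ D * y ^ D) with hz'
  have hyO : y ∈ O' := R.reach.2 C.hy
  obtain ⟨a', rfl⟩ : ∃ a', a = a' + 1 := by
    rcases a with _ | a'
    · omega
    · exact ⟨a', rfl⟩
  set mi := (x ^ γ.1 * y ^ γ.2)⁻¹ with hmi
  set A := algebraMap k K (cf PA γ.1 γ.2) + bA with hA
  set B := algebraMap k K (cf PB γ.1 γ.2) + bB with hB
  set G := algebraMap k K (cf PG γ.1 γ.2) + bG with hG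
  have hAO : A ∈ O' := O'.add_mem (C'.algk _) hbA.1
  have hBO : B ∈ O' := O'.add_mem (C'.algk _) hbB.1
  have hGO : G ∈ O' := O'.add_mem (C'.algk _) hbG.1
  have hN : ∀ n : ℕ, (n : K) ∈ O' := fun n => natCast_mem O' n
  have hα : x' ^ a' * y' ^ b * y * t ∈ O' :=
    O'.mul_mem (O'.mul_mem (O'.mul_mem (O'.pow_mem C'.hx _) (O'.pow_mem C'.hy _)) hyO) ht
  have hκ : G - D * (A + B) ∈ O' := O'.sub_mem hGO (O'.mul_mem (hN D) (O'.add_mem hAO hBO))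
  have hXO : d * A - b * B ∈ O' := O'.sub_mem (O'.mul_mem (hN _) hAO) (O'.mul_mem (hN _) hBO)
  have hYO : (a' + 1 : ℕ) * B - c * A ∈ O' := O'.sub_mem (O'.mul_mem (hN _) hBO) (O'.mul_mem (hN _) hAO)
  have hc3 : mi * ξ z' = x' ^ a' * y' ^ b * y * t * x' + 0 * y' + (G - D * (A + B)) * z' := by
    rw [hder, Er0, ← FA, ← FB, ← FG, show x' ^ a' * y' ^ b * y * t * x' = (x' ^ (a' + 1) * y' ^ b) * y * t by ring, ← e1,
      htdef, hz', mul_pow, hmi]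
    field_simp
    ring
  have hX1 : mi * ld ξ x' = d * A - b * B := by
    rw [l3, ← FA, ← FB]; ring
  have hY1 : mi * ld ξ y' = (a' + 1 : ℕ) * B - c * A := by
    rw [l4, ← FA, ← FB]; ring
  have hA1 : A = (a' + 1 : ℕ) * (d * A - b * B) + b * ((a' + 1 : ℕ) * B - c * A) := by
    rw [← hX1, ← hY1, ← FA, l1]; ring
  have hB1 : B = c * (d * A - b * B) + d * ((a' + 1 : ℕ) * B - c * A) := by
    rw [← hX1, ← hY1, ← FB, l2]; ring
  refine Goal.trans R.reach.1 (Goal.smul mi ?_)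
  refine C'.goal_two _ hXO hYO (c := x' ^ a' * y' ^ b * y * t * x' + 0 * y' + (G - D * (A + B)) * z') ?_ ?_ ?_ ?_ ?_
  · exact O'.add_mem (O'.add_mem (O'.mul_mem hα C'.hx) (by simpa using O'.zero_mem)) (O'.mul_mem hκ C'.hz)
  · rw [Derivation.smul_apply, smul_eq_mul, ← ld_mul_self ξ C'.x0, ← mul_assoc, hX1]
  · rw [Derivation.smul_apply, smul_eq_mul, ← ld_mul_self ξ C'.y0, ← mul_assoc, hY1]
  · rw [Derivation.smul_apply, smul_eq_mul, hc3]
  · by_cases hX : VPos ν (d * A - b * B)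
    swap
    · exact Or.inl (C'.not_sq_unit hX)
    by_cases hY : VPos ν ((a' + 1 : ℕ) * B - c * A)
    swap
    · exact Or.inr (Or.inl (C'.not_sq_unit hY))
    have hV : ∀ n : ℕ, VGe ν 0 (n : K) := fun n => C'.cen.vge (hN n)
    have pA : VPos ν A := by
      rw [hA1]; exact (VPos.mul' (hV _) hX).add (VPos.mul' (hV _) hY)
    have pB : VPos ν B := by
      rw [hB1]; exact (VPos.mul' (hV _) hX).add (VPos.mul' (hV _) hY)
    have hG0 : cf PG γ.1 γ.2 ≠ 0 := by
      rcases hne with h | h | h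
      · exact absurd pA (not_vpos_add h hbA.2)
      · exact absurd pB (not_vpos_add h hbB.2)
      · exact h
    refine Or.inr (Or.inr (C'.not_sq_lin hα O'.zero_mem hκ (Or.inr (Or.inr fun hp => ?_))))
    have := hp.add (VPos.mul' (hV D) (pA.add pB))
    rw [sub_add_cancel] at this
    exact not_vpos_add hG0 hbG.2 this

theorem rank_two (F : FSeq ν O x y f) (li : ∀ p q : ℤ, (p : ℝ) * ν.v x + q * ν.v y = 0 → p = 0 ∧ q = 0)
    (ξ : Derivation k K K) (hξ : ξ ≠ 0) (hpres : ∀ a ∈ O, ξ a ∈ O) (hlx : ld ξ x ∈ O) (hly : ld ξ y ∈ O) :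
    Goal ν O ξ := by
  by_cases h : ∀ D, ∃ i₀, ∀ i ≥ i₀, ξ (f i) ∈ Er O x y (f i) D
  · exact rank_two_zero F li ξ hξ hlx hly h
  · push Not at h
    obtain ⟨D, hD⟩ := h
    exact rank_two_nonzero F li ξ hpres hlx hly D hD

end

section
variable {ν : KValuation k K ℝ} {O : Subring K} {x y z : K}

lemma pow_vge (h : Chart ν O x y z) {ε : ℝ} (hx : ε ≤ ν.v x) (hy : ε ≤ ν.v y) (hz : ε ≤ ν.v z) (m : ℕ) :
    ∀ a ∈ maxIdealPow O m, VGe ν (m * ε) a := by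
  induction m with
  | zero =>
    intro a ha
    simpa using h.cen.vge (show a ∈ O from ha)
  | succ m ih =>
    rintro a ⟨n, c, g, hc, hg, rfl⟩
    refine VGe.sum fun i _ => ?_
    obtain ⟨u, w, hu, hw, e⟩ := hg i
    obtain ⟨hu1, hu2⟩ := h.cen.nonunit_iff.1 hu
    obtain ⟨b₁, h₁, b₂, h₂, b₃, h₃, e'⟩ := h.gen_pos hu1 hu2
    have h4 : ∀ {b t : K}, b ∈ O → ε ≤ ν.v t → VGe ν ε (b * t) := fun hb ht => by
      have := (h.cen.vge hb).mul (show VGe ν ε _ from Or.inr ht)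
      rwa [zero_add] at this
    have h5 : VGe ν ε u := by
      rw [e']; exact ((h4 h₁ hx).add (h4 h₂ hy)).add (h4 h₃ hz)
    have h6 := (h.cen.vge (hc i)).mul (h5.mul (ih w hw))
    rw [e]
    exact h6.mono (by push_cast; linarith)

lemma sq_lin (h : Chart ν O x y z) {a : K} (ha : a ∈ maxIdealPow O 2) :
    ∃ b₁ ∈ mS ν O, ∃ b₂ ∈ mS ν O, ∃ b₃ ∈ mS ν O, a = b₁ * x + b₂ * y + b₃ * z := by
  obtain ⟨n, c, g, hc, hg, rfl⟩ := ha
  have key : ∀ i, ∃ b₁ ∈ mS ν O, ∃ b₂ ∈ mS ν O, ∃ b₃ ∈ mS ν O, c i * g i = b₁ * x + b₂ * y + b₃ * z := by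
    intro i
    obtain ⟨u, w, hu, hw, e⟩ := hg i
    have hw' : w ∈ mS ν O := by
      obtain ⟨n', c', g', hc', hg', rfl⟩ := hw
      refine mS_sum _ _ fun j _ => mS_mul h.cen (hc' j) ?_
      obtain ⟨u', w', hu', hw', e'⟩ := hg' j
      rw [e', mul_comm]
      exact mS_mul h.cen (show w' ∈ O from hw') (h.cen.nonunit_iff.1 hu')
    obtain ⟨hu1, hu2⟩ := h.cen.nonunit_iff.1 hu
    obtain ⟨b₁, h₁, b₂, h₂, b₃, h₃, e'⟩ := h.gen_pos hu1 hu2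
    refine ⟨c i * b₁ * w, mS_mul h.cen (O.mul_mem (hc i) h₁) hw', c i * b₂ * w, mS_mul h.cen (O.mul_mem (hc i) h₂) hw',
      c i * b₃ * w, mS_mul h.cen (O.mul_mem (hc i) h₃) hw', ?_⟩
    rw [e, e']; ring
  choose b₁ h₁ b₂ h₂ b₃ h₃ e using key
  refine ⟨∑ i, b₁ i, mS_sum _ _ fun i _ => h₁ i, ∑ i, b₂ i, mS_sum _ _ fun i _ => h₂ i, ∑ i, b₃ i,
    mS_sum _ _ fun i _ => h₃ i, ?_⟩
  simp only [e, Finset.sum_add_distrib, Finset.sum_mul]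

lemma setup_seq {g : ℕ → K} (h : Chart ν O x y (g 0)) (h0 : ∀ i, g i ≠ 0)
    (hinc : ∀ i, ν.v (g i) < ν.v (g (i + 1)))
    (hconv : ∀ m : ℕ, ∃ N : ℕ, ∀ i, N ≤ i → g (i + 1) - g i ∈ maxIdealPow O m)
    (h2 : ∀ i, g (i + 1) - g i ∈ maxIdealPow O 2) : FSeq ν O x y g := by
  have key : ∀ i, ∃ b₁ ∈ mS ν O, ∃ b₂ ∈ mS ν O, ∃ b₃ ∈ mS ν O, g i = b₁ * x + b₂ * y + (1 + b₃) * g 0 := by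
    intro i
    induction i with
    | zero => exact ⟨0, mS_zero, 0, mS_zero, 0, mS_zero, by ring⟩
    | succ i ih =>
      obtain ⟨b₁, h₁, b₂, h₂, b₃, h₃, e⟩ := ih
      obtain ⟨c₁, k₁, c₂, k₂, c₃, k₃, e'⟩ := sq_lin h (h2 i)
      exact ⟨b₁ + c₁, mS_add h₁ k₁, b₂ + c₂, mS_add h₂ k₂, b₃ + c₃, mS_add h₃ k₃, by linear_combination e + e'⟩
  have rel : ∀ i, ∃ b₁ ∈ O, ∃ b₂ ∈ O, ∃ u ∈ O, ¬ VPos ν u ∧ g i = b₁ * x + b₂ * y + u * g 0 := by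
    intro i
    obtain ⟨b₁, h₁, b₂, h₂, b₃, h₃, e⟩ := key i
    refine ⟨b₁, h₁.1, b₂, h₂.1, 1 + b₃, O.add_mem O.one_mem h₃.1, ?_, e⟩
    have := not_vpos_add (ν := ν) (one_ne_zero (α := k)) h₃.2
    rwa [map_one] at this
  refine ⟨fun i => ?_, ?_, rel⟩
  · obtain ⟨b₁, h₁, b₂, h₂, u, hu, hn, e⟩ := rel i
    exact h.change3 h₁ h₂ hu hn e
  · intro B
    obtain ⟨ε, hε, hx, hy, hz⟩ : ∃ ε : ℝ, 0 < ε ∧ ε ≤ ν.v x ∧ ε ≤ ν.v y ∧ ε ≤ ν.v (g 0) :=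
      ⟨min (ν.v x) (min (ν.v y) (ν.v (g 0))), lt_min h.vx (lt_min h.vy h.vz), min_le_left _ _,
        (min_le_right _ _).trans (min_le_left _ _), (min_le_right _ _).trans (min_le_right _ _)⟩
    obtain ⟨m, hm⟩ := exists_mult_gt B hε
    obtain ⟨N, hN⟩ := hconv m
    refine ⟨N, fun i hi => hm.trans_le ?_⟩
    by_contra hlt
    push Not at hlt
    have h1 := pow_vge h hx hy hz m _ (hN i hi)
    have h3 : VGe ν (min (ν.v (g (i + 1))) (m * ε)) (g i) := by
      have := (show VGe ν (min (ν.v (g (i + 1))) (m * ε)) (g (i + 1)) from Or.inr (min_le_left _ _)).add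
        (h1.mono (min_le_right (ν.v (g (i + 1))) _)).neg
      convert this using 1; ring
    exact absurd (lt_min (hinc i) hlt) (not_lt.2 (h3.resolve_left (h0 i)))

lemma scale (h : Chart ν O x y z) (frac : ∀ u : K, ∃ a b : K, a ∈ O ∧ b ∈ O ∧ b ≠ 0 ∧ u = a / b)
    (ξ : Derivation k K K) (hξ : ξ ≠ 0) : ∃ q : K, q • ξ ≠ 0 ∧ (∀ a ∈ O, (q • ξ) a ∈ O) ∧
      ld (q • ξ) x ∈ O ∧ ld (q • ξ) y ∈ O := by
  obtain ⟨a₁, b₁, ha₁, hb₁, n₁, e₁⟩ := frac (ξ x)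
  obtain ⟨a₂, b₂, ha₂, hb₂, n₂, e₂⟩ := frac (ξ y)
  obtain ⟨a₃, b₃, ha₃, hb₃, n₃, e₃⟩ := frac (ξ z)
  have x0 := h.x0
  have y0 := h.y0
  have hx := h.hx
  have hy := h.hy
  have m1 : ld ((b₁ * b₂ * b₃ * x * y) • ξ) x = a₁ * b₂ * b₃ * y := by
    rw [ld_smul, ld, e₁]; field_simp
  have m2 : ld ((b₁ * b₂ * b₃ * x * y) • ξ) y = b₁ * a₂ * b₃ * x := by
    rw [ld_smul, ld, e₂]; field_simp
  have m1' : ld ((b₁ * b₂ * b₃ * x * y) • ξ) x ∈ O := by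
    rw [m1]; exact O.mul_mem (O.mul_mem (O.mul_mem ha₁ hb₂) hb₃) hy
  have m2' : ld ((b₁ * b₂ * b₃ * x * y) • ξ) y ∈ O := by
    rw [m2]; exact O.mul_mem (O.mul_mem (O.mul_mem hb₁ ha₂) hb₃) hx
  refine ⟨b₁ * b₂ * b₃ * x * y, ?_, ?_, m1', m2'⟩
  · intro h0
    apply hξ
    ext a
    have := congrArg (fun η : Derivation k K K => η a) h0
    simpa [n₁, n₂, n₃, x0, y0] using this
  · refine h.mapsInto _ ?_ ?_ ?_
    · rw [← ld_mul_self _ x0]; exact O.mul_mem m1' hx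
    · rw [← ld_mul_self _ y0]; exact O.mul_mem m2' hy
    · have : ((b₁ * b₂ * b₃ * x * y) • ξ) z = b₁ * b₂ * a₃ * x * y := by
        rw [Derivation.smul_apply, smul_eq_mul, e₃]; field_simp
      rw [this]
      exact O.mul_mem (O.mul_mem (O.mul_mem (O.mul_mem hb₁ hb₂) ha₃) hx) hy

end

/-- the generator of a foliation as a derivation -/
def FoliationByLines.der (L : FoliationByLines k K) : Derivation k K K :=
  Derivation.mk' (R := k) (A := K) (M := K)
    { toFun := L.gen
      map_add' := L.isDer.map_add
      map_smul' := fun c a => by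
        rw [Algebra.smul_def, L.isDer.leibniz, L.isDer.map_algebra, mul_zero, add_zero, RingHom.id_apply, Algebra.smul_def] }
    (fun a b => by simpa using L.isDer.leibniz a b)

lemma FoliationByLines.der_apply (L : FoliationByLines k K) (a : K) : L.der a = L.gen a := rfl

lemma FoliationByLines.der_ne (L : FoliationByLines k K) : L.der ≠ 0 := by
  intro h
  apply L.ne
  ext a
  rw [← L.der_apply, h]; rfl

theorem main_aux [CharZero k]
    (hK : IsFunctionField k K 3)
    (ν : KValuation k K ℝ) (hres : ν.ResidueFieldIsK)
    (r : ℕ) (hrk : ν.HasRationalRank r)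
    (ξ : Derivation k K K) (hξ : ξ ≠ 0)
    (O : Subring K) (hO : IsLocalModel k O) (hc : CenteredAt ν O)
    (hreg : ∃ z : Fin 3 → K, IsRSP O z)
    (hmc : TransversalMaxContact ν O r) : Goal ν O ξ := by
  obtain ⟨f, hfO, hinc, hconv, x, -, hli, N, hN⟩ := hmc
  obtain ⟨w, hw⟩ := hreg
  obtain ⟨N₂, hN₂⟩ := hconv 2
  -- the parameters are part of a system of three parameters
  have hz : ∀ i, N ≤ i → ∃ (h : r + 1 ≤ 3) (z : Fin 3 → K), IsRSP O z ∧
      ∀ j : Fin (r + 1), z (Fin.castLE h j) = Fin.snoc (α := fun _ => K) x (f i) j := by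
    intro i hi
    obtain ⟨m', h, z, h1, h2⟩ := hN i hi
    obtain rfl : m' = 3 := le_antisymm (rsp_card_le hres hc hO.algk hw h1) (rsp_card_le hres hc hO.algk h1 hw)
    exact ⟨h, z, h1, h2⟩
  have hf0 : ∀ i, N ≤ i → f i ≠ 0 := by
    intro i hi
    obtain ⟨h, z, h1, h2⟩ := hz i hi
    have := h2 (Fin.last r)
    rw [Fin.snoc_last] at this
    rw [← this]
    exact h1.ne_zero hc _
  obtain ⟨h3, z, hzR, hzx⟩ := hz (N + N₂) (by omega)
  have hseq : ∀ y₁ y₂, Chart ν O y₁ y₂ (f (N + N₂)) → FSeq ν O y₁ y₂ (fun i => f (N + N₂ + i)) := by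
    intro y₁ y₂ C
    refine setup_seq C (fun i => hf0 _ (by omega)) (fun i => hinc _) (fun m => ?_) (fun i => hN₂ (N + N₂ + i) (by omega))
    obtain ⟨N', hN'⟩ := hconv m
    exact ⟨N', fun i hi => hN' (N + N₂ + i) (by omega)⟩
  have C := setup_chart hK hres hO hc hzR
  obtain rfl | rfl | rfl : r = 0 ∨ r = 1 ∨ r = 2 := by omega
  · exfalso
    apply hrk.2
    obtain ⟨u, hu, hv⟩ := ν.nontrivial'
    refine ⟨fun _ => u, fun _ => hu, ?_⟩
    have : Unique (Fin (0 + 1)) := inferInstanceAs (Unique (Fin 1))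
    rw [linearIndependent_unique_iff]
    exact hv
  · have e0 : z 1 = f (N + N₂) := by
      have := hzx (Fin.last 1)
      rw [Fin.snoc_last] at this
      exact this
    rw [e0] at C
    have C' := C.swap23
    obtain ⟨q, q0, q1, q2, q3⟩ := scale C' hO.frac ξ hξ
    have F := hseq _ _ C'
    obtain ⟨T, t1, t2, t3⟩ := exists_tower hres hrk (F.chart 0)
    refine Goal.smul q ?_
    rw [← t1, ← t2, ← t3] at F
    rw [← t1, ← t2] at q2
    rw [← t1] at q1
    rw [← t1]
    exact Tower.rank_one (f := fun i => f (N + N₂ + i)) T F _ q0 q1 q2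
  · have e0 : z 2 = f (N + N₂) := by
      have := hzx (Fin.last 2)
      rw [Fin.snoc_last] at this
      exact this
    have e1 : z 0 = x 0 := by
      have := hzx (Fin.castSucc 0)
      rw [Fin.snoc_castSucc] at this
      exact this
    have e2 : z 1 = x 1 := by
      have := hzx (Fin.castSucc 1)
      rw [Fin.snoc_castSucc] at this
      exact this
    rw [e0] at C
    obtain ⟨q, q0, q1, q2, q3⟩ := scale C hO.frac ξ hξ
    have F := hseq _ _ C
    refine Goal.smul q (rank_two F ?_ _ q0 q1 q2 q3)
    intro a b hab
    rw [e1, e2] at hab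
    rw [Fintype.linearIndependent_iff] at hli
    have := hli ![a, b] (by simpa [Fin.sum_univ_two] using hab)
    exact ⟨this 0, this 1⟩

/-- **Theorem 4 (maximal contact).** Assume `n = 3`.  Let `ν` be a real `k`-valuation
of `K` with residue field `κ_ν = k` and suppose that some `f̂ ∈ Ô_{M₀,P}` has
transversal maximal contact with `ν` (with `P`, the center of `ν` on `M₀`, a regular
point).  There is a finite composition of blow-ups with non-singular centers
`M → M₀` such that `ℒ` is log-elementary at the center `P` of `ν`. -/
theorem maximal_contact_gives_log_elementary
    {k K : Type} [Field k] [IsAlgClosed k] [CharZero k] [Field K] [Algebra k K]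
    (hK : IsFunctionField k K 3)
    (ν : KValuation k K ℝ) (hres : ν.ResidueFieldIsK)
    (r : ℕ) (hrk : ν.HasRationalRank r)
    (L : FoliationByLines k K)
    (O₀ : Subring K) (hO₀ : IsLocalModel k O₀) (hc₀ : CenteredAt ν O₀)
    (hreg : ∃ z : Fin 3 → K, IsRSP O₀ z)
    (hmc : TransversalMaxContact ν O₀ r) :
    ∃ O : Subring K, Relation.ReflTransGen (LocalBlowUpStep ν) O₀ O ∧
      CenteredAt ν O ∧ LogElementaryAt L.Mem O := by
  have h := main_aux hK ν hres r hrk L.der L.der_ne O₀ hO₀ hc₀ hreg hmc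
  exact h

end FoliationLU
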